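/- Let M be a subcomplex of I^n of dimension d whose geometric realization |M| is a compact topological d-manifold without boundary (in particular a ℤ/2-homology d-manifold, the paper's hypothesis), let k ≥ 2, and let S ⊆ M be a subcomplex isomorphic to ∂I^{k+1}. Then S is the boundary of a (k+1)-dimensional face of M (i.e. S = ∂F̂ for some (k+1)-dimensional face F ∈ M) if and only if H_j(|M ∖ S|; ℤ/2) ≅ H_j(|M|; ℤ/2) for both j = d − k and j = d − k − 1. -/

import Mathlib

/-- A face of the cube `I^n`: `none` marks a free coordinate. -/
def CubeFace (n : ℕ) : Type := Fin n → Option Bool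

namespace CubeFace

/-- The order on faces of the cube: `F ≤ G` iff every coordinate of `G` is free
or agrees with the corresponding coordinate of `F`. -/
instance (n : ℕ) : PartialOrder (CubeFace n) where
  le F G := ∀ i, G i = none ∨ F i = G i
  le_refl F i := Or.inr rfl
  le_trans F G H h1 h2 i := by
    rcases h2 i with h | h
    · exact Or.inl h
    · rcases h1 i with h' | h'
      · exact Or.inl (h ▸ h')
      · exact Or.inr (h' ▸ h)
  le_antisymm F G h1 h2 := by
    funext i
    rcases h1 i with h | h
    · rcases h2 i with h' | h'
      · rw [h, h']
      · rw [← h', h]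
    · exact h

/-- The face of `I^n` corresponding to a vertex. -/
def toFace {n : ℕ} (v : Fin n → Bool) : CubeFace n := fun i => some (v i)

/-- The vertex set of a face. -/
def verts {n : ℕ} (F : CubeFace n) : Set (Fin n → Bool) := {v | toFace v ≤ F}

/-- The dimension of a face: its number of free coordinates. -/
def dim {n : ℕ} (F : CubeFace n) : ℕ :=
  haveI : DecidablePred (fun i => F i = none) := fun i => decEq (α := Option Bool) (F i) none
  (Finset.univ.filter (fun i => F i = none)).card

/-- A subcomplex of `I^n`: a nonempty, downward closed set of faces. -/
def IsSubcomplex {n : ℕ} (K : Set (CubeFace n)) : Prop :=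
  K.Nonempty ∧ ∀ F ∈ K, ∀ G : CubeFace n, G ≤ F → G ∈ K

/-- The vertex set of a subcomplex. -/
def cvert {n : ℕ} (K : Set (CubeFace n)) : Set (Fin n → Bool) := {v | toFace v ∈ K}

/-- A subcomplex `Γ ⊆ K` is face-like if, for every face `F` of `K`, the set of vertices
of `F` belonging to `Γ` is empty or the vertex set of a face of `Γ`. -/
def FaceLike {n : ℕ} (K Γ : Set (CubeFace n)) : Prop :=
  ∀ F ∈ K, verts F ∩ cvert Γ = ∅ ∨ ∃ G ∈ Γ, verts F ∩ cvert Γ = verts G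

/-- The deletion `K ∖ Γ`: the faces of `K` with no vertex in `Γ`. -/
def delete {n : ℕ} (K Γ : Set (CubeFace n)) : Set (CubeFace n) :=
  {F | F ∈ K ∧ verts F ∩ cvert Γ = ∅}

/-- The geometric realization of a subcomplex of `I^n`, as a subset of `ℝ^n`. -/
def real {n : ℕ} (K : Set (CubeFace n)) : Set (Fin n → ℝ) :=
  ⋃ F ∈ K, {x | (∀ i, 0 ≤ x i ∧ x i ≤ 1) ∧
    ∀ i, (F i = some false → x i = 0) ∧ (F i = some true → x i = 1)}

/-- The boundary `∂F̂` of a face `F`: all faces strictly below `F`. -/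
def bdryHat {n : ℕ} (F : CubeFace n) : Set (CubeFace n) := {G | G ≤ F ∧ G ≠ F}

/-- The boundary of the cube `I^k`: all faces except the top one. -/
def boundaryCube (k : ℕ) : Set (CubeFace k) := {F | F ≠ fun _ => none}

/-- The `k`-skeleton of a subcomplex. -/
def skel {n : ℕ} (k : ℕ) (K : Set (CubeFace n)) : Set (CubeFace n) :=
  {F | F ∈ K ∧ dim F ≤ k}

/-- Isomorphism of cubical subcomplexes: a bijection between the vertex sets under which
vertex sets of faces correspond to vertex sets of faces. -/
def Iso {m n : ℕ} (K : Set (CubeFace m)) (L : Set (CubeFace n)) : Prop :=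
  ∃ f : (Fin m → Bool) → (Fin n → Bool),
    Set.BijOn f (cvert K) (cvert L) ∧
    ∀ W : Set (Fin m → Bool), W ⊆ cvert K →
      ((∃ F ∈ K, verts F = W) ↔ (∃ G ∈ L, verts G = f '' W))

/-- `K` has dimension `d`. -/
def HasDim {n : ℕ} (K : Set (CubeFace n)) (d : ℕ) : Prop :=
  (∀ F ∈ K, dim F ≤ d) ∧ ∃ F ∈ K, dim F = d

end CubeFace

open CategoryTheory in
/-- The `j`-th singular homology of a topological space with coefficients in `R`. -/
noncomputable def sHomology (R : Type) [CommRing R] (X : Type) [TopologicalSpace X]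
    (j : ℕ) : ModuleCat R :=
  ((AlgebraicTopology.alternatingFaceMapComplex (ModuleCat R)).obj
    (((SimplicialObject.whiskering _ _).obj (ModuleCat.free R)).obj
      (TopCat.toSSet.obj (TopCat.of X)))).homology j

/-- `X` is a compact topological `d`-manifold without boundary. -/
def IsCompactManifold (X : Type) [TopologicalSpace X] (d : ℕ) : Prop :=
  CompactSpace X ∧ Nonempty (ChartedSpace (EuclideanSpace ℝ (Fin d)) X)



namespace BF

open CubeFace

/-- In a module over `ZMod 2`, everything is its own negative. -/
theorem two_self {V : Type*} [AddCommGroup V] [Module (ZMod 2) V] (v : V) : v + v = 0 := by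
  have h : (2 : ZMod 2) • v = 0 := by
    have : (2 : ZMod 2) = 0 := by decide
    rw [this, zero_smul]
  rwa [two_smul] at h

theorem add_eq_zero_iff' {V : Type*} [AddCommGroup V] [Module (ZMod 2) V] {v w : V} :
    v + w = 0 ↔ v = w := by
  constructor
  · intro h
    have := two_self w
    grind
  · rintro rfl
    exact two_self v

/-- A linear map is controlled on supported elements by its values on basis elements. -/
theorem map_supported {B V : Type*} [AddCommGroup V] [Module (ZMod 2) V]
    (f : (B →₀ ZMod 2) →ₗ[ZMod 2] V) (W : Submodule (ZMod 2) V) (s : Set B)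
    (h : ∀ b ∈ s, f (Finsupp.single b 1) ∈ W) (c : B →₀ ZMod 2)
    (hc : c ∈ Finsupp.supported (ZMod 2) (ZMod 2) s) : f c ∈ W := by
  rw [Finsupp.supported_eq_span_single] at hc
  have : Submodule.span (ZMod 2) ((fun i => Finsupp.single i (1 : ZMod 2)) '' s) ≤ W.comap f := by
    rw [Submodule.span_le]
    rintro _ ⟨b, hb, rfl⟩
    exact h b hb
  exact this hc

theorem eq_on_supported {B V : Type*} [AddCommGroup V] [Module (ZMod 2) V]
    (f g : (B →₀ ZMod 2) →ₗ[ZMod 2] V) (s : Set B)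
    (h : ∀ b ∈ s, f (Finsupp.single b 1) = g (Finsupp.single b 1)) (c : B →₀ ZMod 2)
    (hc : c ∈ Finsupp.supported (ZMod 2) (ZMod 2) s) : f c = g c := by
  have := map_supported (f - g) ⊥ s (by intro b hb; simp [h b hb]) c hc
  simpa [sub_eq_zero] using this

/-- Supported elements on a union split. -/
theorem supported_split {B : Type*} {s t : Set B} {c : B →₀ ZMod 2}
    (hc : c ∈ Finsupp.supported (ZMod 2) (ZMod 2) (s ∪ t)) :
    ∃ a ∈ Finsupp.supported (ZMod 2) (ZMod 2) s, ∃ b ∈ Finsupp.supported (ZMod 2) (ZMod 2) t,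
      c = a + b := by
  rw [Finsupp.supported_union, Submodule.mem_sup] at hc
  obtain ⟨a, ha, b, hb, h⟩ := hc
  exact ⟨a, ha, b, hb, h.symm⟩

theorem supported_inter_mem {B : Type*} {s t : Set B} {c : B →₀ ZMod 2}
    (h1 : c ∈ Finsupp.supported (ZMod 2) (ZMod 2) s)
    (h2 : c ∈ Finsupp.supported (ZMod 2) (ZMod 2) t) :
    c ∈ Finsupp.supported (ZMod 2) (ZMod 2) (s ∩ t) := by
  rw [Finsupp.mem_supported] at *
  exact Set.subset_inter h1 h2

theorem supported_empty_eq {B : Type*} {c : B →₀ ZMod 2}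
    (h1 : c ∈ Finsupp.supported (ZMod 2) (ZMod 2) (∅ : Set B)) : c = 0 := by
  simpa using h1

/-- homology of `∂` with `j`-chains `W` and `j+1`-chains `W'`. -/
abbrev Hq {V : Type*} [AddCommGroup V] [Module (ZMod 2) V] (D : V →ₗ[ZMod 2] V)
    (W W' : Submodule (ZMod 2) V) : Type _ :=
  ↥(W ⊓ LinearMap.ker D) ⧸ ((W'.map D).submoduleOf (W ⊓ LinearMap.ker D))

/-- A linear map of cycle modules, which is bijective modulo boundaries,
gives an isomorphism of homology. -/
theorem quot_equiv {V V' : Type*} [AddCommGroup V] [Module (ZMod 2) V]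
    [AddCommGroup V'] [Module (ZMod 2) V']
    (f : V →ₗ[ZMod 2] V') (P : Submodule (ZMod 2) V) (P' : Submodule (ZMod 2) V')
    (hP : ∀ v, f v ∈ P' ↔ v ∈ P) (hs : ∀ w, ∃ v, w + f v ∈ P') :
    Nonempty ((V ⧸ P) ≃ₗ[ZMod 2] (V' ⧸ P')) := by
  have hle : P ≤ P'.comap f := fun v hv => (hP v).2 hv
  refine ⟨LinearEquiv.ofBijective (P.mapQ P' f hle) ⟨?_, ?_⟩⟩
  · rw [← LinearMap.ker_eq_bot, Submodule.ker_mapQ]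
    have : P'.comap f ≤ P := fun v hv => (hP v).1 hv
    rw [eq_bot_iff]
    rintro _ ⟨v, hv, rfl⟩
    rw [Submodule.mem_bot, Submodule.mkQ_apply, Submodule.Quotient.mk_eq_zero]
    exact this hv
  · intro w
    obtain ⟨w, rfl⟩ := Submodule.mkQ_surjective _ w
    obtain ⟨v, hv⟩ := hs w
    refine ⟨P.mkQ v, ?_⟩
    simp only [Submodule.mkQ_apply, Submodule.mapQ_apply]
    rw [Submodule.Quotient.eq]
    have : f v - w = w + f v := by
      have := two_self w
      grind
    rwa [this]

/-! ### Cellular chains -/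

noncomputable section

open Classical in
theorem dim_eq {n : ℕ} (F : CubeFace n) :
    dim F = (Finset.univ.filter (fun i => F i = none)).card := by
  unfold dim
  congr

/-- cellular chains of the cube -/
abbrev Cell (n : ℕ) : Type := CubeFace n →₀ ZMod 2

/-- replace one coordinate -/
def upd {n : ℕ} (F : CubeFace n) (i : Fin n) (b : Option Bool) : CubeFace n :=
  fun j => if j = i then b else F j

theorem face_ext {n : ℕ} {F G : CubeFace n} (h : ∀ i, F i = G i) : F = G := funext h

theorem upd_apply {n : ℕ} (F : CubeFace n) (i j : Fin n) (b : Option Bool) :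
    upd F i b j = if j = i then b else F j := rfl

@[simp] theorem upd_same {n : ℕ} (F : CubeFace n) (i : Fin n) (b : Option Bool) :
    upd F i b i = b := by simp [upd_apply]

theorem upd_ne {n : ℕ} (F : CubeFace n) {i j : Fin n} (h : j ≠ i) (b : Option Bool) :
    upd F i b j = F j := by simp [upd_apply, h]

theorem upd_self {n : ℕ} (F : CubeFace n) (i : Fin n) (b : Option Bool) (h : F i = b) :
    upd F i b = F := by
  apply face_ext
  intro j
  rw [upd_apply]
  split_ifs with hj
  · rw [hj, h]
  · rfl

theorem upd_upd {n : ℕ} (F : CubeFace n) (i : Fin n) (b c : Option Bool) :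
    upd (upd F i b) i c = upd F i c := by
  apply face_ext
  intro j
  simp only [upd_apply]
  split_ifs <;> rfl

theorem upd_comm {n : ℕ} (F : CubeFace n) {i j : Fin n} (h : i ≠ j) (b c : Option Bool) :
    upd (upd F i b) j c = upd (upd F j c) i b := by
  apply face_ext
  intro k
  simp only [upd_apply]
  split_ifs with h1 h2
  · exact absurd (h2.symm.trans h1) h
  all_goals rfl

theorem le_iff {n : ℕ} (F G : CubeFace n) : F ≤ G ↔ ∀ i, G i = none ∨ F i = G i := Iff.rfl

open Classical in
theorem dim_upd_some {n : ℕ} (F : CubeFace n) (i : Fin n) (b : Bool) (h : F i = none) :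
    dim (upd F i (some b)) + 1 = dim F := by
  rw [dim_eq, dim_eq]
  have : (Finset.univ.filter (fun j => F j = none))
      = insert i (Finset.univ.filter (fun j => upd F i (some b) j = none)) := by
    ext j
    by_cases hj : j = i
    · subst hj; simp [h]
    · simp [hj, upd_ne F hj]
  rw [this, Finset.card_insert_of_notMem (by simp)]

theorem upd_some_le {n : ℕ} (F : CubeFace n) (i : Fin n) (b : Option Bool) (h : F i = none) :
    upd F i b ≤ F := by
  intro j
  by_cases hj : j = i
  · subst hj; exact Or.inl h
  · exact Or.inr (upd_ne F hj b)

/-- the boundary in direction `i` -/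
def bd1 {n : ℕ} (i : Fin n) : Cell n →ₗ[ZMod 2] Cell n :=
  Finsupp.lsum (ZMod 2) fun F => LinearMap.toSpanSingleton (ZMod 2) _
    (if F i = none then Finsupp.single (upd F i (some false)) 1
      + Finsupp.single (upd F i (some true)) 1 else 0)

theorem bd1_single {n : ℕ} (i : Fin n) (F : CubeFace n) :
    bd1 i (Finsupp.single F 1) = if F i = none then Finsupp.single (upd F i (some false)) 1
      + Finsupp.single (upd F i (some true)) 1 else 0 := by
  simp [bd1]

/-- the cellular boundary -/
def bd {n : ℕ} : Cell n →ₗ[ZMod 2] Cell n := ∑ i, bd1 i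

theorem bd1_bd1 {n : ℕ} (i : Fin n) (c : Cell n) : bd1 i (bd1 i c) = 0 := by
  have : (bd1 i) ∘ₗ (bd1 i) = (0 : Cell n →ₗ[ZMod 2] Cell n) := by
    apply Finsupp.lhom_ext'
    intro F
    apply LinearMap.ext_ring
    simp only [LinearMap.comp_apply, Finsupp.lsingle_apply, bd1_single]
    split_ifs
    · simp [bd1_single]
    · simp
  exact DFunLike.congr_fun this c

theorem bd1_comm {n : ℕ} {i j : Fin n} (h : i ≠ j) (c : Cell n) :
    bd1 i (bd1 j c) = bd1 j (bd1 i c) := by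
  have : (bd1 i) ∘ₗ (bd1 j) = ((bd1 j) ∘ₗ (bd1 i) : Cell n →ₗ[ZMod 2] Cell n) := by
    apply Finsupp.lhom_ext'
    intro F
    apply LinearMap.ext_ring
    simp only [LinearMap.comp_apply, Finsupp.lsingle_apply, bd1_single]
    by_cases h1 : F i = none <;> by_cases h2 : F j = none <;>
      simp [h1, h2, bd1_single, upd_ne _ h, upd_ne _ h.symm, upd_comm F h]
    abel
  exact DFunLike.congr_fun this c

theorem bd_bd {n : ℕ} (c : Cell n) : bd (bd c) = 0 := by
  simp only [bd, LinearMap.sum_apply, map_sum]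
  rw [← Finset.sum_product']
  refine Finset.sum_involution (fun p _ => (p.2, p.1)) ?_ ?_ ?_ ?_
  · rintro ⟨i, j⟩ _
    by_cases h : i = j
    · subst h; simp [bd1_bd1]
    · simp only
      rw [bd1_comm h]
      exact two_self _
  · rintro ⟨i, j⟩ _ h1 h2
    simp only [Prod.mk.injEq] at h2
    obtain ⟨rfl, _⟩ := h2
    exact h1 (bd1_bd1 _ _)
  · simp
  · simp

theorem bd_single {n : ℕ} (F : CubeFace n) :
    bd (Finsupp.single F 1) = ∑ i, if F i = none then Finsupp.single (upd F i (some false)) 1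
      + Finsupp.single (upd F i (some true)) (1 : ZMod 2) else 0 := by
  simp [bd, bd1_single]

/-- down-closed sets of faces -/
def Down {n : ℕ} (K : Set (CubeFace n)) : Prop := ∀ F ∈ K, ∀ G : CubeFace n, G ≤ F → G ∈ K

/-- chains supported on `K` -/
abbrev CS {n : ℕ} (K : Set (CubeFace n)) : Submodule (ZMod 2) (Cell n) :=
  Finsupp.supported (ZMod 2) (ZMod 2) K

/-- `j`-chains supported on `K` -/
abbrev CC {n : ℕ} (K : Set (CubeFace n)) (j : ℕ) : Submodule (ZMod 2) (Cell n) :=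
  Finsupp.supported (ZMod 2) (ZMod 2) {F | F ∈ K ∧ dim F = j}

theorem CC_le_CS {n : ℕ} (K : Set (CubeFace n)) (j : ℕ) : CC K j ≤ CS K :=
  Finsupp.supported_mono fun _ h => h.1

theorem CC_mono {n : ℕ} {K L : Set (CubeFace n)} (h : K ⊆ L) (j : ℕ) : CC K j ≤ CC L j :=
  Finsupp.supported_mono fun _ h' => ⟨h h'.1, h'.2⟩

theorem CC_of_CS {n : ℕ} {K L : Set (CubeFace n)} {j : ℕ} {c : Cell n} (h : c ∈ CC L j)
    (h' : c ∈ CS K) : c ∈ CC K j := by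
  refine Finsupp.supported_mono ?_ (supported_inter_mem h h')
  rintro F ⟨h1, h2⟩
  exact ⟨h2, h1.2⟩

theorem bd_mem {n : ℕ} {K : Set (CubeFace n)} (hK : Down K) {j : ℕ} {c : Cell n}
    (hc : c ∈ CC K (j + 1)) : bd c ∈ CC K j := by
  refine map_supported bd _ _ ?_ c hc
  rintro F ⟨hF, hd⟩
  rw [bd_single]
  refine Submodule.sum_mem _ fun i _ => ?_
  split_ifs with h
  · refine Submodule.add_mem _ ?_ ?_ <;> refine Finsupp.single_mem_supported _ _ ⟨?_, ?_⟩
    · exact hK _ hF _ (upd_some_le F i _ h)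
    · have := dim_upd_some F i false h; omega
    · exact hK _ hF _ (upd_some_le F i _ h)
    · have := dim_upd_some F i true h; omega
  · exact Submodule.zero_mem _

theorem bd_mem_CS {n : ℕ} {K : Set (CubeFace n)} (hK : Down K) {c : Cell n}
    (hc : c ∈ CS K) : bd c ∈ CS K := by
  refine map_supported bd _ _ ?_ c hc
  rintro F hF
  rw [bd_single]
  refine Submodule.sum_mem _ fun i _ => ?_
  split_ifs with h
  · refine Submodule.add_mem _ ?_ ?_ <;> refine Finsupp.single_mem_supported _ _ ?_
    · exact hK _ hF _ (upd_some_le F i _ h)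
    · exact hK _ hF _ (upd_some_le F i _ h)
  · exact Submodule.zero_mem _

theorem dim_zero_ne {n : ℕ} {F : CubeFace n} (h : dim F = 0) (i : Fin n) : F i ≠ none := by
  classical
  rw [dim_eq, Finset.card_eq_zero, Finset.filter_eq_empty_iff] at h
  exact h (Finset.mem_univ i)

theorem bd_zero {n : ℕ} {K : Set (CubeFace n)} {c : Cell n}
    (hc : c ∈ CC K 0) : bd c = 0 := by
  refine eq_on_supported bd 0 _ ?_ c hc
  rintro F ⟨hF, hd⟩
  rw [bd_single, LinearMap.zero_apply]
  exact Finset.sum_eq_zero fun i _ => if_neg (dim_zero_ne hd i)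

/-- augmentation: the number (mod 2) of vertices -/
def aug {n : ℕ} : Cell n →ₗ[ZMod 2] ZMod 2 :=
  Finsupp.lsum (ZMod 2) fun F => LinearMap.toSpanSingleton (ZMod 2) _ (if dim F = 0 then 1 else 0)

theorem aug_single {n : ℕ} (F : CubeFace n) :
    aug (Finsupp.single F 1) = if dim F = 0 then 1 else 0 := by
  simp [aug]

theorem aug_bd {n : ℕ} (c : Cell n) : aug (bd c) = 0 := by
  have : aug ∘ₗ bd = (0 : Cell n →ₗ[ZMod 2] ZMod 2) := by
    apply Finsupp.lhom_ext'
    intro F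
    apply LinearMap.ext_ring
    simp only [LinearMap.comp_apply, Finsupp.lsingle_apply, bd_single, map_sum]
    refine Finset.sum_eq_zero fun i _ => ?_
    split_ifs with h
    · rw [map_add, aug_single, aug_single]
      have h1 := dim_upd_some F i false h
      have h2 := dim_upd_some F i true h
      have : dim (upd F i (some false)) = dim (upd F i (some true)) := by omega
      rw [this]
      exact two_self _
    · simp
  exact DFunLike.congr_fun this c

/-! ### contraction in one direction -/

/-- the contracting homotopy in direction `i` towards the value `a` -/
def hc1 {n : ℕ} (i : Fin n) (a : Bool) : Cell n →ₗ[ZMod 2] Cell n :=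
  Finsupp.lsum (ZMod 2) fun F => LinearMap.toSpanSingleton (ZMod 2) _
    (if F i = some (!a) then Finsupp.single (upd F i none) 1 else 0)

/-- the projection in direction `i` towards the value `a` -/
def pr1 {n : ℕ} (i : Fin n) (a : Bool) : Cell n →ₗ[ZMod 2] Cell n :=
  Finsupp.lsum (ZMod 2) fun F => LinearMap.toSpanSingleton (ZMod 2) _
    (if F i = none then 0 else Finsupp.single (upd F i (some a)) 1)

theorem hc1_single {n : ℕ} (i : Fin n) (a : Bool) (F : CubeFace n) :
    hc1 i a (Finsupp.single F 1) =
      if F i = some (!a) then Finsupp.single (upd F i none) 1 else 0 := by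
  simp [hc1]

theorem pr1_single {n : ℕ} (i : Fin n) (a : Bool) (F : CubeFace n) :
    pr1 i a (Finsupp.single F 1) =
      if F i = none then 0 else Finsupp.single (upd F i (some a)) 1 := by
  simp [pr1]

theorem bd1_hc1 {n : ℕ} {i j : Fin n} (h : i ≠ j) (a : Bool) (c : Cell n) :
    bd1 i (hc1 j a c) = hc1 j a (bd1 i c) := by
  have : (bd1 i) ∘ₗ (hc1 j a) = ((hc1 j a) ∘ₗ (bd1 i) : Cell n →ₗ[ZMod 2] Cell n) := by
    apply Finsupp.lhom_ext'
    intro F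
    apply LinearMap.ext_ring
    simp only [LinearMap.comp_apply, Finsupp.lsingle_apply, bd1_single, hc1_single]
    by_cases h1 : F i = none <;> by_cases h2 : F j = some (!a) <;>
      simp [h1, h2, bd1_single, hc1_single, upd_ne _ h, upd_ne _ h.symm, upd_comm F h]
  exact DFunLike.congr_fun this c

theorem bd1_hc1_same {n : ℕ} (i : Fin n) (a : Bool) (c : Cell n) :
    bd1 i (hc1 i a c) + hc1 i a (bd1 i c) = c + pr1 i a c := by
  have : (bd1 i) ∘ₗ (hc1 i a) + (hc1 i a) ∘ₗ (bd1 i)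
      = (LinearMap.id + pr1 i a : Cell n →ₗ[ZMod 2] Cell n) := by
    apply Finsupp.lhom_ext'
    intro F
    apply LinearMap.ext_ring
    simp only [LinearMap.comp_apply, Finsupp.lsingle_apply, bd1_single, hc1_single,
      LinearMap.add_apply, LinearMap.id_apply, pr1_single]
    rcases hF : F i with _ | b
    · cases a <;> simp [hc1_single, upd_upd, upd_self F i none hF]
    · cases a <;> cases b <;>
        simp [bd1_single, upd_upd, upd_self F i _ hF, two_self, add_comm]
  exact DFunLike.congr_fun this c

theorem bd_hc1 {n : ℕ} (i : Fin n) (a : Bool) (c : Cell n) :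
    bd (hc1 i a c) + hc1 i a (bd c) = c + pr1 i a c := by
  classical
  simp only [bd, LinearMap.sum_apply, map_sum]
  rw [← Finset.sum_add_distrib, ← bd1_hc1_same]
  refine Finset.sum_eq_single i (fun j _ hj => ?_) (by simp)
  rw [bd1_hc1 hj]
  exact two_self _

theorem dim_upd_none {n : ℕ} (F : CubeFace n) (i : Fin n) (h : F i ≠ none) :
    dim (upd F i none) = dim F + 1 := by
  obtain ⟨b, hb⟩ := Option.ne_none_iff_exists'.1 h
  have := dim_upd_some (upd F i none) i b (by simp)
  rw [upd_upd, upd_self F i _ hb] at this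
  exact this.symm

theorem dim_upd_ss {n : ℕ} (F : CubeFace n) (i : Fin n) (b : Bool) (h : F i ≠ none) :
    dim (upd F i (some b)) = dim F := by
  have h1 := dim_upd_some (upd F i none) i b (by simp)
  rw [upd_upd] at h1
  have := dim_upd_none F i h
  omega

/-- `K` is star-like around the vertex `a` -/
def StarAt {n : ℕ} (K : Set (CubeFace n)) (a : Fin n → Bool) : Prop :=
  ∀ G ∈ K, ∃ H ∈ K, G ≤ H ∧ toFace a ≤ H

theorem StarAt.upd_none {n : ℕ} {K : Set (CubeFace n)} (hK : Down K) {a : Fin n → Bool}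
    (h : StarAt K a) {G : CubeFace n} (hG : G ∈ K) (i : Fin n) (hi : G i = some (!a i)) :
    upd G i none ∈ K := by
  obtain ⟨H, hH, h1, h2⟩ := h G hG
  refine hK H hH _ ?_
  intro j
  by_cases hj : j = i
  · subst hj
    rcases h1 j with h3 | h3
    · exact Or.inl h3
    · rcases h2 j with h4 | h4
      · exact Or.inl h4
      · rw [← h3, hi] at h4
        simp [toFace] at h4
  · rw [upd_ne _ hj]; exact h1 j

theorem StarAt.upd_some {n : ℕ} {K : Set (CubeFace n)} (hK : Down K) {a : Fin n → Bool}
    (h : StarAt K a) {G : CubeFace n} (hG : G ∈ K) (i : Fin n) :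
    upd G i (some (a i)) ∈ K := by
  obtain ⟨H, hH, h1, h2⟩ := h G hG
  refine hK H hH _ ?_
  intro j
  by_cases hj : j = i
  · subst hj
    rcases h2 j with h4 | h4
    · exact Or.inl h4
    · right; rw [upd_same, ← h4]; rfl
  · rw [upd_ne _ hj]; exact h1 j

theorem star_step {n : ℕ} {K : Set (CubeFace n)} (hK : Down K) {a : Fin n → Bool}
    (h : StarAt K a) {j : ℕ} {c : Cell n} (hc : c ∈ CC K j) (hb : bd c = 0)
    (s : Finset (Fin n)) :
    ∃ e ∈ CC K (j + 1), c + bd e ∈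
      Finsupp.supported (ZMod 2) (ZMod 2)
        {F : CubeFace n | F ∈ K ∧ dim F = j ∧ ∀ i ∈ s, F i = some (a i)} := by
  classical
  induction s using Finset.induction_on with
  | empty => exact ⟨0, Submodule.zero_mem _, by simpa using hc⟩
  | insert i s his ih =>
    obtain ⟨e, he, hce⟩ := ih
    set c' := c + bd e with hc'
    have hb' : bd c' = 0 := by rw [hc', map_add, hb, bd_bd, add_zero]
    refine ⟨e + hc1 i (a i) c', Submodule.add_mem _ he ?_, ?_⟩
    · refine map_supported _ _ _ ?_ c' hce
      rintro F ⟨h1, h2, h3⟩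
      rw [hc1_single]
      split_ifs with h4
      · refine Finsupp.single_mem_supported _ _ ⟨h.upd_none hK h1 i h4, ?_⟩
        rw [dim_upd_none F i (by rw [h4]; simp), h2]
      · exact Submodule.zero_mem _
    · have key := bd_hc1 i (a i) c'
      rw [hb', map_zero, add_zero] at key
      rw [map_add, ← add_assoc, ← hc', key, ← add_assoc, two_self, zero_add]
      refine map_supported _ _ _ ?_ c' hce
      rintro F ⟨h1, h2, h3⟩
      rw [pr1_single]
      split_ifs with h4
      · exact Submodule.zero_mem _
      · refine Finsupp.single_mem_supported _ _ ⟨h.upd_some hK h1 i, ?_, ?_⟩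
        · rw [dim_upd_ss F i _ h4, h2]
        · intro k hk
          rcases Finset.mem_insert.1 hk with rfl | hk2
          · simp
          · rw [upd_ne]
            · exact h3 k hk2
            · rintro rfl; exact his hk2

theorem dim_toFace {n : ℕ} (a : Fin n → Bool) : dim (toFace a) = 0 := by
  classical
  rw [dim_eq]; simp [toFace]

/-- star-like complexes are acyclic in positive degrees -/
theorem star_acyclic {n : ℕ} {K : Set (CubeFace n)} (hK : Down K) {a : Fin n → Bool}
    (h : StarAt K a) {j : ℕ} (hj : j ≠ 0) {c : Cell n} (hc : c ∈ CC K j) (hb : bd c = 0) :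
    ∃ e ∈ CC K (j + 1), c = bd e := by
  obtain ⟨e, he, hce⟩ := star_step hK h hc hb Finset.univ
  refine ⟨e, he, ?_⟩
  rw [← add_eq_zero_iff']
  apply supported_empty_eq
  convert hce
  symm
  rw [Set.eq_empty_iff_forall_notMem]
  rintro F ⟨_, h2, h3⟩
  have : F = toFace a := face_ext fun i => h3 i (Finset.mem_univ _)
  rw [this, dim_toFace] at h2
  exact hj h2.symm

/-- star-like complexes are connected -/
theorem star_acyclic_zero {n : ℕ} {K : Set (CubeFace n)} (hK : Down K) {a : Fin n → Bool}
    (h : StarAt K a) {c : Cell n} (hc : c ∈ CC K 0) (hb : aug c = 0) :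
    ∃ e ∈ CC K 1, c = bd e := by
  obtain ⟨e, he, hce⟩ := star_step hK h hc (bd_zero hc) Finset.univ
  refine ⟨e, he, ?_⟩
  rw [← add_eq_zero_iff']
  have hs : c + bd e ∈ Finsupp.supported (ZMod 2) (ZMod 2) {toFace a} := by
    refine Finsupp.supported_mono ?_ hce
    rintro F ⟨_, h2, h3⟩
    exact face_ext fun i => h3 i (Finset.mem_univ _)
  rw [Finsupp.mem_supported, Finset.coe_subset_singleton, Finsupp.support_subset_singleton] at hs
  have h0 : aug (c + bd e) = 0 := by rw [map_add, hb, aug_bd, add_zero]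
  rw [hs] at h0 ⊢
  have : (Finsupp.single (toFace a) ((c + bd e) (toFace a)) : Cell n)
    = ((c + bd e) (toFace a)) • Finsupp.single (toFace a) 1 := by simp
  rw [this, map_smul, aug_single, if_pos (dim_toFace a)] at h0
  simp only [smul_eq_mul, mul_one] at h0
  rw [h0]; simp

end

end BF


namespace BF

noncomputable section

/-! ### tuples -/

/-- tuples of points -/
abbrev Tup (E : Type*) : Type _ := Σ q : ℕ, (Fin q → E)

/-- chains of tuples -/
abbrev TC (E : Type*) : Type _ := Tup E →₀ ZMod 2

/-- put a point in front -/
def tcons {E : Type*} (a : E) : TC E →ₗ[ZMod 2] TC E :=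
  Finsupp.lmapDomain (ZMod 2) (ZMod 2) (fun t => ⟨t.1 + 1, Fin.cons a t.2⟩)

theorem tcons_single {E : Type*} (a : E) (t : Tup E) :
    tcons a (Finsupp.single t 1) = Finsupp.single ⟨t.1 + 1, Fin.cons a t.2⟩ 1 := by
  simp [tcons]

/-- boundary of a basis tuple -/
def tbdB {E : Type*} : (q : ℕ) → (Fin q → E) → TC E
  | 0, _ => 0
  | q + 1, v => ∑ i : Fin (q + 1), Finsupp.single ⟨q, fun k => v (i.succAbove k)⟩ 1

/-- boundary of tuples (augmented) -/
def tbd {E : Type*} : TC E →ₗ[ZMod 2] TC E :=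
  Finsupp.lsum (ZMod 2) fun t => LinearMap.toSpanSingleton (ZMod 2) _ (tbdB t.1 t.2)

theorem tbd_single {E : Type*} (q : ℕ) (v : Fin q → E) :
    tbd (Finsupp.single ⟨q, v⟩ 1) = tbdB q v := by
  simp [tbd]

theorem lin_ext {B V : Type*} [AddCommGroup V] [Module (ZMod 2) V]
    (f g : (B →₀ ZMod 2) →ₗ[ZMod 2] V)
    (h : ∀ b, f (Finsupp.single b 1) = g (Finsupp.single b 1)) : ∀ c, f c = g c :=
  fun c => eq_on_supported f g Set.univ (fun b _ => h b) c (by simp)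

theorem tbd_tcons {E : Type*} (a : E) (c : TC E) :
    tbd (tcons a c) = c + tcons a (tbd c) := by
  refine lin_ext (tbd ∘ₗ tcons a) (LinearMap.id + tcons a ∘ₗ tbd) ?_ c
  rintro ⟨q, v⟩
  simp only [LinearMap.comp_apply, LinearMap.add_apply, LinearMap.id_apply]
  rw [tcons_single, tbd_single, tbd_single]
  cases q with
  | zero =>
    simp only [tbdB, map_zero, add_zero]
    simp [Fin.sum_univ_succ]
  | succ q =>
    simp only [tbdB]
    rw [Fin.sum_univ_succ, map_sum]
    congr 1
    refine Finset.sum_congr rfl fun i _ => ?_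
    rw [tcons_single]
    congr 2
    funext k
    refine Fin.cases ?_ (fun k => ?_) k
    · simp
    · simp

theorem tbd_tbd {E : Type*} (c : TC E) : tbd (tbd c) = 0 := by
  refine lin_ext (tbd ∘ₗ tbd) 0 ?_ c
  rintro ⟨q, v⟩
  simp only [LinearMap.comp_apply, LinearMap.zero_apply]
  induction q with
  | zero => rw [tbd_single]; simp [tbdB]
  | succ q ih =>
    have hv : (⟨q + 1, v⟩ : Tup E) = ⟨q + 1, Fin.cons (v 0) (Fin.tail v)⟩ := by
      rw [Fin.cons_self_tail]
    have h2 := tcons_single (v 0) (⟨q, Fin.tail v⟩ : Tup E)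
    simp only at h2
    rw [hv, ← h2, tbd_tcons, map_add, tbd_tcons, ih, map_zero, add_zero, two_self]

/-- functoriality of tuples -/
def tmap {E E' : Type*} (f : E → E') : TC E →ₗ[ZMod 2] TC E' :=
  Finsupp.lmapDomain (ZMod 2) (ZMod 2) (fun t => ⟨t.1, fun i => f (t.2 i)⟩)

theorem tmap_single {E E' : Type*} (f : E → E') (q : ℕ) (v : Fin q → E) :
    tmap f (Finsupp.single ⟨q, v⟩ 1) = Finsupp.single ⟨q, fun i => f (v i)⟩ 1 := by
  simp [tmap]

theorem tmap_tcons {E E' : Type*} (f : E → E') (a : E) (c : TC E) :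
    tmap f (tcons a c) = tcons (f a) (tmap f c) := by
  refine lin_ext (tmap f ∘ₗ tcons a) (tcons (f a) ∘ₗ tmap f) ?_ c
  rintro ⟨q, v⟩
  simp only [LinearMap.comp_apply, tcons_single, tmap_single]
  congr 2
  funext k
  refine Fin.cases ?_ (fun k => ?_) k <;> simp

theorem tmap_tbd {E E' : Type*} (f : E → E') (c : TC E) :
    tmap f (tbd c) = tbd (tmap f c) := by
  refine lin_ext (tmap f ∘ₗ tbd) (tbd ∘ₗ tmap f) ?_ c
  rintro ⟨q, v⟩
  simp only [LinearMap.comp_apply, tmap_single, tbd_single]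
  cases q with
  | zero => simp [tbdB]
  | succ q => simp only [tbdB, map_sum, tmap_single]

section subdiv

variable {E : Type*} (b : (q : ℕ) → (Fin (q + 1) → E) → E)

/-- subdivision of a basis tuple -/
def SdB : (q : ℕ) → (Fin q → E) → TC E
  | 0, v => Finsupp.single ⟨0, v⟩ 1
  | q + 1, v => tcons (b q v) (∑ i : Fin (q + 1), SdB q (fun k => v (i.succAbove k)))

/-- homotopy on a basis tuple -/
def TdB : (q : ℕ) → (Fin q → E) → TC E
  | 0, _ => 0
  | q + 1, v => tcons (b q v) (Finsupp.single ⟨q + 1, v⟩ 1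
      + ∑ i : Fin (q + 1), TdB q (fun k => v (i.succAbove k)))

/-- subdivision -/
def Sd : TC E →ₗ[ZMod 2] TC E :=
  Finsupp.lsum (ZMod 2) fun t => LinearMap.toSpanSingleton (ZMod 2) _ (SdB b t.1 t.2)

/-- homotopy from identity to subdivision -/
def Td : TC E →ₗ[ZMod 2] TC E :=
  Finsupp.lsum (ZMod 2) fun t => LinearMap.toSpanSingleton (ZMod 2) _ (TdB b t.1 t.2)

theorem Sd_single (q : ℕ) (v : Fin q → E) :
    Sd b (Finsupp.single ⟨q, v⟩ 1) = SdB b q v := by simp [Sd]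

theorem Td_single (q : ℕ) (v : Fin q → E) :
    Td b (Finsupp.single ⟨q, v⟩ 1) = TdB b q v := by simp [Td]

theorem Sd_succ (q : ℕ) (v : Fin (q + 1) → E) :
    Sd b (Finsupp.single ⟨q + 1, v⟩ 1)
      = tcons (b q v) (Sd b (tbd (Finsupp.single ⟨q + 1, v⟩ 1))) := by
  rw [Sd_single, tbd_single]
  simp only [SdB, tbdB, map_sum, Sd_single]

theorem Td_succ (q : ℕ) (v : Fin (q + 1) → E) :
    Td b (Finsupp.single ⟨q + 1, v⟩ 1)
      = tcons (b q v) (Finsupp.single ⟨q + 1, v⟩ 1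
        + Td b (tbd (Finsupp.single ⟨q + 1, v⟩ 1))) := by
  rw [Td_single, tbd_single]
  simp only [TdB, tbdB, map_sum, Td_single]

/-- tuples of fixed length -/
theorem tbdB_mem (q : ℕ) (v : Fin (q + 1) → E) :
    tbd (Finsupp.single ⟨q + 1, v⟩ 1) ∈
      Finsupp.supported (ZMod 2) (ZMod 2) {t : Tup E | t.1 = q} := by
  rw [tbd_single]
  exact Submodule.sum_mem _ fun i _ => Finsupp.single_mem_supported _ _ rfl

theorem tbd_Sd (c : TC E) : tbd (Sd b c) = Sd b (tbd c) := by
  have main : ∀ q (v : Fin q → E), tbd (Sd b (Finsupp.single ⟨q, v⟩ 1))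
      = Sd b (tbd (Finsupp.single ⟨q, v⟩ 1)) := by
    intro q
    induction q with
    | zero => intro v; simp [Sd_single, tbd_single, SdB, tbdB]
    | succ q ih =>
      intro v
      rw [Sd_succ, tbd_tcons]
      have : tbd (Sd b (tbd (Finsupp.single ⟨q + 1, v⟩ 1)))
          = Sd b (tbd (tbd (Finsupp.single ⟨q + 1, v⟩ 1))) := by
        refine eq_on_supported (tbd ∘ₗ Sd b) (Sd b ∘ₗ tbd) _ ?_ _ (tbdB_mem q v)
        rintro ⟨q', v'⟩ h
        obtain rfl : q' = q := h
        exact ih v'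
      rw [this, tbd_tbd]; simp
  exact lin_ext (tbd ∘ₗ Sd b) (Sd b ∘ₗ tbd) (fun ⟨q, v⟩ => main q v) c

theorem tbd_Td (c : TC E) : tbd (Td b c) + Td b (tbd c) = c + Sd b c := by
  have main : ∀ q (v : Fin q → E), tbd (Td b (Finsupp.single ⟨q, v⟩ 1))
      + Td b (tbd (Finsupp.single ⟨q, v⟩ 1))
      = Finsupp.single ⟨q, v⟩ 1 + Sd b (Finsupp.single ⟨q, v⟩ 1) := by
    intro q
    induction q with
    | zero => intro v; simp [Sd_single, Td_single, tbd_single, SdB, tbdB, TdB, two_self]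
    | succ q ih =>
      intro v
      rw [Td_succ, tbd_tcons, Sd_succ]
      have : tbd (Td b (tbd (Finsupp.single ⟨q + 1, v⟩ 1)))
          + Td b (tbd (tbd (Finsupp.single ⟨q + 1, v⟩ 1)))
          = tbd (Finsupp.single ⟨q + 1, v⟩ 1) + Sd b (tbd (Finsupp.single ⟨q + 1, v⟩ 1)) := by
        refine eq_on_supported (tbd ∘ₗ Td b + Td b ∘ₗ tbd) (LinearMap.id + Sd b) _ ?_ _
          (tbdB_mem q v)
        rintro ⟨q', v'⟩ h
        obtain rfl : q' = q := h
        exact ih v'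
      rw [tbd_tbd, map_zero, add_zero] at this
      rw [map_add, this]
      set x := Td b (tbd (Finsupp.single (⟨q + 1, v⟩ : Tup E) 1))
      set y := tbd (Finsupp.single (⟨q + 1, v⟩ : Tup E) (1 : ZMod 2))
      have h1 := two_self x
      have h2 := two_self y
      have h3 : y + (y + Sd b y) = Sd b y := by rw [← add_assoc, h2, zero_add]
      rw [h3]
      grind
  exact lin_ext (tbd ∘ₗ Td b + Td b ∘ₗ tbd) (LinearMap.id + Sd b) (fun ⟨q, v⟩ => main q v) c

variable {E' : Type*} (b' : (q : ℕ) → (Fin (q + 1) → E') → E')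

theorem tmap_Sd (f : E → E') (hf : ∀ q v, f (b q v) = b' q (fun i => f (v i))) (c : TC E) :
    tmap f (Sd b c) = Sd b' (tmap f c) := by
  have main : ∀ q (v : Fin q → E), tmap f (SdB b q v) = SdB b' q (fun i => f (v i)) := by
    intro q
    induction q with
    | zero => intro v; simp [SdB, tmap_single]
    | succ q ih => intro v; simp only [SdB, tmap_tcons, hf, map_sum, ih]
  refine lin_ext (tmap f ∘ₗ Sd b) (Sd b' ∘ₗ tmap f) ?_ c
  rintro ⟨q, v⟩
  simp only [LinearMap.comp_apply, tmap_single, Sd_single, main]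

theorem tmap_Td (f : E → E') (hf : ∀ q v, f (b q v) = b' q (fun i => f (v i))) (c : TC E) :
    tmap f (Td b c) = Td b' (tmap f c) := by
  have main : ∀ q (v : Fin q → E), tmap f (TdB b q v) = TdB b' q (fun i => f (v i)) := by
    intro q
    induction q with
    | zero => intro v; simp [TdB]
    | succ q ih => intro v; simp only [TdB, tmap_tcons, hf, map_sum, ih, map_add, tmap_single]
  refine lin_ext (tmap f ∘ₗ Td b) (Td b' ∘ₗ tmap f) ?_ c
  rintro ⟨q, v⟩
  simp only [LinearMap.comp_apply, tmap_single, Td_single, main]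

end subdiv

/-! ### simplices -/

/-- the standard simplex -/
abbrev Spx (p : ℕ) : Type := ↥(stdSimplex ℝ (Fin (p + 1)))

/-- affine combination of points of a simplex -/
def aff {p q : ℕ} (v : Fin (q + 1) → Spx p) (t : Spx q) : Spx p :=
  ⟨∑ i, t.1 i • (v i).1, (convex_stdSimplex ℝ (Fin (p + 1))).sum_mem (fun i _ => t.2.1 i) t.2.2
    (fun i _ => (v i).2)⟩

theorem aff_coe {p q : ℕ} (v : Fin (q + 1) → Spx p) (t : Spx q) (k : Fin (p + 1)) :
    (aff v t).1 k = ∑ i, t.1 i * (v i).1 k := by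
  simp [aff]

/-- affine map as a continuous map -/
def affC {p q : ℕ} (v : Fin (q + 1) → Spx p) : C(Spx q, Spx p) :=
  ⟨aff v, by
    apply Continuous.subtype_mk
    exact continuous_finsetSum _ fun i _ =>
      ((continuous_apply i).comp continuous_subtype_val).smul continuous_const⟩

@[simp] theorem affC_apply {p q : ℕ} (v : Fin (q + 1) → Spx p) (t : Spx q) :
    affC v t = aff v t := rfl

theorem aff_aff {p q r : ℕ} (w : Fin (q + 1) → Spx p) (v : Fin (r + 1) → Spx q) (t : Spx r) :
    aff w (aff v t) = aff (fun i => aff w (v i)) t := by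
  apply Subtype.ext
  funext k
  simp only [aff_coe, Finset.sum_mul, Finset.mul_sum]
  rw [Finset.sum_comm]
  simp only [mul_assoc]

/-- vertices of the simplex -/
def vtx (p : ℕ) (i : Fin (p + 1)) : Spx p := ⟨Pi.single i 1, single_mem_stdSimplex ℝ i⟩

theorem aff_vtx {p q : ℕ} (v : Fin (q + 1) → Spx p) (i : Fin (q + 1)) : aff v (vtx q i) = v i := by
  apply Subtype.ext
  funext k
  rw [aff_coe]
  simp [vtx, Pi.single_apply]

theorem aff_id {p : ℕ} (t : Spx p) : aff (vtx p) t = t := by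
  apply Subtype.ext
  funext k
  rw [aff_coe]
  simp [vtx, Pi.single_apply]

/-- barycenter of a tuple -/
def bary {p : ℕ} (q : ℕ) (v : Fin (q + 1) → Spx p) : Spx p :=
  aff v stdSimplex.barycenter

theorem aff_bary {p p' : ℕ} (w : Fin (p + 1) → Spx p') (q : ℕ) (v : Fin (q + 1) → Spx p) :
    aff w (bary q v) = bary q (fun i => aff w (v i)) := aff_aff _ _ _

/-! ### singular chains -/

/-- singular simplices -/
abbrev Sing (X : Type*) [TopologicalSpace X] : Type _ := Σ p : ℕ, C(Spx p, X)

/-- singular chains mod 2 -/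
abbrev SC (X : Type*) [TopologicalSpace X] : Type _ := Sing X →₀ ZMod 2

variable {X : Type*} [TopologicalSpace X]

/-- push forward of a basis tuple -/
def pushB {p : ℕ} (σ : C(Spx p, X)) : (q : ℕ) → (Fin q → Spx p) → SC X
  | 0, _ => 0
  | q + 1, v => Finsupp.single ⟨q, σ.comp (affC v)⟩ 1

/-- push forward of tuples along a singular simplex -/
def push {p : ℕ} (σ : C(Spx p, X)) : TC (Spx p) →ₗ[ZMod 2] SC X :=
  Finsupp.lsum (ZMod 2) fun t => LinearMap.toSpanSingleton (ZMod 2) _ (pushB σ t.1 t.2)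

theorem push_single {p : ℕ} (σ : C(Spx p, X)) (q : ℕ) (v : Fin q → Spx p) :
    push σ (Finsupp.single ⟨q, v⟩ 1) = pushB σ q v := by simp [push]

/-- the tautological tuple chain -/
def tau (p : ℕ) : TC (Spx p) := Finsupp.single ⟨p + 1, vtx p⟩ 1

theorem push_tau {p : ℕ} (σ : C(Spx p, X)) : push σ (tau p) = Finsupp.single ⟨p, σ⟩ 1 := by
  rw [tau, push_single, pushB]
  congr 2
  ext t
  simp [aff_id]

theorem tmap_tau {p q : ℕ} (v : Fin (q + 1) → Spx p) :
    tmap (aff v) (tau q) = Finsupp.single ⟨q + 1, v⟩ 1 := by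
  rw [tau, tmap_single]
  simp only [aff_vtx]

theorem push_comp {p q : ℕ} (σ : C(Spx p, X)) (v : Fin (q + 1) → Spx p) (c : TC (Spx q)) :
    push (σ.comp (affC v)) c = push σ (tmap (aff v) c) := by
  refine lin_ext (push (σ.comp (affC v))) (push σ ∘ₗ tmap (aff v)) ?_ c
  rintro ⟨r, w⟩
  simp only [LinearMap.comp_apply, tmap_single, push_single]
  cases r with
  | zero => rfl
  | succ r =>
    simp only [pushB]
    congr 2
    ext t
    simp [aff_aff]

/-- extension of a natural operation on tuples to singular chains -/
def ext (Φ : (p : ℕ) → TC (Spx p)) : SC X →ₗ[ZMod 2] SC X :=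
  Finsupp.lsum (ZMod 2) fun s => LinearMap.toSpanSingleton (ZMod 2) _ (push s.2 (Φ s.1))

theorem ext_single (Φ : (p : ℕ) → TC (Spx p)) (p : ℕ) (σ : C(Spx p, X)) :
    ext Φ (Finsupp.single ⟨p, σ⟩ 1) = push σ (Φ p) := by simp [ext]

theorem ext_push (Φ : (p : ℕ) → TC (Spx p)) (Ψ : (p : ℕ) → TC (Spx p) →ₗ[ZMod 2] TC (Spx p))
    (hΨ : ∀ p, Ψ p (tau p) = Φ p)
    (hn : ∀ (p q : ℕ) (v : Fin (q + 1) → Spx p) c, tmap (aff v) (Ψ q c) = Ψ p (tmap (aff v) c))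
    (p : ℕ) (h0 : ∀ v : Fin 0 → Spx p, ∀ σ : C(Spx p, X),
      push σ (Ψ p (Finsupp.single ⟨0, v⟩ 1)) = 0)
    (σ : C(Spx p, X)) (c : TC (Spx p)) : push σ (Ψ p c) = ext Φ (push σ c) := by
  refine lin_ext (push σ ∘ₗ Ψ p) (ext Φ ∘ₗ push σ) ?_ c
  rintro ⟨q, v⟩
  simp only [LinearMap.comp_apply]
  cases q with
  | zero =>
    rw [h0, push_single, pushB, map_zero]
  | succ q =>
    rw [push_single, pushB, ext_single, push_comp, ← hΨ, hn, tmap_tau]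

/-- singular boundary -/
def sbd : SC X →ₗ[ZMod 2] SC X := ext fun p => tbd (tau p)

/-- singular subdivision -/
def sSd : SC X →ₗ[ZMod 2] SC X := ext fun p => Sd bary (tau p)

/-- singular subdivision homotopy -/
def sTd : SC X →ₗ[ZMod 2] SC X := ext fun p => Td bary (tau p)

theorem push_tbd {p : ℕ} (σ : C(Spx p, X)) (c : TC (Spx p)) :
    push σ (tbd c) = sbd (push σ c) :=
  ext_push _ (fun _ => tbd) (fun _ => rfl) (fun _ _ _ _ => tmap_tbd _ _) p
    (fun v σ => by simp [tbd_single, tbdB]) σ c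

theorem push_Sd {p : ℕ} (σ : C(Spx p, X)) (c : TC (Spx p)) :
    push σ (Sd bary c) = sSd (push σ c) :=
  ext_push _ (fun _ => Sd bary) (fun _ => rfl)
    (fun _ _ v c => tmap_Sd bary bary (aff v) (fun q w => aff_bary v q w) c) p
    (fun v σ => by simp [Sd_single, SdB, push_single, pushB]) σ c

theorem push_Td {p : ℕ} (σ : C(Spx p, X)) (c : TC (Spx p)) :
    push σ (Td bary c) = sTd (push σ c) :=
  ext_push _ (fun _ => Td bary) (fun _ => rfl)
    (fun _ _ v c => tmap_Td bary bary (aff v) (fun q w => aff_bary v q w) c) p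
    (fun v σ => by simp [Td_single, TdB]) σ c

theorem sbd_sbd (c : SC X) : sbd (sbd c) = 0 := by
  refine lin_ext (sbd ∘ₗ sbd) 0 ?_ c
  rintro ⟨p, σ⟩
  simp only [LinearMap.comp_apply, LinearMap.zero_apply]
  rw [← push_tau, ← push_tbd, ← push_tbd, tbd_tbd, map_zero]

theorem sbd_sSd (c : SC X) : sbd (sSd c) = sSd (sbd c) := by
  refine lin_ext (sbd ∘ₗ sSd) (sSd ∘ₗ sbd) ?_ c
  rintro ⟨p, σ⟩
  simp only [LinearMap.comp_apply]
  rw [← push_tau, ← push_tbd, ← push_Sd, ← push_Sd, ← push_tbd, tbd_Sd]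

theorem sbd_sTd (c : SC X) : sbd (sTd c) + sTd (sbd c) = c + sSd c := by
  refine lin_ext (sbd ∘ₗ sTd + sTd ∘ₗ sbd) (LinearMap.id + sSd) ?_ c
  rintro ⟨p, σ⟩
  simp only [LinearMap.comp_apply, LinearMap.add_apply, LinearMap.id_apply]
  rw [← push_tau, ← push_tbd, ← push_Sd, ← push_Td, ← push_Td, ← push_tbd, ← map_add, tbd_Td,
    map_add]

theorem sbd_single (p : ℕ) (σ : C(Spx (p + 1), X)) :
    sbd (Finsupp.single ⟨p + 1, σ⟩ 1) =
      ∑ i : Fin (p + 2), Finsupp.single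
        ⟨p, σ.comp (affC fun k => vtx (p + 1) (i.succAbove k))⟩ 1 := by
  rw [sbd, ext_single, tau, tbd_single, tbdB, map_sum]
  simp only [push_single, pushB]

theorem sbd_single_zero (σ : C(Spx 0, X)) :
    sbd (Finsupp.single ⟨0, σ⟩ 1) = 0 := by
  rw [sbd, ext_single, tau, tbd_single, tbdB, map_sum]
  simp only [push_single, pushB]
  simp

/-! ### degrees and smallness -/

/-- singular `j`-chains in `U` -/
abbrev SU (U : Set X) (j : ℕ) : Submodule (ZMod 2) (SC X) :=
  Finsupp.supported (ZMod 2) (ZMod 2) {s : Sing X | Set.range s.2 ⊆ U ∧ s.1 = j}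

/-- singular `j`-chains which are small of order `𝒰` -/
abbrev SS (𝒰 : Set (Set X)) (j : ℕ) : Submodule (ZMod 2) (SC X) :=
  Finsupp.supported (ZMod 2) (ZMod 2) {s : Sing X | (∃ U ∈ 𝒰, Set.range s.2 ⊆ U) ∧ s.1 = j}

theorem push_mem {p : ℕ} (σ : C(Spx p, X)) (P : Sing X → Prop) (c : TC (Spx p))
    (s : Set (Tup (Spx p))) (hc : c ∈ Finsupp.supported (ZMod 2) (ZMod 2) s)
    (h : ∀ q v, (⟨q + 1, v⟩ : Tup (Spx p)) ∈ s → P ⟨q, σ.comp (affC v)⟩) :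
    push σ c ∈ Finsupp.supported (ZMod 2) (ZMod 2) {s | P s} := by
  refine map_supported _ _ _ ?_ c hc
  rintro ⟨q, v⟩ hv
  rw [push_single]
  cases q with
  | zero => exact Submodule.zero_mem _
  | succ q => exact Finsupp.single_mem_supported _ _ (h q v hv)

theorem tcons_mem {E : Type*} (a : E) {j : ℕ} {c : TC E}
    (hc : c ∈ Finsupp.supported (ZMod 2) (ZMod 2) {t : Tup E | t.1 = j}) :
    tcons a c ∈ Finsupp.supported (ZMod 2) (ZMod 2) {t : Tup E | t.1 = j + 1} := by
  refine map_supported _ _ _ ?_ c hc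
  rintro ⟨q, v⟩ (rfl : q = j)
  rw [tcons_single]
  exact Finsupp.single_mem_supported _ _ rfl

theorem SdB_mem {E : Type*} (b : (q : ℕ) → (Fin (q + 1) → E) → E) (q : ℕ) (v : Fin q → E) :
    SdB b q v ∈ Finsupp.supported (ZMod 2) (ZMod 2) {t : Tup E | t.1 = q} := by
  induction q with
  | zero => exact Finsupp.single_mem_supported _ _ rfl
  | succ q ih => exact tcons_mem _ (Submodule.sum_mem _ fun i _ => ih _)

theorem TdB_mem {E : Type*} (b : (q : ℕ) → (Fin (q + 1) → E) → E) (q : ℕ) (v : Fin q → E) :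
    TdB b q v ∈ Finsupp.supported (ZMod 2) (ZMod 2) {t : Tup E | t.1 = q + 1} := by
  induction q with
  | zero => exact Submodule.zero_mem _
  | succ q ih => exact tcons_mem _ (Submodule.add_mem _ (Finsupp.single_mem_supported _ _ rfl)
      (Submodule.sum_mem _ fun i _ => ih _))

/-- An operation of the form `ext` preserves any condition stable under restriction. -/
theorem ext_mem (Φ : (p : ℕ) → TC (Spx p)) (P : Set X → Prop)
    (hP : ∀ A B, A ⊆ B → P B → P A) (j j' : ℕ)
    (hΦ : Φ j ∈ Finsupp.supported (ZMod 2) (ZMod 2) {t : Tup (Spx j) | t.1 = j' + 1}) (c : SC X)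
    (hc : c ∈ Finsupp.supported (ZMod 2) (ZMod 2)
      {s : Sing X | P (Set.range s.2) ∧ s.1 = j}) :
    ext Φ c ∈ Finsupp.supported (ZMod 2) (ZMod 2)
      {s : Sing X | P (Set.range s.2) ∧ s.1 = j'} := by
  refine map_supported _ _ _ ?_ c hc
  rintro ⟨p, σ⟩ ⟨h1, h2⟩
  simp only at h1 h2
  subst h2
  rw [ext_single]
  refine push_mem σ (fun s => P (Set.range s.2) ∧ s.1 = j') _ _ hΦ ?_
  intro q v hq
  refine ⟨hP _ _ ?_ h1, Nat.succ_injective hq⟩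
  simp only [ContinuousMap.coe_comp]
  exact Set.range_comp_subset_range _ _

theorem sbd_mem' (P : Set X → Prop) (hP : ∀ A B, A ⊆ B → P B → P A) {j : ℕ} {c : SC X}
    (hc : c ∈ Finsupp.supported (ZMod 2) (ZMod 2)
      {s : Sing X | P (Set.range s.2) ∧ s.1 = j + 1}) :
    sbd c ∈ Finsupp.supported (ZMod 2) (ZMod 2)
      {s : Sing X | P (Set.range s.2) ∧ s.1 = j} :=
  ext_mem _ P hP _ _ (tbdB_mem _ _) c hc

theorem sbd_zero' {j : ℕ} (hj : j = 0) {c : SC X} {P : Sing X → Prop}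
    (hc : c ∈ Finsupp.supported (ZMod 2) (ZMod 2)
      {s : Sing X | P s ∧ s.1 = j}) : sbd c = 0 := by
  subst hj
  refine eq_on_supported sbd 0 _ ?_ c hc
  rintro ⟨p, σ⟩ ⟨_, h⟩
  simp only at h
  subst h
  exact sbd_single_zero σ

theorem small_hP (𝒰 : Set (Set X)) : ∀ A B : Set X, A ⊆ B → (∃ U ∈ 𝒰, B ⊆ U) →
    ∃ U ∈ 𝒰, A ⊆ U := fun _ _ h ⟨U, hU, h'⟩ => ⟨U, hU, h.trans h'⟩

theorem sSd_mem {𝒰 : Set (Set X)} {j : ℕ} {c : SC X} (hc : c ∈ SS 𝒰 j) : sSd c ∈ SS 𝒰 j :=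
  ext_mem _ (fun A => ∃ U ∈ 𝒰, A ⊆ U) (small_hP 𝒰) j j
    (by rw [tau, Sd_single]; exact SdB_mem _ _ _) c hc

theorem sTd_mem {𝒰 : Set (Set X)} {j : ℕ} {c : SC X} (hc : c ∈ SS 𝒰 j) : sTd c ∈ SS 𝒰 (j + 1) :=
  ext_mem _ (fun A => ∃ U ∈ 𝒰, A ⊆ U) (small_hP 𝒰) j (j + 1)
    (by rw [tau, Td_single]; exact TdB_mem _ _ _) c hc

theorem sTd_memU {U : Set X} {j : ℕ} {c : SC X} (hc : c ∈ SU U j) : sTd c ∈ SU U (j + 1) :=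
  ext_mem _ (fun A => A ⊆ U) (fun _ _ h h' => h.trans h') j (j + 1)
    (by rw [tau, Td_single]; exact TdB_mem _ _ _) c hc

theorem sSd_memU {U : Set X} {j : ℕ} {c : SC X} (hc : c ∈ SU U j) : sSd c ∈ SU U j :=
  ext_mem _ (fun A => A ⊆ U) (fun _ _ h h' => h.trans h') j j
    (by rw [tau, Sd_single]; exact SdB_mem _ _ _) c hc

theorem sbd_memU {U : Set X} {j : ℕ} {c : SC X} (hc : c ∈ SU U (j + 1)) : sbd c ∈ SU U j :=
  sbd_mem' (fun A => A ⊆ U) (fun _ _ h h' => h.trans h') hc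

theorem sbd_memS {𝒰 : Set (Set X)} {j : ℕ} {c : SC X} (hc : c ∈ SS 𝒰 (j + 1)) : sbd c ∈ SS 𝒰 j :=
  sbd_mem' (fun A => ∃ U ∈ 𝒰, A ⊆ U) (small_hP 𝒰) hc

/-! ### mesh -/

theorem dist_aff_le {p q : ℕ} (v : Fin (q + 1) → Spx p) (t : Spx q) (y : Spx p) (r : ℝ)
    (h : ∀ i, dist (v i) y ≤ r) : dist (aff v t) y ≤ r := by
  have := (convex_closedBall y.1 r).sum_mem (t := Finset.univ)
    (w := fun i => t.1 i) (z := fun i => (v i).1) (fun i _ => t.2.1 i) t.2.2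
    (fun i _ => h i)
  exact this

theorem dist_bary_le {p q : ℕ} (v : Fin (q + 1) → Spx p) (i : Fin (q + 1)) (r : ℝ)
    (h : ∀ i j, dist (v i) (v j) ≤ r) : dist (v i) (bary q v) ≤ (q / (q + 1) : ℝ) * r := by
  have hr : 0 ≤ r := le_trans dist_nonneg (h 0 0)
  rw [dist_comm, Subtype.dist_eq, dist_pi_le_iff (by positivity)]
  intro k
  have h0 : (bary q v).1 k = ∑ j, (1 / (q + 1) : ℝ) * (v j).1 k := by
    rw [bary, aff_coe]
    refine Finset.sum_congr rfl fun j _ => ?_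
    congr 1
    have := stdSimplex.barycenter_apply (𝕜 := ℝ) (X := Fin (q + 1)) j
    simpa using this
  have h1 : (v i).1 k = ∑ j : Fin (q + 1), (1 / (q + 1) : ℝ) * (v i).1 k := by
    rw [Finset.sum_const, Finset.card_univ, Fintype.card_fin, nsmul_eq_mul]
    push_cast
    field_simp
  rw [Real.dist_eq, h0, h1, ← Finset.sum_sub_distrib]
  classical
  calc |∑ j, ((1 / (q + 1) : ℝ) * (v j).1 k - (1 / (q + 1) : ℝ) * (v i).1 k)|
      ≤ ∑ j, |((1 / (q + 1) : ℝ) * (v j).1 k - (1 / (q + 1) : ℝ) * (v i).1 k)| :=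
        Finset.abs_sum_le_sum_abs _ _
    _ ≤ ∑ j, if j = i then 0 else (1 / (q + 1) : ℝ) * r := by
        refine Finset.sum_le_sum fun j _ => ?_
        split_ifs with hj
        · subst hj; simp
        · rw [← mul_sub, abs_mul, abs_of_nonneg (by positivity)]
          have := (dist_pi_le_iff hr).1 (h j i) k
          rw [Real.dist_eq] at this
          gcongr
    _ = (q / (q + 1) : ℝ) * r := by
        rw [Finset.sum_ite, Finset.sum_const_zero, zero_add, Finset.sum_const,
          Finset.filter_ne', Finset.card_erase_of_mem (Finset.mem_univ _)]
        simp
        ring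

/-- tuples of length `q`, in all the balls containing `v`, and mesh at most `r` -/
def MeshSet {p : ℕ} (q : ℕ) (r : ℝ) : Set (Tup (Spx p)) :=
  {t | t.1 = q ∧ ∀ i j, dist (t.2 i) (t.2 j) ≤ r}

/-- tuples in all the balls containing `v` -/
def BallSet {p : ℕ} {q : ℕ} (v : Fin q → Spx p) : Set (Tup (Spx p)) :=
  {t | ∀ (y : Spx p) (r : ℝ), (∀ i, dist (v i) y ≤ r) → ∀ i, dist (t.2 i) y ≤ r}

theorem SdB_mesh {p : ℕ} (N : ℕ) (q : ℕ) (hq : q ≤ N + 1) (v : Fin q → Spx p) (r : ℝ)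
    (h : ∀ i j, dist (v i) (v j) ≤ r) :
    SdB bary q v ∈ Finsupp.supported (ZMod 2) (ZMod 2)
      (MeshSet q ((N / (N + 1) : ℝ) * r) ∩ BallSet v) := by
  induction q with
  | zero =>
    exact Finsupp.single_mem_supported _ _ ⟨⟨rfl, fun i => Fin.elim0 i⟩, fun _ _ _ i => Fin.elim0 i⟩
  | succ q ih =>
    have hr : 0 ≤ r := le_trans dist_nonneg (h 0 0)
    have hb : ∀ i, dist (v i) (bary q v) ≤ (N / (N + 1) : ℝ) * r := by
      intro i
      refine (dist_bary_le v i r h).trans ?_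
      have : (q : ℝ) ≤ N := by exact_mod_cast Nat.le_of_succ_le_succ hq
      gcongr ?_ * r
      rw [div_le_div_iff₀ (by positivity) (by positivity)]
      nlinarith
    have hmem : (∑ i : Fin (q + 1), SdB bary q (fun k => v (i.succAbove k))) ∈
        Finsupp.supported (ZMod 2) (ZMod 2)
          (MeshSet q ((N / (N + 1) : ℝ) * r) ∩ BallSet v) := by
      refine Submodule.sum_mem _ fun i _ => ?_
      refine Finsupp.supported_mono ?_
        (ih (by omega) (fun k => v (i.succAbove k)) (fun _ _ => h _ _))
      rintro t ⟨h1, h2⟩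
      exact ⟨h1, fun y r hy => h2 y r fun k => hy _⟩
    rw [SdB]
    refine map_supported _ _ _ ?_ _ hmem
    rintro ⟨q', w⟩ ⟨⟨h1, h2⟩, h3⟩
    simp only at h1
    subst h1
    rw [tcons_single]
    refine Finsupp.single_mem_supported _ _ ⟨⟨rfl, ?_⟩, ?_⟩
    · have hbw : ∀ k, dist (w k) (bary q' v) ≤ (N / (N + 1) : ℝ) * r := h3 _ _ hb
      intro i j
      refine Fin.cases ?_ (fun i => ?_) i <;> refine Fin.cases ?_ (fun j => ?_) j
      · simp; positivity
      · simp; rw [dist_comm]; exact hbw j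
      · simp; exact hbw i
      · simp; exact h2 i j
    · intro y ρ hy i
      refine Fin.cases ?_ (fun i => ?_) i
      · simp only [Fin.cons_zero]
        exact dist_aff_le _ _ _ _ hy
      · simp only [Fin.cons_succ]
        exact h3 y ρ hy i

theorem Sd_pow_mesh {p : ℕ} (N : ℕ) (m : ℕ) (r : ℝ) (c : TC (Spx p))
    (hc : c ∈ Finsupp.supported (ZMod 2) (ZMod 2) (MeshSet (N + 1) r)) :
    ((Sd bary : TC (Spx p) →ₗ[ZMod 2] TC (Spx p)) ^ m) c ∈ Finsupp.supported (ZMod 2) (ZMod 2)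
      (MeshSet (N + 1) ((N / (N + 1) : ℝ) ^ m * r)) := by
  induction m with
  | zero => simpa using hc
  | succ m ih =>
    rw [pow_succ' (Sd bary) m, Module.End.mul_apply]
    refine map_supported _ _ _ ?_ _ ih
    rintro ⟨q, v⟩ ⟨h1, h2⟩
    simp only at h1
    subst h1
    rw [Sd_single]
    refine Finsupp.supported_mono ?_ (SdB_mesh N (N + 1) le_rfl v _ h2)
    rintro t ⟨h3, h4⟩
    refine ⟨h3.1, fun i j => (h3.2 i j).trans (le_of_eq ?_)⟩
    ring

theorem push_pow {p : ℕ} (σ : C(Spx p, X)) (m : ℕ) (c : TC (Spx p)) :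
    push σ (((Sd bary : TC (Spx p) →ₗ[ZMod 2] TC (Spx p)) ^ m) c)
      = ((sSd : SC X →ₗ[ZMod 2] SC X) ^ m) (push σ c) := by
  induction m with
  | zero => simp
  | succ m ih =>
    rw [pow_succ', pow_succ', Module.End.mul_apply, Module.End.mul_apply, push_Sd, ih]

theorem simplex_small (𝒰 : Set (Set X)) (ho : ∀ U ∈ 𝒰, IsOpen U) (p : ℕ) (σ : C(Spx p, X))
    (hcov : Set.range σ ⊆ ⋃₀ 𝒰) :
    ∃ m, ((sSd : SC X →ₗ[ZMod 2] SC X) ^ m) (Finsupp.single ⟨p, σ⟩ 1) ∈ SS 𝒰 p := by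
  obtain ⟨δ, hδ, hleb⟩ := lebesgue_number_lemma_of_metric_sUnion (s := (Set.univ : Set (Spx p)))
    (c := (fun U => σ ⁻¹' U) '' 𝒰) isCompact_univ
    (by rintro _ ⟨U, hU, rfl⟩; exact (ho U hU).preimage σ.continuous)
    (by
      intro x _
      obtain ⟨U, hU, hx⟩ := hcov (Set.mem_range_self x)
      exact ⟨σ ⁻¹' U, ⟨U, hU, rfl⟩, hx⟩)
  obtain ⟨R, hR⟩ : ∃ R : ℝ, ∀ i j, dist (vtx p i) (vtx p j) ≤ R :=
    ⟨Metric.diam (Set.univ : Set (Spx p)), fun i j =>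
      Metric.dist_le_diam_of_mem isCompact_univ.isBounded (Set.mem_univ _) (Set.mem_univ _)⟩
  have hlim : Filter.Tendsto (fun m : ℕ => (p / (p + 1) : ℝ) ^ m * R) Filter.atTop (nhds (0 * R)) :=
    (tendsto_pow_atTop_nhds_zero_of_lt_one (by positivity)
      (by rw [div_lt_one (by positivity)]; linarith)).mul_const R
  rw [zero_mul] at hlim
  obtain ⟨m, hm⟩ := (hlim.eventually (gt_mem_nhds hδ)).exists
  refine ⟨m, ?_⟩
  rw [← push_tau, ← push_pow]
  refine push_mem σ (fun s => (∃ U ∈ 𝒰, Set.range s.2 ⊆ U) ∧ s.1 = p) _ _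
    (Sd_pow_mesh p m R (tau p) (Finsupp.single_mem_supported _ _ ⟨rfl, hR⟩)) ?_
  rintro q v ⟨h1, h2⟩
  obtain ⟨_, ⟨U, hU, rfl⟩, hsub⟩ := hleb (v 0) (Set.mem_univ _)
  refine ⟨⟨U, hU, ?_⟩, Nat.succ_injective h1⟩
  rintro _ ⟨t, rfl⟩
  apply hsub
  rw [Metric.mem_ball]
  exact lt_of_le_of_lt (dist_aff_le v t (v 0) _ fun i => h2 i 0) hm

theorem SS_le_SU (𝒰 : Set (Set X)) (j : ℕ) : SS 𝒰 j ≤ SU (⋃₀ 𝒰) j := by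
  refine Finsupp.supported_mono ?_
  rintro s ⟨⟨U, hU, h⟩, h2⟩
  exact ⟨h.trans (Set.subset_sUnion_of_mem hU), h2⟩

theorem sSd_pow_mem {𝒰 : Set (Set X)} {j : ℕ} {c : SC X} (hc : c ∈ SS 𝒰 j) (m : ℕ) :
    ((sSd : SC X →ₗ[ZMod 2] SC X) ^ m) c ∈ SS 𝒰 j := by
  induction m with
  | zero => simpa using hc
  | succ m ih => rw [pow_succ', Module.End.mul_apply]; exact sSd_mem ih

theorem chain_small (𝒰 : Set (Set X)) (ho : ∀ U ∈ 𝒰, IsOpen U) (p : ℕ) (c : SC X)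
    (hc : c ∈ SU (⋃₀ 𝒰) p) : ∃ m, ((sSd : SC X →ₗ[ZMod 2] SC X) ^ m) c ∈ SS 𝒰 p := by
  rw [SU, Finsupp.supported_eq_span_single] at hc
  induction hc using Submodule.span_induction with
  | mem x hx =>
    obtain ⟨⟨q, σ⟩, ⟨h1, h2⟩, rfl⟩ := hx
    simp only at h1 h2
    subst h2
    exact simplex_small 𝒰 ho q σ h1
  | zero => exact ⟨0, by simp⟩
  | add x y _ _ hx hy =>
    obtain ⟨m, hm⟩ := hx
    obtain ⟨m', hm'⟩ := hy
    refine ⟨m + m', ?_⟩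
    rw [map_add]
    refine Submodule.add_mem _ ?_ ?_
    · rw [add_comm, pow_add, Module.End.mul_apply]; exact sSd_pow_mem hm _
    · rw [pow_add, Module.End.mul_apply]; exact sSd_pow_mem hm' _
  | smul a x _ hx =>
    obtain ⟨m, hm⟩ := hx
    exact ⟨m, by rw [map_smul]; exact Submodule.smul_mem _ _ hm⟩

/-- `c` is homologous to its iterated subdivision, modulo small chains. -/
theorem small_step (𝒰 : Set (Set X)) (p : ℕ) (c : SC X)
    (hc : c ∈ SU (⋃₀ 𝒰) p) (hb : p = 0 ∨ sbd c ∈ SS 𝒰 (p - 1)) (m : ℕ) :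
    ∃ e ∈ SU (⋃₀ 𝒰) (p + 1), ∃ f ∈ SS 𝒰 p,
      c + ((sSd : SC X →ₗ[ZMod 2] SC X) ^ m) c = sbd e + f := by
  have hz : sTd (sbd c) ∈ SS 𝒰 p := by
    rcases hb with rfl | hb
    · rw [sbd_zero' rfl hc, map_zero]; exact Submodule.zero_mem _
    · rcases p with _ | p
      · rw [sbd_zero' rfl hc, map_zero]; exact Submodule.zero_mem _
      · exact sTd_mem hb
  induction m with
  | zero => exact ⟨0, Submodule.zero_mem _, 0, Submodule.zero_mem _, by simp [two_self]⟩
  | succ m ih =>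
    obtain ⟨e, he, f, hf, h⟩ := ih
    have h1 := sbd_sTd c
    have h2 := congrArg sSd h
    rw [map_add, map_add, ← sbd_sSd] at h2
    refine ⟨sTd c + sSd e, Submodule.add_mem _ (sTd_memU hc) (sSd_memU he),
      sTd (sbd c) + sSd f, Submodule.add_mem _ hz (sSd_mem hf), ?_⟩
    rw [pow_succ', Module.End.mul_apply, map_add]
    have h3 := two_self (sSd c)
    grind

/-- The theorem of small simplices. -/
theorem small_simplices (𝒰 : Set (Set X)) (ho : ∀ U ∈ 𝒰, IsOpen U) (p : ℕ) (c : SC X)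
    (hc : c ∈ SU (⋃₀ 𝒰) p) (hb : p = 0 ∨ sbd c ∈ SS 𝒰 (p - 1)) :
    ∃ e ∈ SU (⋃₀ 𝒰) (p + 1), c + sbd e ∈ SS 𝒰 p := by
  obtain ⟨m, hm⟩ := chain_small 𝒰 ho p c hc
  obtain ⟨e, he, f, hf, h⟩ := small_step 𝒰 p c hc hb m
  refine ⟨e, he, ?_⟩
  have : c + sbd e = ((sSd : SC X →ₗ[ZMod 2] SC X) ^ m) c + f := by
    have h1 := two_self f
    have h2 := two_self (sbd e)
    have h3 := two_self (((sSd : SC X →ₗ[ZMod 2] SC X) ^ m) c)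
    grind
  rw [this]
  exact Submodule.add_mem _ hm hf

end

end BF


namespace BF

open CubeFace

noncomputable section

/-! ### cones -/

/-- faces of the standard simplex -/
abbrev dface {p : ℕ} (i : Fin (p + 2)) : C(Spx p, Spx (p + 1)) :=
  affC fun k => vtx (p + 1) (i.succAbove k)

theorem dface_self {p : ℕ} (i : Fin (p + 2)) (t : Spx p) : (dface i t).1 i = 0 := by
  rw [affC_apply, aff_coe]
  refine Finset.sum_eq_zero fun k _ => ?_
  simp [vtx, (Fin.succAbove_ne i k).symm]

theorem dface_succAbove {p : ℕ} (i : Fin (p + 2)) (t : Spx p) (k : Fin (p + 1)) :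
    (dface i t).1 (i.succAbove k) = t.1 k := by
  rw [affC_apply, aff_coe]
  rw [Finset.sum_eq_single k]
  · simp [vtx]
  · intro k' _ hk
    simp [vtx, hk.symm]
  · simp

theorem spx_tail {p : ℕ} (t : Spx (p + 1)) :
    ∃ u : Spx p, ∀ k, t.1 k.succ = (1 - t.1 0) * u.1 k := by
  have hsum : t.1 0 + ∑ k : Fin (p + 1), t.1 k.succ = 1 := by
    rw [← Fin.sum_univ_succ]; exact t.2.2
  by_cases h : t.1 0 = 1
  · refine ⟨vtx p 0, fun k => ?_⟩
    have h0 : ∑ k : Fin (p + 1), t.1 k.succ = 0 := by linarith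
    rw [Finset.sum_eq_zero_iff_of_nonneg (fun k _ => t.2.1 _)] at h0
    rw [h0 k (Finset.mem_univ _), h]; ring
  · have hpos : 0 < 1 - t.1 0 := by
      have h1 : 0 ≤ ∑ k : Fin (p + 1), t.1 k.succ := Finset.sum_nonneg fun k _ => t.2.1 _
      rcases lt_or_eq_of_le (show 0 ≤ 1 - t.1 0 by linarith) with h2 | h2
      · exact h2
      · exact absurd (by linarith) h
    refine ⟨⟨fun k => t.1 k.succ / (1 - t.1 0), fun k => div_nonneg (t.2.1 _) hpos.le, ?_⟩,
      fun k => ?_⟩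
    · rw [← Finset.sum_div, div_eq_one_iff_eq hpos.ne']; linarith
    · simp only; field_simp

variable {n : ℕ}

/-- the cone function -/
def coneFun {p : ℕ} (b : Fin n → ℝ) (f : (Fin (p + 1) → ℝ) → (Fin n → ℝ)) (t : Spx (p + 1)) :
    Fin n → ℝ :=
  t.1 0 • b + (1 - t.1 0) • f (fun k => t.1 k.succ / (1 - t.1 0))

theorem coneFun_eq {p : ℕ} (b : Fin n → ℝ) (f : (Fin (p + 1) → ℝ) → (Fin n → ℝ))
    (t : Spx (p + 1)) (u : Spx p) (h : ∀ k, t.1 k.succ = (1 - t.1 0) * u.1 k) :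
    coneFun b f t = t.1 0 • b + (1 - t.1 0) • f u.1 := by
  unfold coneFun
  by_cases h0 : 1 - t.1 0 = 0
  · rw [h0]; simp
  · congr 3
    funext k
    rw [h k]; field_simp

theorem coneFun_continuous {p : ℕ} (b : Fin n → ℝ) (f : C(Fin (p + 1) → ℝ, Fin n → ℝ)) :
    Continuous (coneFun b f : Spx (p + 1) → (Fin n → ℝ)) := by
  rw [continuous_iff_continuousAt]
  intro t
  have hc : ∀ k, Continuous fun s : Spx (p + 1) => s.1 k := fun k =>
    (continuous_apply k).comp continuous_subtype_val
  by_cases h : 1 - t.1 0 = 0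
  · obtain ⟨C, hC⟩ := ((isCompact_stdSimplex ℝ (Fin (p + 1))).image
      f.continuous).isBounded.exists_norm_le
    have hval : coneFun b f t = b := by
      unfold coneFun; rw [h]
      have : t.1 0 = 1 := by linarith
      rw [this]; simp
    have h1 : Filter.Tendsto (fun s : Spx (p + 1) => s.1 0 • b) (nhds t) (nhds b) := by
      have this : Filter.Tendsto (fun s : Spx (p + 1) => s.1 0 • b) (nhds t) (nhds (t.1 0 • b)) :=
        ((hc 0).smul (continuous_const (y := b))).tendsto t
      have h1 : t.1 0 = 1 := by linarith
      rwa [h1, one_smul] at this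
    have h2 : Filter.Tendsto (fun s : Spx (p + 1) => coneFun b f s - s.1 0 • b) (nhds t)
        (nhds 0) := by
      have h3 : Filter.Tendsto (fun s : Spx (p + 1) => |1 - s.1 0| * C) (nhds t) (nhds 0) := by
        have : Continuous fun s : Spx (p + 1) => |1 - s.1 0| * C :=
          ((continuous_const.sub (hc 0)).abs).mul continuous_const
        have h4 := this.tendsto t
        simpa [h] using h4
      refine squeeze_zero_norm (fun s => ?_) h3
      obtain ⟨u, hu⟩ := spx_tail s
      rw [coneFun_eq b f s u hu, add_sub_cancel_left, norm_smul, Real.norm_eq_abs]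
      gcongr
      exact hC _ ⟨u.1, u.2, rfl⟩
    have := h2.add h1
    rw [zero_add] at this
    rw [ContinuousAt, hval]
    refine this.congr fun s => ?_
    simp
  · unfold coneFun
    refine ContinuousAt.add ((hc 0).continuousAt.smul continuousAt_const) ?_
    refine (continuousAt_const.sub (hc 0).continuousAt).smul ?_
    refine f.continuous.continuousAt.comp (f := fun s : Spx (p + 1) =>
      (fun k : Fin (p + 1) => s.1 k.succ / (1 - s.1 0))) ?_
    rw [continuousAt_pi]
    intro k
    exact (hc _).continuousAt.div (continuousAt_const.sub (hc 0).continuousAt) h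

theorem exists_ext {p : ℕ} (σ : C(Spx p, Fin n → ℝ)) :
    ∃ g : C(Fin (p + 1) → ℝ, Fin n → ℝ), g.restrict (stdSimplex ℝ (Fin (p + 1))) = σ :=
  ContinuousMap.exists_restrict_eq (isCompact_stdSimplex ℝ (Fin (p + 1))).isClosed σ

/-- the cone -/
def cone {p : ℕ} (b : Fin n → ℝ) (σ : C(Spx p, Fin n → ℝ)) : C(Spx (p + 1), Fin n → ℝ) :=
  ⟨_, coneFun_continuous b (exists_ext σ).choose⟩

theorem cone_eq {p : ℕ} (b : Fin n → ℝ) (σ : C(Spx p, Fin n → ℝ))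
    (t : Spx (p + 1)) (u : Spx p) (h : ∀ k, t.1 k.succ = (1 - t.1 0) * u.1 k) :
    cone b σ t = t.1 0 • b + (1 - t.1 0) • σ u := by
  have := coneFun_eq b (exists_ext σ).choose t u h
  have h2 := DFunLike.congr_fun (exists_ext σ).choose_spec u
  rw [ContinuousMap.restrict_apply] at h2
  rw [h2] at this
  exact this

theorem cone_face_zero {p : ℕ} (b : Fin n → ℝ) (σ : C(Spx p, Fin n → ℝ)) :
    (cone b σ).comp (dface 0) = σ := by
  ext1 t
  have h0 := dface_self 0 t
  rw [ContinuousMap.comp_apply, cone_eq b σ _ t, h0]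
  · simp
  · intro k
    rw [h0, ← Fin.succAbove_zero, dface_succAbove]; ring

theorem cone_face_succ {p : ℕ} (b : Fin n → ℝ) (σ : C(Spx (p + 1), Fin n → ℝ)) (j : Fin (p + 2)) :
    (cone b σ).comp (dface j.succ) = cone b (σ.comp (dface j)) := by
  ext1 t
  obtain ⟨u, hu⟩ := spx_tail t
  have h0 : (dface j.succ t).1 0 = t.1 0 := by
    have := dface_succAbove j.succ t 0
    rwa [Fin.succ_succAbove_zero] at this
  rw [ContinuousMap.comp_apply, cone_eq b σ _ (dface j u), cone_eq b _ t u hu, h0]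
  · rfl
  · intro m
    rw [h0]
    rcases eq_or_ne m j with rfl | hm
    · rw [dface_self, dface_self, mul_zero]
    · obtain ⟨k, rfl⟩ := Fin.exists_succAbove_eq hm
      rw [dface_succAbove, ← hu k, ← dface_succAbove j.succ t k.succ, Fin.succ_succAbove_succ]

theorem cone_face_one (b : Fin n → ℝ) (σ : C(Spx 0, Fin n → ℝ)) :
    (cone b σ).comp (dface 1) = ContinuousMap.const _ b := by
  ext1 t
  obtain ⟨u, hu⟩ := spx_tail (dface 1 t)
  have h0 : (dface 1 t).1 0 = 1 := by
    have := dface_succAbove 1 t 0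
    rw [show (1 : Fin 2).succAbove (0 : Fin 1) = 0 from rfl] at this
    rw [this]
    have := t.2.2
    simpa using this
  rw [ContinuousMap.comp_apply, cone_eq b σ _ u hu, h0]
  simp

theorem cone_range {p : ℕ} {U : Set (Fin n → ℝ)} (hU : Convex ℝ U) {b : Fin n → ℝ} (hb : b ∈ U)
    {σ : C(Spx p, Fin n → ℝ)} (hσ : Set.range σ ⊆ U) : Set.range (cone b σ) ⊆ U := by
  rintro _ ⟨t, rfl⟩
  obtain ⟨u, hu⟩ := spx_tail t
  rw [cone_eq b σ t u hu]
  have h1 : t.1 0 ≤ 1 := by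
    have : t.1 0 + ∑ k : Fin (p + 1), t.1 k.succ = 1 := by
      rw [← Fin.sum_univ_succ]; exact t.2.2
    have h2 : 0 ≤ ∑ k : Fin (p + 1), t.1 k.succ := Finset.sum_nonneg fun k _ => t.2.1 _
    linarith
  exact hU hb (hσ ⟨u, rfl⟩) (t.2.1 0) (by linarith) (by ring)

/-- cone on chains -/
def sCone (b : Fin n → ℝ) : SC (Fin n → ℝ) →ₗ[ZMod 2] SC (Fin n → ℝ) :=
  Finsupp.lmapDomain (ZMod 2) (ZMod 2) fun s => ⟨s.1 + 1, cone b s.2⟩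

theorem sCone_single (b : Fin n → ℝ) (p : ℕ) (σ : C(Spx p, Fin n → ℝ)) :
    sCone b (Finsupp.single ⟨p, σ⟩ 1) = Finsupp.single ⟨p + 1, cone b σ⟩ 1 := by
  simp [sCone]

/-- augmentation on singular chains -/
def saug {X : Type*} [TopologicalSpace X] : SC X →ₗ[ZMod 2] ZMod 2 :=
  Finsupp.lsum (ZMod 2) fun s => LinearMap.toSpanSingleton (ZMod 2) _ (if s.1 = 0 then 1 else 0)

theorem saug_single {X : Type*} [TopologicalSpace X] (s : Sing X) :
    saug (Finsupp.single s 1) = if s.1 = 0 then 1 else 0 := by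
  simp [saug]

theorem saug_sbd {X : Type*} [TopologicalSpace X] (c : SC X) : saug (sbd c) = 0 := by
  refine lin_ext (saug ∘ₗ sbd) 0 ?_ c
  rintro ⟨p, σ⟩
  rcases p with _ | p
  · simp [sbd_single_zero]
  · rw [LinearMap.comp_apply, sbd_single, map_sum]
    simp only [saug_single]
    rcases p with _ | p
    · simp; decide
    · simp

/-- constant 0-simplex -/
abbrev pt {X : Type*} [TopologicalSpace X] (b : X) : SC X :=
  Finsupp.single ⟨0, ContinuousMap.const _ b⟩ 1

theorem sbd_sCone (b : Fin n → ℝ) (c : SC (Fin n → ℝ)) :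
    sbd (sCone b c) = c + sCone b (sbd c) + saug c • pt b := by
  refine lin_ext (sbd ∘ₗ sCone b) (LinearMap.id + sCone b ∘ₗ sbd
    + saug.smulRight (pt b)) ?_ c
  rintro ⟨p, σ⟩
  simp only [LinearMap.comp_apply, LinearMap.add_apply, LinearMap.id_apply,
    LinearMap.smulRight_apply, sCone_single, saug_single]
  rw [sbd_single, Fin.sum_univ_succ, cone_face_zero, add_assoc (Finsupp.single _ _) (sCone b _)]
  congr 1
  rcases p with _ | p
  · rw [sbd_single_zero, map_zero]
    have : (Finset.univ : Finset (Fin (0 + 1))) = {0} := rfl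
    rw [this, Finset.sum_singleton, show (Fin.succ 0 : Fin 2) = 1 from rfl, cone_face_one]
    simp
  · rw [sbd_single, map_sum]
    simp only [sCone_single, cone_face_succ]
    simp

theorem sCone_mem {U : Set (Fin n → ℝ)} (hU : Convex ℝ U) {b : Fin n → ℝ} (hb : b ∈ U)
    {j : ℕ} {c : SC (Fin n → ℝ)} (hc : c ∈ SU U j) : sCone b c ∈ SU U (j + 1) := by
  refine map_supported _ _ _ ?_ c hc
  rintro ⟨p, σ⟩ ⟨h1, h2⟩
  simp only at h1 h2
  subst h2
  rw [sCone_single]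
  exact Finsupp.single_mem_supported _ _ ⟨cone_range hU hb h1, rfl⟩

theorem saug_pos {X : Type*} [TopologicalSpace X] {U : Set X} {j : ℕ} (hj : j ≠ 0) {c : SC X}
    (hc : c ∈ SU U j) : saug c = 0 := by
  refine eq_on_supported saug 0 _ ?_ c hc
  rintro ⟨p, σ⟩ ⟨h1, h2⟩
  simp only at h2
  subst h2
  rw [saug_single]; simp [hj]

theorem convex_acyclic {U : Set (Fin n → ℝ)} (hU : Convex ℝ U) (hne : U.Nonempty)
    {j : ℕ} {c : SC (Fin n → ℝ)} (hc : c ∈ SU U j) (hb : sbd c = 0) (ha : saug c = 0) :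
    ∃ e ∈ SU U (j + 1), c = sbd e := by
  obtain ⟨b, hbU⟩ := hne
  refine ⟨sCone b c, sCone_mem hU hbU hc, ?_⟩
  rw [sbd_sCone, hb, ha]; simp

end

end BF


namespace BF

open CubeFace

noncomputable section

variable {n : ℕ}

/-! ### neighbourhoods -/

/-- open convex neighbourhood of a face -/
def NF (F : CubeFace n) : Set (Fin n → ℝ) :=
  {x | ∀ i, (F i = some false → x i < 1 / 3) ∧ (F i = some true → 2 / 3 < x i)}

/-- neighbourhoods of faces of `K` -/
def NFs (K : Set (CubeFace n)) : Set (Set (Fin n → ℝ)) := Set.image NF K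

/-- neighbourhood of `K` -/
def NK (K : Set (CubeFace n)) : Set (Fin n → ℝ) := ⋃₀ NFs K

theorem NF_convex (F : CubeFace n) : Convex ℝ (NF F) := by
  intro x hx y hy a b ha hb hab i
  have key : ∀ u v : ℝ, (a • x + b • y) i = a * x i + b * y i := fun _ _ => rfl
  refine ⟨fun h => ?_, fun h => ?_⟩
  · have h1 := (hx i).1 h
    have h2 := (hy i).1 h
    rw [key 0 0]
    rcases ha.eq_or_lt with rfl | ha'
    · have : b = 1 := by linarith
      subst this; linarith
    · nlinarith
  · have h1 := (hx i).2 h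
    have h2 := (hy i).2 h
    rw [key 0 0]
    rcases ha.eq_or_lt with rfl | ha'
    · have : b = 1 := by linarith
      subst this; linarith
    · nlinarith

theorem NF_open (F : CubeFace n) : IsOpen (NF F) := by
  have : NF F = ⋂ i, {x | (F i = some false → x i < 1 / 3) ∧ (F i = some true → 2 / 3 < x i)} := by
    ext x; simp [NF]
  rw [this]
  refine isOpen_iInter_of_finite fun i => ?_
  rcases hF : F i with _ | _ | _
  · simp
  · simpa using isOpen_lt (continuous_apply i) continuous_const
  · simpa using isOpen_lt continuous_const (continuous_apply i)

theorem NF_mono {F G : CubeFace n} (h : F ≤ G) : NF F ⊆ NF G := by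
  intro x hx i
  rcases h i with h1 | h1
  · rw [h1]; simp
  · rw [← h1]; exact hx i

/-- coordinates of a vertex -/
def vpt (v : Fin n → Bool) : Fin n → ℝ := fun i => if v i then 1 else 0

/-- a vertex of a face -/
def someVert (F : CubeFace n) : Fin n → Bool := fun i => (F i).getD false

theorem someVert_le (F : CubeFace n) : toFace (someVert F) ≤ F := by
  intro i
  rcases hF : F i with _ | b
  · exact Or.inl rfl
  · right; simp [toFace, someVert, hF]

theorem vpt_mem {F : CubeFace n} {v : Fin n → Bool} (h : toFace v ≤ F) : vpt v ∈ NF F := by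
  intro i
  rcases h i with h1 | h1
  · rw [h1]; simp
  · rw [← h1]
    simp only [toFace, vpt, Option.some.injEq]
    refine ⟨fun h => ?_, fun h => ?_⟩ <;> rw [h] <;> norm_num

theorem NF_nonempty (F : CubeFace n) : (NF F).Nonempty := ⟨_, vpt_mem (someVert_le F)⟩

open Classical in
/-- the minimal face whose neighbourhood contains `x` -/
def Rx (x : Fin n → ℝ) : CubeFace n :=
  fun i => if x i < 1 / 3 then some false else if 2 / 3 < x i then some true else none

theorem mem_NF_iff {x : Fin n → ℝ} {F : CubeFace n} : x ∈ NF F ↔ Rx x ≤ F := by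
  rw [le_iff]
  refine forall_congr' fun i => ?_
  rcases hF : F i with _ | _ | _
  · simp
  · simp [Rx]
  · simp only [Rx, reduceCtorEq, Option.some.injEq, Bool.true_eq_false, false_imp_iff, true_and,
      forall_true_left, false_or]
    constructor
    · intro h
      rw [if_neg (by linarith), if_pos h]
    · intro h; split_ifs at h with h1 h2
      · simp at h
      · exact h2

theorem mem_NK {K : Set (CubeFace n)} (hK : Down K) {x : Fin n → ℝ} : x ∈ NK K ↔ Rx x ∈ K := by
  constructor
  · rintro ⟨_, ⟨F, hF, rfl⟩, hx⟩
    exact hK F hF _ (mem_NF_iff.1 hx)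
  · intro h
    exact ⟨_, ⟨_, h, rfl⟩, mem_NF_iff.2 le_rfl⟩

/-! ### the intersection of two faces -/

/-- small chains of `K` -/
abbrev SK (K : Set (CubeFace n)) (j : ℕ) : Submodule (ZMod 2) (SC (Fin n → ℝ)) := SS (NFs K) j

theorem SK_mono {K L : Set (CubeFace n)} (h : K ⊆ L) (j : ℕ) : SK K j ≤ SK L j := by
  refine Finsupp.supported_mono ?_
  rintro s ⟨⟨_, ⟨F, hF, rfl⟩, h2⟩, h3⟩
  exact ⟨⟨_, ⟨F, h hF, rfl⟩, h2⟩, h3⟩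

/-- the intersection of two faces -/
def meet (F G : CubeFace n) : CubeFace n := fun i => (F i).or (G i)

theorem meet_le_left (F G : CubeFace n) : meet F G ≤ F := by
  intro i
  rcases hF : F i with _ | b
  · exact Or.inl rfl
  · right; simp [meet, hF]

/-- two faces intersect -/
def Meets (F G : CubeFace n) : Prop := ∀ i, F i = none ∨ G i = none ∨ F i = G i

theorem meet_le_right {F G : CubeFace n} (h : Meets F G) : meet F G ≤ G := by
  intro i
  rcases h i with h | h | h
  · right; simp [meet, h]
  · exact Or.inl h
  · right; simp [meet, h]

theorem le_meet {F G H : CubeFace n} (h1 : H ≤ F) (h2 : H ≤ G) : H ≤ meet F G := by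
  intro i
  rcases hF : F i with _ | b
  · simpa [meet, hF] using h2 i
  · simpa [meet, hF] using h1 i

theorem meets_of_le {F G H : CubeFace n} (h1 : H ≤ F) (h2 : H ≤ G) : Meets F G := by
  intro i
  rcases h1 i with h | h
  · exact Or.inl h
  · rcases h2 i with h' | h'
    · exact Or.inr (Or.inl h')
    · exact Or.inr (Or.inr (h.symm.trans h'))

theorem SK_inter {K L : Set (CubeFace n)} (hK : Down K) (hL : Down L) {j : ℕ}
    {c : SC (Fin n → ℝ)} (h1 : c ∈ SK K j) (h2 : c ∈ SK L j) : c ∈ SK (K ∩ L) j := by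
  refine Finsupp.supported_mono ?_ (supported_inter_mem h1 h2)
  rintro ⟨p, σ⟩ ⟨⟨⟨_, ⟨F, hF, rfl⟩, hσ⟩, h3⟩, ⟨⟨_, ⟨G, hG, rfl⟩, hτ⟩, _⟩⟩
  simp only at hσ hτ h3
  have hm : Meets F G := by
    have hF := mem_NF_iff.1 (hσ ⟨vtx p 0, rfl⟩)
    have hG := mem_NF_iff.1 (hτ ⟨vtx p 0, rfl⟩)
    exact meets_of_le hF hG
  refine ⟨⟨_, ⟨meet F G, ⟨hK F hF _ (meet_le_left F G), hL G hG _ (meet_le_right hm)⟩, rfl⟩, ?_⟩, h3⟩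
  intro x hx
  exact mem_NF_iff.2 (le_meet (mem_NF_iff.1 (hσ hx)) (mem_NF_iff.1 (hτ hx)))

/-! ### the chain map -/

theorem down_below (F : CubeFace n) : Down {G | G ≤ F} := fun _ h _ h' => le_trans h' h

theorem star_below (F : CubeFace n) : StarAt {G | G ≤ F} (someVert F) :=
  fun G hG => ⟨F, le_refl F, hG, someVert_le F⟩

/-- the properties of the chain map in dimension at most `m` -/
def PhiProp (m : ℕ) (φ : Cell n →ₗ[ZMod 2] SC (Fin n → ℝ)) : Prop :=
  ∀ F : CubeFace n, dim F ≤ m → φ (Finsupp.single F 1) ∈ SU (NF F) (dim F) ∧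
    sbd (φ (Finsupp.single F 1)) = φ (bd (Finsupp.single F 1)) ∧
    saug (φ (Finsupp.single F 1)) = aug (Finsupp.single F 1)

theorem single_memCC {F : CubeFace n} {K : Set (CubeFace n)} (h : F ∈ K) :
    (Finsupp.single F 1 : Cell n) ∈ CC K (dim F) := Finsupp.single_mem_supported _ _ ⟨h, rfl⟩

theorem phi_mem {m : ℕ} {φ : Cell n →ₗ[ZMod 2] SC (Fin n → ℝ)} (hφ : PhiProp m φ)
    {K : Set (CubeFace n)} {j : ℕ} (hj : j ≤ m) {c : Cell n} (hc : c ∈ CC K j) :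
    φ c ∈ SK K j := by
  refine map_supported φ _ _ ?_ c hc
  rintro F ⟨hF, rfl⟩
  refine Finsupp.supported_mono ?_ (hφ F hj).1
  rintro s ⟨h1, h2⟩
  exact ⟨⟨_, ⟨F, hF, rfl⟩, h1⟩, h2⟩

theorem phi_sbd {m : ℕ} {φ : Cell n →ₗ[ZMod 2] SC (Fin n → ℝ)} (hφ : PhiProp m φ)
    {K : Set (CubeFace n)} {j : ℕ} (hj : j ≤ m) {c : Cell n} (hc : c ∈ CC K j) :
    sbd (φ c) = φ (bd c) := by
  refine eq_on_supported (sbd ∘ₗ φ) (φ ∘ₗ bd) _ ?_ c hc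
  rintro F ⟨hF, rfl⟩
  exact (hφ F hj).2.1

theorem phi_saug {m : ℕ} {φ : Cell n →ₗ[ZMod 2] SC (Fin n → ℝ)} (hφ : PhiProp m φ)
    {K : Set (CubeFace n)} {j : ℕ} (hj : j ≤ m) {c : Cell n} (hc : c ∈ CC K j) :
    saug (φ c) = aug c := by
  refine eq_on_supported (saug ∘ₗ φ) aug _ ?_ c hc
  rintro F ⟨hF, rfl⟩
  exact (hφ F hj).2.2

theorem SK_below (F : CubeFace n) (j : ℕ) : SK {G | G ≤ F} j ≤ SU (NF F) j := by
  refine Finsupp.supported_mono ?_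
  rintro s ⟨⟨_, ⟨G, hG, rfl⟩, h⟩, h2⟩
  exact ⟨h.trans (NF_mono hG), h2⟩

theorem SU_below (F : CubeFace n) (j : ℕ) : SU (NF F) j ≤ SK {G | G ≤ F} j := by
  refine Finsupp.supported_mono ?_
  rintro s ⟨h, h2⟩
  exact ⟨⟨_, ⟨F, le_refl F, rfl⟩, h⟩, h2⟩

theorem exists_phi (m : ℕ) : ∃ φ : Cell n →ₗ[ZMod 2] SC (Fin n → ℝ), PhiProp m φ := by
  classical
  induction m with
  | zero =>
    refine ⟨Finsupp.lsum (ZMod 2) fun F => LinearMap.toSpanSingleton (ZMod 2) _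
      (pt (vpt (someVert F))), ?_⟩
    intro F hF
    have h0 : dim F = 0 := by omega
    have hval : (Finsupp.lsum (ZMod 2) fun F : CubeFace n => LinearMap.toSpanSingleton (ZMod 2) _
      (pt (vpt (someVert F)))) (Finsupp.single F 1) = pt (vpt (someVert F)) := by simp
    rw [hval, h0]
    refine ⟨Finsupp.single_mem_supported _ _ ⟨?_, rfl⟩, ?_, ?_⟩
    · rintro _ ⟨t, rfl⟩
      exact vpt_mem (someVert_le F)
    · rw [sbd_single_zero, bd_zero (K := Set.univ), map_zero]
      rw [← h0]; exact single_memCC (Set.mem_univ _)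
    · rw [saug_single, aug_single, h0]
  | succ m ih =>
    obtain ⟨φ, hφ⟩ := ih
    have hex : ∀ F : CubeFace n, ∃ e, dim F = m + 1 →
        e ∈ SU (NF F) (m + 1) ∧ φ (bd (Finsupp.single F 1)) = sbd e := by
      intro F
      by_cases hF : dim F = m + 1
      · have h1 : (Finsupp.single F 1 : Cell n) ∈ CC {G | G ≤ F} (m + 1) := by
          rw [← hF]; exact single_memCC (le_refl F)
        have h2 := bd_mem (down_below F) h1
        obtain ⟨e, he, h⟩ := convex_acyclic (NF_convex F) (NF_nonempty F)
          (SK_below F m (phi_mem hφ le_rfl h2))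
          (by rw [phi_sbd hφ le_rfl h2, bd_bd, map_zero])
          (by rw [phi_saug hφ le_rfl h2, aug_bd])
        exact ⟨e, fun _ => ⟨he, h⟩⟩
      · exact ⟨0, fun h => absurd h hF⟩
    choose e he using hex
    set ψ : Cell n →ₗ[ZMod 2] SC (Fin n → ℝ) := Finsupp.lsum (ZMod 2) fun F =>
      LinearMap.toSpanSingleton (ZMod 2) _
        (if dim F = m + 1 then e F else φ (Finsupp.single F 1)) with hψ
    have hval : ∀ F, ψ (Finsupp.single F 1) =
        if dim F = m + 1 then e F else φ (Finsupp.single F 1) := by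
      intro F; simp [hψ]
    have hag : ∀ (j : ℕ), j ≤ m → ∀ c ∈ CC (Set.univ : Set (CubeFace n)) j, ψ c = φ c := by
      intro j hj c hc
      refine eq_on_supported ψ φ _ ?_ c hc
      rintro F ⟨_, hF⟩
      rw [hval, if_neg (by omega)]
    refine ⟨ψ, fun F hF => ?_⟩
    by_cases hm : dim F = m + 1
    · have h2 : bd (Finsupp.single F 1) ∈ CC (Set.univ : Set (CubeFace n)) m :=
        bd_mem (fun _ _ _ _ => Set.mem_univ _) (by rw [← hm]; exact single_memCC (Set.mem_univ _))
      obtain ⟨h3, h4⟩ := he F hm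
      rw [hag m le_rfl _ h2, hval, if_pos hm, h4]
      refine ⟨by rw [hm]; exact h3, rfl, ?_⟩
      rw [saug_pos (Nat.succ_ne_zero m) h3, aug_single, if_neg (by omega)]
    · rw [hval, if_neg hm]
      have hle : dim F ≤ m := by omega
      obtain ⟨h1, h2, h3⟩ := hφ F hle
      refine ⟨h1, ?_, h3⟩
      rw [h2]
      rcases hd : dim F with _ | j
      · rw [bd_zero (K := Set.univ), map_zero, map_zero]
        rw [← hd]; exact single_memCC (Set.mem_univ _)
      · rw [hag j (by omega)]
        exact bd_mem (fun _ _ _ _ => Set.mem_univ _)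
          (by rw [← hd]; exact single_memCC (Set.mem_univ _))

theorem dim_le (F : CubeFace n) : dim F ≤ n := by
  classical
  rw [dim_eq]
  exact (Finset.card_le_univ _).trans (by simp)

/-! ### acyclicity of unions -/

/-- the graded subcomplex `W` of `(V, D)` is acyclic -/
def Acy {V : Type*} [AddCommGroup V] [Module (ZMod 2) V] (D : V →ₗ[ZMod 2] V)
    (W : ℕ → Submodule (ZMod 2) V) : Prop :=
  ∀ p, ∀ z ∈ W p, D z = 0 → ∃ y ∈ W (p + 1), z = D y

theorem acy_union {V : Type*} [AddCommGroup V] [Module (ZMod 2) V] (D : V →ₗ[ZMod 2] V)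
    (W W₁ W₂ W₃ : ℕ → Submodule (ZMod 2) V)
    (hDD : ∀ v, D (D v) = 0)
    (h1 : ∀ p, ∀ v ∈ W₁ (p + 1), D v ∈ W₁ p) (h10 : ∀ v ∈ W₁ 0, D v = 0)
    (h2 : ∀ p, ∀ v ∈ W₂ (p + 1), D v ∈ W₂ p)
    (hW : ∀ p, W p ≤ W₁ p ⊔ W₂ p) (hW1 : ∀ p, W₁ p ≤ W p) (hW2 : ∀ p, W₂ p ≤ W p)
    (hW3 : ∀ p, W₁ p ⊓ W₂ p ≤ W₃ p) (hW31 : ∀ p, W₃ p ≤ W₁ p) (hW32 : ∀ p, W₃ p ≤ W₂ p)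
    (a1 : Acy D W₁) (a2 : Acy D W₂) (a3 : Acy D W₃) : Acy D W := by
  intro p z hz hDz
  obtain ⟨a, ha, b, hb, rfl⟩ := Submodule.mem_sup.1 (hW p hz)
  rw [map_add, add_eq_zero_iff'] at hDz
  obtain ⟨c, hc, hDc⟩ : ∃ c ∈ W₃ p, D a = D c := by
    rcases p with _ | p
    · exact ⟨0, Submodule.zero_mem _, by rw [h10 a ha, map_zero]⟩
    · exact a3 p (D a) (hW3 p ⟨h1 p a ha, by rw [hDz]; exact h2 p b hb⟩) (hDD a)
  obtain ⟨y, hy, hy'⟩ := a1 p (a + c) (Submodule.add_mem _ ha (hW31 p hc))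
    (by rw [map_add, hDc]; exact two_self _)
  obtain ⟨y2, hy2, hy2'⟩ := a2 p (b + c) (Submodule.add_mem _ hb (hW32 p hc))
    (by rw [map_add, ← hDz, hDc]; exact two_self _)
  refine ⟨y + y2, Submodule.add_mem _ (hW1 _ hy) (hW2 _ hy2), ?_⟩
  rw [map_add, ← hy', ← hy2']
  have := two_self c
  grind

/-! ### the mapping cone -/

/-- shifted cellular chains -/
def CM (K : Set (CubeFace n)) : ℕ → Submodule (ZMod 2) (Cell n)
  | 0 => ⊥
  | p + 1 => CC K p

/-- mapping cone chains -/
def MC (K : Set (CubeFace n)) (p : ℕ) : Submodule (ZMod 2) (Cell n × SC (Fin n → ℝ)) :=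
  (CM K p).prod (SK K p)

/-- mapping cone differential -/
def MD (φ : Cell n →ₗ[ZMod 2] SC (Fin n → ℝ)) :
    (Cell n × SC (Fin n → ℝ)) →ₗ[ZMod 2] (Cell n × SC (Fin n → ℝ)) :=
  (bd ∘ₗ LinearMap.fst _ _ _).prod (φ ∘ₗ LinearMap.fst _ _ _ + sbd ∘ₗ LinearMap.snd _ _ _)

theorem MD_apply (φ : Cell n →ₗ[ZMod 2] SC (Fin n → ℝ)) (c : Cell n) (e : SC (Fin n → ℝ)) :
    MD φ (c, e) = (bd c, φ c + sbd e) := rfl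

theorem phi_comm {φ : Cell n →ₗ[ZMod 2] SC (Fin n → ℝ)} (hφ : PhiProp n φ) (c : Cell n) :
    sbd (φ c) = φ (bd c) :=
  lin_ext (sbd ∘ₗ φ) (φ ∘ₗ bd) (fun F => (hφ F (dim_le F)).2.1) c

theorem phi_mem' {φ : Cell n →ₗ[ZMod 2] SC (Fin n → ℝ)} (hφ : PhiProp n φ)
    {K : Set (CubeFace n)} {j : ℕ} {c : Cell n} (hc : c ∈ CC K j) :
    φ c ∈ SK K j := by
  refine map_supported φ _ _ ?_ c hc
  rintro F ⟨hF, rfl⟩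
  refine Finsupp.supported_mono ?_ (hφ F (dim_le F)).1
  rintro s ⟨h1, h2⟩
  exact ⟨⟨_, ⟨F, hF, rfl⟩, h1⟩, h2⟩

theorem phi_saug' {φ : Cell n →ₗ[ZMod 2] SC (Fin n → ℝ)} (hφ : PhiProp n φ) (c : Cell n) :
    saug (φ c) = aug c :=
  lin_ext (saug ∘ₗ φ) aug (fun F => (hφ F (dim_le F)).2.2) c

theorem MD_MD {φ : Cell n →ₗ[ZMod 2] SC (Fin n → ℝ)} (hφ : PhiProp n φ)
    (v : Cell n × SC (Fin n → ℝ)) : MD φ (MD φ v) = 0 := by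
  obtain ⟨c, e⟩ := v
  rw [MD_apply, MD_apply, bd_bd, map_add, sbd_sbd, phi_comm hφ, add_zero, two_self]
  rfl

theorem MD_mem {φ : Cell n →ₗ[ZMod 2] SC (Fin n → ℝ)} (hφ : PhiProp n φ)
    {K : Set (CubeFace n)} (hK : Down K) (p : ℕ) (v) (hv : v ∈ MC K (p + 1)) :
    MD φ v ∈ MC K p := by
  obtain ⟨c, e⟩ := v
  obtain ⟨h1, h2⟩ := hv
  have h1 : c ∈ CC K p := h1
  refine ⟨?_, Submodule.add_mem _ (phi_mem' hφ h1) (sbd_memS h2)⟩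
  rcases p with _ | p
  · exact bd_zero h1
  · exact bd_mem hK h1

theorem MD_zero {φ : Cell n →ₗ[ZMod 2] SC (Fin n → ℝ)}
    {K : Set (CubeFace n)} (v) (hv : v ∈ MC K 0) : MD φ v = 0 := by
  obtain ⟨c, e⟩ := v
  obtain ⟨h1, h2⟩ := hv
  have h1 : c = 0 := h1
  have h2 : e ∈ SK K 0 := h2
  rw [MD_apply, h1, sbd_zero' rfl h2]
  simp

theorem CM_mono {K L : Set (CubeFace n)} (h : K ⊆ L) (p : ℕ) : CM K p ≤ CM L p := by
  rcases p with _ | p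
  · exact le_rfl
  · exact CC_mono h p

theorem MC_mono {K L : Set (CubeFace n)} (h : K ⊆ L) (p : ℕ) : MC K p ≤ MC L p :=
  Submodule.prod_mono (CM_mono h p) (SK_mono h p)

theorem MC_union (K L : Set (CubeFace n)) (p : ℕ) : MC (K ∪ L) p ≤ MC K p ⊔ MC L p := by
  rintro ⟨c, e⟩ ⟨h1, h2⟩
  have hc : ∃ c1 ∈ CM K p, ∃ c2 ∈ CM L p, c = c1 + c2 := by
    rcases p with _ | p
    · exact ⟨0, rfl, 0, rfl, by rw [show c = 0 from h1]; simp⟩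
    · refine supported_split (s := {F | F ∈ K ∧ dim F = p}) (t := {F | F ∈ L ∧ dim F = p}) ?_
      refine Finsupp.supported_mono ?_ h1
      rintro F ⟨h3 | h3, h4⟩
      · exact Or.inl ⟨h3, h4⟩
      · exact Or.inr ⟨h3, h4⟩
  have he : ∃ e1 ∈ SK K p, ∃ e2 ∈ SK L p, e = e1 + e2 := by
    refine supported_split ?_
    refine Finsupp.supported_mono ?_ h2
    rintro s ⟨⟨_, ⟨F, hF | hF, rfl⟩, h3⟩, h4⟩
    · exact Or.inl ⟨⟨_, ⟨F, hF, rfl⟩, h3⟩, h4⟩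
    · exact Or.inr ⟨⟨_, ⟨F, hF, rfl⟩, h3⟩, h4⟩
  obtain ⟨c1, hc1, c2, hc2, rfl⟩ := hc
  obtain ⟨e1, he1, e2, he2, rfl⟩ := he
  exact Submodule.mem_sup.2 ⟨(c1, e1), ⟨hc1, he1⟩, (c2, e2), ⟨hc2, he2⟩, rfl⟩

theorem MC_inter {K L : Set (CubeFace n)} (hK : Down K) (hL : Down L) (p : ℕ) :
    MC K p ⊓ MC L p ≤ MC (K ∩ L) p := by
  rintro ⟨c, e⟩ ⟨⟨h1, h2⟩, ⟨h3, h4⟩⟩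
  refine ⟨?_, SK_inter hK hL h2 h4⟩
  rcases p with _ | p
  · exact h1
  · refine Finsupp.supported_mono ?_ (supported_inter_mem h1 h3)
    rintro F ⟨⟨h5, h6⟩, ⟨h7, _⟩⟩
    exact ⟨⟨h5, h7⟩, h6⟩

theorem acy_below {φ : Cell n →ₗ[ZMod 2] SC (Fin n → ℝ)} (hφ : PhiProp n φ) (F : CubeFace n) :
    Acy (MD φ) (MC {G | G ≤ F}) := by
  rintro p ⟨c, e⟩ ⟨h1, h2⟩ hD
  have h2 : e ∈ SU (NF F) p := SK_below F p h2
  rw [MD_apply] at hD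
  have hb : bd c = 0 := congrArg Prod.fst hD
  have he : φ c = sbd e := add_eq_zero_iff'.1 (congrArg Prod.snd hD)
  obtain ⟨x, hx, hcx, hax⟩ : ∃ x ∈ CC {G | G ≤ F} p, c = bd x ∧ saug (e + φ x) = 0 := by
    rcases p with _ | p
    · have h1 : c = 0 := h1
      have hv : (Finsupp.single (toFace (someVert F)) 1 : Cell n) ∈ CC {G | G ≤ F} 0 :=
        Finsupp.single_mem_supported _ _ ⟨someVert_le F, dim_toFace _⟩
      refine ⟨saug e • Finsupp.single (toFace (someVert F)) 1, Submodule.smul_mem _ _ hv, ?_, ?_⟩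
      · rw [map_smul, bd_zero hv, smul_zero, h1]
      · rw [map_add, phi_saug' hφ, map_smul, aug_single, if_pos (dim_toFace _), smul_eq_mul, mul_one]
        exact two_self _
    · have h1 : c ∈ CC {G | G ≤ F} p := h1
      obtain ⟨x, hx, hcx⟩ : ∃ x ∈ CC {G | G ≤ F} (p + 1), c = bd x := by
        rcases p with _ | p
        · refine star_acyclic_zero (down_below F) (star_below F) h1 ?_
          rw [← phi_saug' hφ, he, saug_sbd]
        · exact star_acyclic (down_below F) (star_below F) (Nat.succ_ne_zero p) h1 hb
      refine ⟨x, hx, hcx, ?_⟩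
      rw [map_add, saug_pos (Nat.succ_ne_zero p) h2,
        saug_pos (Nat.succ_ne_zero p) (SK_below F _ (phi_mem' hφ hx)), add_zero]
  obtain ⟨y, hy, hey⟩ := convex_acyclic (NF_convex F) (NF_nonempty F)
    (Submodule.add_mem _ h2 (SK_below F p (phi_mem' hφ hx)))
    (by rw [map_add, phi_comm hφ, ← hcx, ← he]; exact two_self _) hax
  refine ⟨(x, y), ⟨hx, SU_below F _ hy⟩, ?_⟩
  rw [MD_apply, ← hcx, ← hey]
  have := two_self (φ x)
  have h3 : φ x + (e + φ x) = e := by grind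
  rw [h3]

instance : Finite (CubeFace n) := inferInstanceAs (Finite (Fin n → Option Bool))

theorem exists_max {K : Set (CubeFace n)} (hK : K.Nonempty) :
    ∃ F ∈ K, ∀ G ∈ K, F ≤ G → G = F := by
  obtain ⟨F, hF⟩ := (Set.toFinite K).exists_maximal hK
  exact ⟨F, hF.1, fun G hG h => le_antisymm (hF.2 hG h) h⟩

theorem acy_all {φ : Cell n →ₗ[ZMod 2] SC (Fin n → ℝ)} (hφ : PhiProp n φ) :
    ∀ (N : ℕ) (K : Set (CubeFace n)), K.ncard = N → Down K → Acy (MD φ) (MC K) := by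
  intro N
  induction N using Nat.strong_induction_on with
  | _ N ih =>
    intro K hN hK
    rcases K.eq_empty_or_nonempty with rfl | hne
    · rintro p ⟨c, e⟩ ⟨h1, h2⟩ _
      refine ⟨0, Submodule.zero_mem _, ?_⟩
      have h1 : c = 0 := by
        rcases p with _ | p
        · exact h1
        · apply supported_empty_eq
          refine Finsupp.supported_mono ?_ h1
          rintro F ⟨h, _⟩; exact h
      have h2 : e = 0 := by
        apply supported_empty_eq
        refine Finsupp.supported_mono ?_ h2
        rintro s ⟨⟨_, ⟨F, hF, _⟩, _⟩, _⟩
        exact hF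
      rw [h1, h2, map_zero]; rfl
    · obtain ⟨F, hF, hmax⟩ := exists_max hne
      have hd1 : Down (K \ {F}) := by
        rintro G ⟨hG, hGF⟩ H hH
        refine ⟨hK G hG H hH, ?_⟩
        rintro rfl
        exact hGF (hmax G hG hH)
      have hsub : {G | G ≤ F} ⊆ K := fun G hG => hK F hF G hG
      have hd2 : Down ((K \ {F}) ∩ {G | G ≤ F}) :=
        fun G hG H hH => ⟨hd1 G hG.1 H hH, down_below F G hG.2 H hH⟩
      have hlt : (K \ {F}).ncard < N := by
        rw [← hN]; exact Set.ncard_sdiff_singleton_lt_of_mem hF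
      have hlt2 : ((K \ {F}) ∩ {G | G ≤ F}).ncard < N :=
        lt_of_le_of_lt (Set.ncard_le_ncard Set.inter_subset_left) hlt
      refine acy_union (MD φ) _ (MC (K \ {F})) (MC {G | G ≤ F}) (MC ((K \ {F}) ∩ {G | G ≤ F}))
        (MD_MD hφ) (MD_mem hφ hd1) MD_zero (MD_mem hφ (down_below F)) ?_
        (fun p => MC_mono Set.sdiff_subset p) (fun p => MC_mono hsub p)
        (fun p => MC_inter hd1 (down_below F) p)
        (fun p => MC_mono Set.inter_subset_left p) (fun p => MC_mono Set.inter_subset_right p)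
        (ih _ hlt _ rfl hd1) (acy_below hφ F) (ih _ hlt2 _ rfl hd2)
      intro p
      refine le_trans (MC_mono ?_ p) (MC_union _ _ p)
      intro G hG
      by_cases h : G = F
      · right; exact h.le
      · left; exact ⟨hG, h⟩

theorem mem_subOf {V : Type*} [AddCommGroup V] [Module (ZMod 2) V] {N M : Submodule (ZMod 2) V}
    {x : ↥M} : x ∈ N.submoduleOf M ↔ (x : V) ∈ N := Iff.rfl

/-- cellular homology agrees with the singular homology of the neighbourhood -/
theorem cell_sing {K : Set (CubeFace n)} (hK : Down K) (j : ℕ) :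
    Nonempty (Hq bd (CC K j) (CC K (j + 1)) ≃ₗ[ZMod 2] Hq sbd (SU (NK K) j) (SU (NK K) (j + 1))) := by
  obtain ⟨φ, hφ⟩ := exists_phi (n := n) n
  have hacy := acy_all hφ _ K rfl hK
  have ho : ∀ U ∈ NFs K, IsOpen U := by rintro _ ⟨F, _, rfl⟩; exact NF_open F
  have hmem : ∀ j, ∀ c ∈ CC K j, φ c ∈ SU (NK K) j := fun j c hc => SS_le_SU _ _ (phi_mem' hφ hc)
  have hf : ∀ c ∈ CC K j ⊓ LinearMap.ker bd, φ c ∈ SU (NK K) j ⊓ LinearMap.ker sbd := by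
    rintro c ⟨h1, h2⟩
    refine ⟨hmem j c h1, ?_⟩
    change sbd (φ c) = 0
    rw [phi_comm hφ, LinearMap.mem_ker.1 h2, map_zero]
  refine quot_equiv (φ.restrict hf) _ _ ?_ ?_
  · rintro ⟨c, hc1, hc2⟩
    rw [mem_subOf, mem_subOf]
    simp only [LinearMap.restrict_coe_apply]
    constructor
    · rintro ⟨e, he, h⟩
      obtain ⟨e', he', hs⟩ := small_simplices (NFs K) ho (j + 1) e he
        (Or.inr (by rw [h]; exact phi_mem' hφ hc1))
      obtain ⟨⟨x, y⟩, ⟨hx, hy⟩, hxy⟩ := hacy (j + 1) (c, e + sbd e') ⟨hc1, hs⟩ (by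
        rw [MD_apply, LinearMap.mem_ker.1 hc2, map_add, sbd_sbd, add_zero, h, two_self]; rfl)
      rw [MD_apply] at hxy
      exact ⟨x, hx, (congrArg Prod.fst hxy).symm⟩
    · rintro ⟨x, hx, h⟩
      refine ⟨φ x, hmem _ x hx, ?_⟩
      rw [phi_comm hφ, h]
  · rintro ⟨w, hw1, hw2⟩
    obtain ⟨e', he', hs⟩ := small_simplices (NFs K) ho j w hw1
        (Or.inr (by rw [LinearMap.mem_ker.1 hw2]; exact Submodule.zero_mem _))
    obtain ⟨⟨x, y⟩, ⟨hx, hy⟩, hxy⟩ := hacy j (0, w + sbd e') ⟨Submodule.zero_mem _, hs⟩ (by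
        rw [MD_apply, map_zero, map_zero, zero_add, map_add, sbd_sbd, LinearMap.mem_ker.1 hw2]
        simp)
    rw [MD_apply] at hxy
    have h1 : 0 = bd x := congrArg Prod.fst hxy
    have h2 : w + sbd e' = φ x + sbd y := congrArg Prod.snd hxy
    refine ⟨⟨x, hx, h1.symm⟩, ?_⟩
    rw [mem_subOf]
    refine ⟨e' + y, Submodule.add_mem _ he' (SS_le_SU _ _ hy), ?_⟩
    simp only [map_add, Submodule.coe_add, LinearMap.restrict_coe_apply]
    have h3 := two_self (sbd e')
    have h4 := two_self (φ x)
    grind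

end

end BF


namespace BF
open CubeFace
noncomputable section

section cat
open CategoryTheory

/-- singular homology as a functor -/
def HF (j : ℕ) : TopCat.{0} ⥤ ModuleCat.{0} (ZMod 2) :=
  TopCat.toSSet ⋙ (SimplicialObject.whiskering _ _).obj (ModuleCat.free (ZMod 2)) ⋙
    AlgebraicTopology.alternatingFaceMapComplex (ModuleCat (ZMod 2)) ⋙
    HomologicalComplex.homologyFunctor _ _ j

theorem HF_obj (X : Type) [TopologicalSpace X] (j : ℕ) :
    (HF j).obj (TopCat.of X) = sHomology (ZMod 2) X j := rfl

theorem HF_homotopic {X Y : TopCat.{0}} (f g : X ⟶ Y) (h : TopCat.Homotopy f g) (j : ℕ) :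
    (HF j).map f = (HF j).map g := by
  have H1 := (TopCat.Homotopy.toSSet h).toSimplicialObjectHomotopy
  have H2 := H1.whiskerRight (ModuleCat.free (ZMod 2))
  have H3 := H2.toChainHomotopy
  exact H3.homologyMap_eq j

theorem HF_homotopic' {X Y : Type} [TopologicalSpace X] [TopologicalSpace Y]
    (f g : C(X, Y)) (h : f.Homotopic g) (j : ℕ) :
    (HF j).map (TopCat.ofHom f) = (HF j).map (TopCat.ofHom g) := by
  obtain ⟨h⟩ := h
  refine HF_homotopic _ _ (?_ : TopCat.Homotopy _ _) j
  exact h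
end cat
end
end BF


namespace BF
open CubeFace
noncomputable section

section cat
open CategoryTheory

theorem homology_iso_Hq (C : ChainComplex (ModuleCat.{0} (ZMod 2)) ℕ)
    {V : Type*} [AddCommGroup V] [Module (ZMod 2) V] (D : V →ₗ[ZMod 2] V)
    (W : ℕ → Submodule (ZMod 2) V) (θ : ∀ p, C.X p →ₗ[ZMod 2] V)
    (hinj : ∀ p, Function.Injective (θ p)) (hW : ∀ p, LinearMap.range (θ p) = W p)
    (hd : ∀ p x, θ p (C.d (p + 1) p x) = D (θ (p + 1) x)) (h0 : ∀ x, D (θ 0 x) = 0) (j : ℕ) :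
    Nonempty (C.homology j ≃ₗ[ZMod 2] Hq D (W j) (W (j + 1))) := by
  obtain ⟨k, hk⟩ : ∃ k, (ComplexShape.down ℕ).next j = k := ⟨_, rfl⟩
  have hker : ∀ x : C.X j, C.d j k x = 0 ↔ D (θ j x) = 0 := by
    intro x
    rcases j with _ | j
    · simp only [h0, iff_true]
      rw [C.shape 0 k (by simp)]
      rfl
    · have hk' : k = j := by rw [← hk]; exact ChainComplex.next_nat_succ j
      subst hk'
      rw [← hd, map_eq_zero_iff _ (hinj _)]
  let S := C.sc' (j + 1) j k
  have e1 : C.homology j ≅ S.homology :=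
    ShortComplex.homologyMapIso (C.isoSc' (j + 1) j k (by simp) hk)
  have e2 := e1 ≪≫ S.moduleCatHomologyIso
  let f : LinearMap.ker S.g.hom →ₗ[ZMod 2] ↥(W j ⊓ LinearMap.ker D) :=
    LinearMap.codRestrict _ ((θ j).comp (LinearMap.ker S.g.hom).subtype) (by
      rintro ⟨x, hx⟩
      refine ⟨hW j ▸ LinearMap.mem_range_self _ x, ?_⟩
      exact (hker x).1 hx)
  have e3 := quot_equiv f (LinearMap.range S.moduleCatToCycles)
    ((W (j+1)).map D |>.submoduleOf (W j ⊓ LinearMap.ker D)) (by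
      rintro ⟨x, hx⟩
      rw [mem_subOf]
      constructor
      · rintro ⟨w, hw, hw'⟩
        have hw2 : w ∈ LinearMap.range (θ (j+1)) := by rw [hW]; exact hw
        obtain ⟨y, rfl⟩ := hw2
        refine ⟨y, Subtype.ext ?_⟩
        refine hinj j ?_
        exact (hd j y).trans hw'
      · rintro ⟨y, hy⟩
        refine ⟨θ (j+1) y, hW (j+1) ▸ LinearMap.mem_range_self _ y, ?_⟩
        refine (hd j y).symm.trans ?_
        exact congrArg (θ j) (congrArg Subtype.val hy)) (by
      rintro ⟨w, hw, hw'⟩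
      have hw2 : w ∈ LinearMap.range (θ j) := by rw [hW]; exact hw
      obtain ⟨y, rfl⟩ := hw2
      refine ⟨⟨y, (hker y).2 hw'⟩, ?_⟩
      rw [mem_subOf]
      have : θ j y + θ j y = 0 := two_self _
      change θ j y + θ j y ∈ _
      rw [this]; exact Submodule.zero_mem _)
  obtain ⟨e3⟩ := e3
  exact ⟨e2.toLinearEquiv.trans e3⟩

/-- simplices of a subspace as simplices of the ambient space -/
def simpl {E : Type} [TopologicalSpace E] (U : Set E) (p : ℕ)
    (s : (TopCat.toSSet.obj (TopCat.of ↥U)).obj (Opposite.op (SimplexCategory.mk p))) : Sing E :=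
  ⟨p, (ContinuousMap.mk Subtype.val continuous_subtype_val : C(↥U, E)).comp
    ((TopCat.toSSetObjEquiv (TopCat.of ↥U) (Opposite.op (SimplexCategory.mk p))) s)⟩

theorem simpl_inj {E : Type} [TopologicalSpace E] (U : Set E) (p : ℕ) :
    Function.Injective (simpl U p) := by
  intro s t h
  apply (TopCat.toSSetObjEquiv (TopCat.of ↥U) (Opposite.op (SimplexCategory.mk p))).injective
  simp only [simpl, Sigma.mk.injEq, heq_eq_eq, true_and] at h
  ext x
  exact DFunLike.congr_fun h x

theorem simpl_range {E : Type} [TopologicalSpace E] (U : Set E) (p : ℕ) :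
    Set.range (simpl U p) = {s : Sing E | Set.range s.2 ⊆ U ∧ s.1 = p} := by
  ext ⟨q, σ⟩
  constructor
  · rintro ⟨s, hs⟩
    rw [← hs]
    refine ⟨?_, rfl⟩
    rintro _ ⟨x, rfl⟩
    exact Subtype.property _
  · rintro ⟨h1, h2⟩
    simp only at h2 
    subst h2
    refine ⟨(TopCat.toSSetObjEquiv (TopCat.of ↥U) (Opposite.op (SimplexCategory.mk q))).symm
      ⟨fun x => ⟨σ x, h1 ⟨x, rfl⟩⟩, by fun_prop⟩, ?_⟩
    simp only [simpl, Equiv.apply_symm_apply]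
    rfl

theorem simpl_face {E : Type} [TopologicalSpace E] (U : Set E) (p : ℕ) (i : Fin (p + 2))
    (s : (TopCat.toSSet.obj (TopCat.of ↥U)).obj (Opposite.op (SimplexCategory.mk (p + 1)))) :
    simpl U p ((TopCat.toSSet.obj (TopCat.of ↥U)).map (SimplexCategory.δ i).op s) =
      ⟨p, (simpl U (p+1) s).2.comp (dface i)⟩ := by
  simp only [simpl]
  congr 1
  ext t
  simp only [ContinuousMap.comp_apply, ContinuousMap.coe_mk]
  congr 1
  have : dface i t = stdSimplex.map (SimplexCategory.δ i) t := by
    ext k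
    rw [stdSimplex.map_coe, affC_apply]
    refine (aff_coe _ _ _).trans ?_
    rw [FunOnFinite.linearMap_apply_apply]
    simp only [vtx]
    rw [Finset.sum_filter]
    refine Finset.sum_congr rfl fun x _ => ?_
    have : (SimplexCategory.δ i) x = i.succAbove x := rfl
    rw [this]
    by_cases h : i.succAbove x = k
    · subst h; simp; rfl
    · simp [h, Ne.symm h]
  exact (congrArg (((TopCat.of ↑U).toSSetObjEquiv (Opposite.op { len := p + 1 })) s) this.symm)

theorem simpl_map_range {E : Type} [TopologicalSpace E] (U : Set E) (p : ℕ) :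
    LinearMap.range (Finsupp.lmapDomain (ZMod 2) (ZMod 2) (simpl U p)) = SU U p := by
  rw [LinearMap.range_eq_map, ← Finsupp.supported_univ, Finsupp.lmapDomain_supported,
    Set.image_univ, simpl_range]

/-- the singular complex -/
abbrev SCx {E : Type} [TopologicalSpace E] (U : Set E) : ChainComplex (ModuleCat.{0} (ZMod 2)) ℕ :=
  (AlgebraicTopology.alternatingFaceMapComplex (ModuleCat (ZMod 2))).obj
    (((SimplicialObject.whiskering _ _).obj (ModuleCat.free (ZMod 2))).obj
      (TopCat.toSSet.obj (TopCat.of ↥U)))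

theorem zsign (V : Type*) [AddCommGroup V] [Module (ZMod 2) V] (i : ℕ) (v : V) :
    ((-1 : ℤ) ^ i) • v = v := by
  rcases neg_one_pow_eq_or ℤ i with h | h
  · rw [h, one_smul]
  · rw [h, neg_smul, one_smul]
    have := two_self v
    exact neg_eq_of_add_eq_zero_left this

theorem alt_sum {A B : ModuleCat.{0} (ZMod 2)} {m : ℕ} (f : Fin m → (A ⟶ B)) (x : A) :
    ModuleCat.Hom.hom (∑ i : Fin m, ((-1 : ℤ) ^ (i : ℕ)) • f i : A ⟶ B) x = ∑ i, ModuleCat.Hom.hom (f i) x := by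
  rw [ModuleCat.hom_sum, LinearMap.sum_apply]
  refine Finset.sum_congr rfl fun i _ => ?_
  rw [ModuleCat.hom_zsmul, LinearMap.smul_apply, zsign]

theorem SCx_d {E : Type} [TopologicalSpace E] (U : Set E) (p : ℕ)
    (s : (TopCat.toSSet.obj (TopCat.of ↥U)).obj (Opposite.op (SimplexCategory.mk (p + 1)))) :
    ((SCx U).d (p + 1) p) (ModuleCat.freeMk s) =
      ∑ i : Fin (p + 2), ModuleCat.freeMk (R := ZMod 2)
        ((TopCat.toSSet.obj (TopCat.of ↥U)).map (SimplexCategory.δ i).op s) := by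
  have h := AlgebraicTopology.AlternatingFaceMapComplex.obj_d_eq
    (((SimplicialObject.whiskering _ _).obj (ModuleCat.free (ZMod 2))).obj
      (TopCat.toSSet.obj (TopCat.of ↥U))) p
  refine (congrArg (fun f => ModuleCat.Hom.hom f (ModuleCat.freeMk s)) h).trans ?_
  refine (alt_sum _ _).trans ?_
  refine Finset.sum_congr rfl fun i _ => ?_
  exact ModuleCat.free_map_apply _ _ 

theorem SCx_comm {E : Type} [TopologicalSpace E] (U : Set E) (p : ℕ) :
    (Finsupp.lmapDomain (ZMod 2) (ZMod 2) (simpl U p)).comp ((SCx U).d (p + 1) p).hom =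
      sbd.comp (Finsupp.lmapDomain (ZMod 2) (ZMod 2) (simpl U (p+1))) := by
  refine Finsupp.lhom_ext' fun s => LinearMap.ext_ring ?_
  have h := congrArg (Finsupp.lmapDomain (ZMod 2) (ZMod 2) (simpl U p)) (SCx_d U p s)
  refine h.trans ((map_sum (Finsupp.lmapDomain (ZMod 2) (ZMod 2) (simpl U p)) _ _).trans ?_)
  refine Eq.trans ?_ ((sbd_single p (simpl U (p+1) s).2).symm.trans
    (congrArg sbd (Finsupp.mapDomain_single (f := simpl U (p+1))).symm))
  refine Finset.sum_congr rfl fun i _ => ?_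
  exact Finsupp.mapDomain_single.trans
    (congrArg (fun x => Finsupp.single x (1 : ZMod 2)) (simpl_face U p i s))

theorem sHom_Hq {E : Type} [TopologicalSpace E] (U : Set E) (j : ℕ) :
    Nonempty (sHomology (ZMod 2) ↥U j ≃ₗ[ZMod 2] Hq sbd (SU U j) (SU U (j + 1))) := by
  refine homology_iso_Hq (SCx U) sbd (SU U) (fun p => Finsupp.lmapDomain (ZMod 2) (ZMod 2) (simpl U p))
    ?_ ?_ ?_ ?_ j
  · intro p
    exact Finsupp.mapDomain_injective (simpl_inj U p)
  · intro p
    exact simpl_map_range U p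
  · intro p x
    exact LinearMap.congr_fun (SCx_comm U p) x
  · intro x
    refine sbd_zero' (j := 0) rfl (P := fun s => Set.range s.2 ⊆ U) ?_
    exact (simpl_map_range U 0).le (LinearMap.mem_range_self _ x)

end cat
end
end BF


namespace BF
open CubeFace
noncomputable section

section iso
open CategoryTheory
variable {A B C D : Type} [TopologicalSpace A] [TopologicalSpace B] [TopologicalSpace C]
  [TopologicalSpace D]

/-- a map inducing isomorphisms in homology -/
def IsoH (f : C(A, B)) : Prop := ∀ j, IsIso ((HF j).map (TopCat.ofHom f))

theorem HF_comp (f : C(A, B)) (g : C(B, C)) (j : ℕ) :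
    (HF j).map (TopCat.ofHom (g.comp f)) =
      (HF j).map (TopCat.ofHom f) ≫ (HF j).map (TopCat.ofHom g) := by
  rw [← Functor.map_comp, ← TopCat.ofHom_comp]

theorem IsoH_of_homotopic_id {f : C(A, A)} (h : f.Homotopic (ContinuousMap.id A)) : IsoH f := by
  intro j
  rw [HF_homotopic' _ _ h j]
  have : (HF j).map (TopCat.ofHom (ContinuousMap.id A)) = 𝟙 _ := (HF j).map_id _
  rw [this]
  infer_instance

theorem two_of_six {f : C(A, B)} {g : C(B, C)} {h : C(C, D)} (h1 : IsoH (g.comp f))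
    (h2 : IsoH (h.comp g)) : IsoH f ∧ IsoH g ∧ IsoH h := by
  have hg : IsoH g := by
    intro j
    have a1 := h1 j
    have a2 := h2 j
    rw [HF_comp] at a1 a2
    have : Mono ((HF j).map (TopCat.ofHom g)) :=
      mono_of_mono _ ((HF j).map (TopCat.ofHom h))
    have : IsSplitEpi ((HF j).map (TopCat.ofHom g)) :=
      ⟨⟨⟨inv ((HF j).map (TopCat.ofHom f) ≫ (HF j).map (TopCat.ofHom g)) ≫
        (HF j).map (TopCat.ofHom f), by simp⟩⟩⟩
    exact isIso_of_mono_of_isSplitEpi _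
  refine ⟨fun j => ?_, hg, fun j => ?_⟩
  · have a1 := h1 j
    rw [HF_comp] at a1
    have := hg j
    exact IsIso.of_isIso_comp_right _ ((HF j).map (TopCat.ofHom g))
  · have a1 := h2 j
    rw [HF_comp] at a1
    have := hg j
    exact IsIso.of_isIso_comp_left ((HF j).map (TopCat.ofHom g)) _

theorem IsoH_of_inv {f : C(A, B)} {g : C(B, A)} (h1 : (g.comp f).Homotopic (ContinuousMap.id A))
    (h2 : (f.comp g).Homotopic (ContinuousMap.id B)) : IsoH f :=
  (two_of_six (IsoH_of_homotopic_id h1) (IsoH_of_homotopic_id h2)).1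

theorem IsoH.comp {f : C(A, B)} {g : C(B, C)} (hf : IsoH f) (hg : IsoH g) : IsoH (g.comp f) := by
  intro j
  rw [HF_comp]
  have := hf j
  have := hg j
  infer_instance

theorem IsoH.equiv {f : C(A, B)} (hf : IsoH f) (j : ℕ) :
    Nonempty (sHomology (ZMod 2) A j ≃ₗ[ZMod 2] sHomology (ZMod 2) B j) := by
  have := hf j
  exact ⟨(asIso ((HF j).map (TopCat.ofHom f))).toLinearEquiv⟩

end iso

theorem line_homotopic {X : Type} [TopologicalSpace X] {n : ℕ} {U : Set (Fin n → ℝ)}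
    (f g : C(X, ↥U))
    (h : ∀ x, ∀ t : ℝ, 0 ≤ t → t ≤ 1 → (1 - t) • (f x).1 + t • (g x).1 ∈ U) :
    f.Homotopic g := by
  refine ⟨⟨⟨fun p => ⟨(1 - (p.1 : ℝ)) • (f p.2).1 + (p.1 : ℝ) • (g p.2).1,
    h p.2 p.1 p.1.2.1 p.1.2.2⟩, ?_⟩, ?_, ?_⟩⟩
  · fun_prop
  · intro x; apply Subtype.ext; simp
  · intro x; apply Subtype.ext; simp

section clamp
variable {n : ℕ}

/-- closed geometric face -/
def CF (F : CubeFace n) : Set (Fin n → ℝ) := {x | (∀ i, 0 ≤ x i ∧ x i ≤ 1) ∧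
    ∀ i, (F i = some false → x i = 0) ∧ (F i = some true → x i = 1)}

theorem mem_real {K : Set (CubeFace n)} {x : Fin n → ℝ} : x ∈ real K ↔ ∃ F ∈ K, x ∈ CF F := by
  simp only [real, CF, Set.mem_iUnion, exists_prop]

theorem CF_convex (F : CubeFace n) : Convex ℝ (CF F) := by
  intro x hx y hy a b ha hb hab
  have key : ∀ i, (a • x + b • y) i = a * x i + b * y i := fun _ => rfl
  refine ⟨fun i => ?_, fun i => ⟨fun h => ?_, fun h => ?_⟩⟩
  · rw [key]
    have h1 := hx.1 i; have h2 := hy.1 i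
    constructor
    · nlinarith [mul_nonneg ha h1.1, mul_nonneg hb h2.1]
    · nlinarith [mul_nonneg ha (sub_nonneg.2 h1.2), mul_nonneg hb (sub_nonneg.2 h2.2)]
  · rw [key, (hx.2 i).1 h, (hy.2 i).1 h]; simp
  · rw [key, (hx.2 i).2 h, (hy.2 i).2 h]; simpa using hab

theorem CF_sub_NF (F : CubeFace n) : CF F ⊆ NF F := by
  intro x hx i
  refine ⟨fun h => ?_, fun h => ?_⟩
  · rw [(hx.2 i).1 h]; norm_num
  · rw [(hx.2 i).2 h]; norm_num

/-- clamping -/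
def clamp (x : Fin n → ℝ) : Fin n → ℝ := fun i => max 0 (min 1 (3 * x i - 1))

theorem clamp_cont : Continuous (clamp (n := n)) := by
  unfold clamp
  fun_prop

theorem clamp_mem {F : CubeFace n} {x : Fin n → ℝ} (hx : x ∈ NF F) : clamp x ∈ CF F := by
  refine ⟨fun i => ⟨le_max_left _ _, max_le zero_le_one (min_le_left _ _)⟩,
    fun i => ⟨fun h => ?_, fun h => ?_⟩⟩
  · have := (hx i).1 h
    refine max_eq_left ((min_le_right _ _).trans (by linarith))
  · have := (hx i).2 h
    rw [clamp, min_eq_left (by linarith)]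
    simp

theorem clamp_real {K : Set (CubeFace n)} {x : Fin n → ℝ} (hx : x ∈ NK K) : clamp x ∈ real K := by
  obtain ⟨_, ⟨F, hF, rfl⟩, hx⟩ := hx
  exact mem_real.2 ⟨F, hF, clamp_mem hx⟩

theorem real_NK {K : Set (CubeFace n)} {x : Fin n → ℝ} (hx : x ∈ real K) : x ∈ NK K := by
  obtain ⟨F, hF, h⟩ := mem_real.1 hx
  exact ⟨_, ⟨F, hF, rfl⟩, CF_sub_NF F h⟩

theorem conv_pair {U : Set (Fin n → ℝ)} (hU : Convex ℝ U) {x y : Fin n → ℝ} (hx : x ∈ U)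
    (hy : y ∈ U) {t : ℝ} (h0 : 0 ≤ t) (h1 : t ≤ 1) : (1 - t) • x + t • y ∈ U :=
  hU hx hy (by linarith) h0 (by ring)

theorem real_NK_iso (K : Set (CubeFace n)) : ∃ f : C(↥(real K), ↥(NK K)), IsoH f := by
  let f : C(↥(real K), ↥(NK K)) := ⟨fun x => ⟨x.1, real_NK x.2⟩, by fun_prop⟩
  let g : C(↥(NK K), ↥(real K)) := ⟨fun x => ⟨clamp x.1, clamp_real x.2⟩,
    Continuous.subtype_mk (clamp_cont.comp continuous_subtype_val) _⟩
  refine ⟨f, IsoH_of_inv (g := g) ?_ ?_⟩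
  · refine line_homotopic _ _ ?_
    rintro ⟨x, hx⟩ t h0 h1
    obtain ⟨F, hF, h⟩ := mem_real.1 hx
    exact mem_real.2 ⟨F, hF, conv_pair (CF_convex F) (clamp_mem (CF_sub_NF F h)) h h0 h1⟩
  · refine line_homotopic _ _ ?_
    rintro ⟨x, hx⟩ t h0 h1
    obtain ⟨_, ⟨F, hF, rfl⟩, h⟩ := hx
    exact ⟨_, ⟨F, hF, rfl⟩, conv_pair (NF_convex F) (CF_sub_NF F (clamp_mem h)) h h0 h1⟩

/-- singular homology of the realization is cellular homology -/
theorem sHom_cell {K : Set (CubeFace n)} (hK : Down K) (j : ℕ) :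
    Nonempty (sHomology (ZMod 2) ↥(real K) j ≃ₗ[ZMod 2] Hq bd (CC K j) (CC K (j + 1))) := by
  obtain ⟨f, hf⟩ := real_NK_iso K
  obtain ⟨e1⟩ := hf.equiv j
  obtain ⟨e2⟩ := sHom_Hq (NK K) j
  obtain ⟨e3⟩ := cell_sing hK j
  exact ⟨e1.trans (e2.trans e3.symm)⟩
end clamp
end
end BF


namespace BF
open CubeFace
noncomputable section

theorem line_homotopic' {X : Type} [TopologicalSpace X] {E : Type} [AddCommGroup E] [Module ℝ E]
    [TopologicalSpace E] [ContinuousAdd E] [ContinuousSMul ℝ E] {U : Set E}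
    (f g : C(X, ↥U))
    (h : ∀ x, ∀ t : ℝ, 0 ≤ t → t ≤ 1 → (1 - t) • (f x).1 + t • (g x).1 ∈ U) :
    f.Homotopic g := by
  refine ⟨⟨⟨fun p => ⟨(1 - (p.1 : ℝ)) • (f p.2).1 + (p.1 : ℝ) • (g p.2).1,
    h p.2 p.1 p.1.2.1 p.1.2.2⟩, ?_⟩, ?_, ?_⟩⟩
  · fun_prop
  · intro x; apply Subtype.ext; simp
  · intro x; apply Subtype.ext; simp

section conefam
variable {E E' : Type} [NormedAddCommGroup E']
  [NormedSpace ℝ E'] [NormedAddCommGroup E] [NormedSpace ℝ E]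

/-- a nested family of sets, conical with respect to `x` -/
structure ConeFam (T : ℝ → Set E) (x : E) : Prop where
  mono : ∀ s t, 0 < s → s ≤ t → t ≤ 1 → T s ⊆ T t
  scale : ∀ s l, 0 < s → s ≤ 1 → 0 < l → l ≤ 1 → ∀ y ∈ T s, x + l • (y - x) ∈ T (l * s)

theorem ConeFam.scale_mem {T : ℝ → Set E} {x : E} (h : ConeFam T x) {s l : ℝ} (hs : 0 < s)
    (hs1 : s ≤ 1) (hl : 0 < l) (hl1 : l ≤ 1) {y : E} (hy : y ∈ T s) : x + l • (y - x) ∈ T s :=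
  h.mono _ _ (by positivity) (by nlinarith) hs1 (h.scale s l hs hs1 hl hl1 y hy)

theorem ConeFam.incl {T : ℝ → Set E} {x : E} (h : ConeFam T x) {s t : ℝ} (hs : 0 < s)
    (hst : s ≤ t) (ht : t ≤ 1) (f : C(↥(T s), ↥(T t))) (hf : ∀ y, (f y).1 = y.1) : IsoH f := by
  have ht0 : 0 < t := by linarith
  have hl : 0 < s / t := by positivity
  have hl1 : s / t ≤ 1 := (div_le_one ht0).2 hst
  have hst' : s / t * t = s := by field_simp
  let g : C(↥(T t), ↥(T s)) := ⟨fun y => ⟨x + (s / t) • (y.1 - x),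
    by have := h.scale t (s / t) ht0 ht hl hl1 y.1 y.2; rwa [hst'] at this⟩, by fun_prop⟩
  have key : ∀ (y : E) (r : ℝ), (1 - r) • (x + (s / t) • (y - x)) + r • y =
      x + ((1 - r) * (s / t) + r) • (y - x) := by
    intro y r; module
  have pos : ∀ r : ℝ, 0 ≤ r → r ≤ 1 → 0 < (1 - r) * (s / t) + r ∧ (1 - r) * (s / t) + r ≤ 1 := by
    intro r h0 h1
    rcases eq_or_lt_of_le h0 with rfl | h0
    · simp [hl, hl1]
    · constructor
      · have := mul_nonneg (sub_nonneg.2 h1) hl.le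
        linarith
      · nlinarith
  refine IsoH_of_inv (g := g) ?_ ?_
  · refine line_homotopic' _ _ ?_
    intro y r h0 h1
    change (1 - r) • (x + (s / t) • ((f y).1 - x)) + r • y.1 ∈ T s
    rw [hf, key]
    exact h.scale_mem hs (hst.trans ht) (pos r h0 h1).1 (pos r h0 h1).2 y.2
  · refine line_homotopic' _ _ ?_
    intro y r h0 h1
    change (1 - r) • (f (g y)).1 + r • y.1 ∈ T t
    rw [hf]
    change (1 - r) • (x + (s / t) • (y.1 - x)) + r • y.1 ∈ T t
    rw [key]
    exact h.scale_mem ht0 ht (pos r h0 h1).1 (pos r h0 h1).2 y.2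

theorem sandwich {T : ℝ → Set E} {x : E} (h : ConeFam T x) {T' : ℝ → Set E'} {x' : E'}
    (h' : ConeFam T' x') {s r1 r2 : ℝ} (hs : 0 < s) (hs1 : s ≤ 1) (hr2 : 0 < r2) (hr : r2 ≤ r1)
    (hr1 : r1 ≤ 1)
    (a : C(↥(T' r2), ↥(T s))) (b : C(↥(T s), ↥(T' r1))) (c : C(↥(T' r1), ↥(T 1)))
    (hba : ∀ v, (b (a v)).1 = v.1) (hcb : ∀ v, (c (b v)).1 = v.1) : IsoH a :=
  (two_of_six (g := b) (h := c) (h'.incl hr2 hr hr1 _ hba) (h.incl hs hs1 le_rfl _ hcb)).1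

/-- punctured balls -/
def pball (p : E) (r0 : ℝ) (r : ℝ) : Set E := {y | 0 < ‖y - p‖ ∧ ‖y - p‖ < r * r0}

theorem pball_cone (p : E) {r0 : ℝ} (h0 : 0 < r0) : ConeFam (pball p r0) p := by
  refine ⟨fun s t _ hst _ y hy => ⟨hy.1, hy.2.trans_le (by gcongr)⟩, fun s l _ _ hl _ y hy => ?_⟩
  have : ‖p + l • (y - p) - p‖ = l * ‖y - p‖ := by
    rw [add_sub_cancel_left, norm_smul, Real.norm_of_nonneg hl.le]
  refine ⟨?_, ?_⟩
  · rw [this]; exact mul_pos hl hy.1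
  · rw [this, mul_assoc]; exact mul_lt_mul_of_pos_left hy.2 hl

end conefam

section gauge
variable {n : ℕ}

/-- barycenter -/
def bary0 (A : CubeFace n) : Fin n → ℝ := fun i =>
  match A i with
  | none => 1 / 2
  | some false => 0
  | some true => 1

/-- weights -/
def wt (A : CubeFace n) (i : Fin n) : ℝ := 
  match A i with
  | none => 2
  | some _ => 1

/-- gauge -/
def gau (A : CubeFace n) (y : Fin n → ℝ) : ℝ := ‖fun i => wt A i * (y i - bary0 A i)‖

theorem wt_pos (A : CubeFace n) (i : Fin n) : 0 < wt A i := by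
  unfold wt; split <;> norm_num

theorem gau_nonneg (A : CubeFace n) (y : Fin n → ℝ) : 0 ≤ gau A y := norm_nonneg _

theorem gau_cont (A : CubeFace n) : Continuous (gau A) := by
  unfold gau; fun_prop

theorem gau_eq_zero {A : CubeFace n} {y : Fin n → ℝ} : gau A y = 0 ↔ y = bary0 A := by
  rw [gau, norm_eq_zero]
  constructor
  · intro h
    funext i
    have := congrFun h i
    simp only [Pi.zero_apply, mul_eq_zero, (wt_pos A i).ne', false_or] at this
    linarith
  · rintro rfl
    funext i; simp

theorem gau_scale (A : CubeFace n) (y : Fin n → ℝ) {l : ℝ} (hl : 0 ≤ l) :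
    gau A (bary0 A + l • (y - bary0 A)) = l * gau A y := by
  rw [gau, gau]
  have : (fun i => wt A i * ((bary0 A + l • (y - bary0 A)) i - bary0 A i)) =
      l • fun i => wt A i * (y i - bary0 A i) := by
    funext i
    simp only [Pi.add_apply, Pi.smul_apply, Pi.sub_apply, smul_eq_mul]
    ring
  rw [this, norm_smul, Real.norm_of_nonneg hl]

theorem dist_le_gau (A : CubeFace n) (y : Fin n → ℝ) : dist y (bary0 A) ≤ gau A y := by
  rw [dist_eq_norm, pi_norm_le_iff_of_nonneg (gau_nonneg A y)]
  intro i
  refine le_trans ?_ (norm_le_pi_norm (fun i => wt A i * (y i - bary0 A i)) i)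
  rw [norm_mul]
  have : 1 ≤ ‖wt A i‖ := by
    unfold wt; split <;> simp
  exact le_mul_of_one_le_left (norm_nonneg _) this

/-- carrier face -/
def car (y : Fin n → ℝ) : CubeFace n := fun i =>
  if y i = 0 then some false else if y i = 1 then some true else none

theorem car_le {y : Fin n → ℝ} {G : CubeFace n} (h : y ∈ CF G) : car y ≤ G := by
  intro i
  rcases hG : G i with _ | _ | _
  · exact Or.inl rfl
  · right; simp [car, (h.2 i).1 hG]
  · right; simp [car, (h.2 i).2 hG]

theorem mem_car {y : Fin n → ℝ} (h : ∀ i, 0 ≤ y i ∧ y i ≤ 1) : y ∈ CF (car y) := by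
  refine ⟨h, fun i => ⟨fun hi => ?_, fun hi => ?_⟩⟩
  · unfold car at hi
    by_contra h1
    rw [if_neg h1] at hi
    split at hi <;> simp at hi
  · unfold car at hi
    by_contra h1
    rw [if_neg h1] at hi
    split at hi <;> simp at hi

theorem mem_real_car {K : Set (CubeFace n)} (hK : Down K) {y : Fin n → ℝ} (hy : y ∈ real K) :
    car y ∈ K ∧ y ∈ CF (car y) := by
  obtain ⟨G, hG, h⟩ := mem_real.1 hy
  exact ⟨hK G hG _ (car_le h), mem_car h.1⟩

theorem gau_lt_iff {A : CubeFace n} {y : Fin n → ℝ} (h : ∀ i, 0 ≤ y i ∧ y i ≤ 1) :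
    gau A y < 1 ↔ A ≤ car y := by
  rw [gau, pi_norm_lt_iff zero_lt_one]
  refine forall_congr' fun i => ?_
  have h1 := (h i).1
  have h2 := (h i).2
  rw [Real.norm_eq_abs, abs_lt]
  rcases hA : A i with _ | _ | _
  · simp only [wt, bary0, hA, car]
    by_cases h3 : y i = 0
    · simp [h3]
    by_cases h4 : y i = 1
    · norm_num [h4];  exact ⟨nofun, nofun⟩
    · simp only [h3, h4, if_false, true_or, iff_true]
      have := lt_of_le_of_ne h1 (Ne.symm h3)
      have := lt_of_le_of_ne h2 h4
      constructor <;> linarith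
  · simp only [wt, bary0, hA, car]
    by_cases h3 : y i = 0
    · simp [h3]
    by_cases h4 : y i = 1
    · norm_num [h4]; exact nofun
    · simp only [h3, h4, if_false, true_or, iff_true]
      have := lt_of_le_of_ne h1 (Ne.symm h3)
      have := lt_of_le_of_ne h2 h4
      constructor <;> linarith
  · simp only [wt, bary0, hA, car]
    by_cases h3 : y i = 0
    · norm_num [h3];  exact nofun
    by_cases h4 : y i = 1
    · norm_num [h4]
    · simp only [h3, h4, if_false, true_or, iff_true]
      have := lt_of_le_of_ne h1 (Ne.symm h3)
      have := lt_of_le_of_ne h2 h4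
      constructor <;> linarith

theorem gau_le_one {A : CubeFace n} {y : Fin n → ℝ} (h : ∀ i, 0 ≤ y i ∧ y i ≤ 1) :
    gau A y ≤ 1 := by
  rw [gau, pi_norm_le_iff_of_nonneg zero_le_one]
  intro i
  have h1 := (h i).1
  have h2 := (h i).2
  rw [Real.norm_eq_abs, abs_le]
  unfold wt bary0
  rcases hA : A i with _ | _ | _ <;> constructor <;> simp only <;> linarith

/-- radial scaling stays in a face above `A` -/
theorem scale_CF {A H : CubeFace n} (hA : A ≤ H) {y : Fin n → ℝ} (hy : y ∈ CF H) {l : ℝ}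
    (hl : 0 ≤ l) (hg : l * gau A y ≤ 1) : bary0 A + l • (y - bary0 A) ∈ CF H := by
  rw [← gau_scale A y hl, gau, pi_norm_le_iff_of_nonneg zero_le_one] at hg
  have key : ∀ i, (bary0 A + l • (y - bary0 A)) i = bary0 A i + l * (y i - bary0 A i) :=
    fun i => rfl
  refine ⟨fun i => ?_, fun i => ⟨fun hi => ?_, fun hi => ?_⟩⟩
  · have := hg i
    rw [Real.norm_eq_abs, abs_le, key] at this
    rw [key]
    have h1 := hy.1 i
    revert this
    unfold wt bary0
    rcases A i with _ | _ | _ <;> simp only <;> intro this <;> constructor <;>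
      nlinarith [mul_nonneg hl h1.1, mul_nonneg hl (sub_nonneg.2 h1.2)]
  · rw [key, (hy.2 i).1 hi]
    have : A i = some false := by
      rcases hA i with h | h
      · rw [h] at hi; cases hi
      · rw [h, hi]
    simp [bary0, this]
  · rw [key, (hy.2 i).2 hi]
    have : A i = some true := by
      rcases hA i with h | h
      · rw [h] at hi; cases hi
      · rw [h, hi]
    simp [bary0, this]

theorem bary0_mem {A H : CubeFace n} (hA : A ≤ H) : bary0 A ∈ CF H := by
  refine ⟨fun i => ?_, fun i => ⟨fun hi => ?_, fun hi => ?_⟩⟩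
  · unfold bary0
    rcases A i with _ | _ | _ <;> norm_num
  · have : A i = some false := by
      rcases hA i with h | h
      · rw [h] at hi; cases hi
      · rw [h, hi]
    simp [bary0, this]
  · have : A i = some true := by
      rcases hA i with h | h
      · rw [h] at hi; cases hi
      · rw [h, hi]
    simp [bary0, this]

/-- closed star -/
def Bst (M : Set (CubeFace n)) (A : CubeFace n) : Set (CubeFace n) :=
  {G | ∃ H ∈ M, A ≤ H ∧ G ≤ H}

/-- link -/
def Lst (M : Set (CubeFace n)) (A : CubeFace n) : Set (CubeFace n) :=
  {G | G ∈ Bst M A ∧ ¬ A ≤ G}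

theorem Bst_down (M : Set (CubeFace n)) (A : CubeFace n) : Down (Bst M A) := by
  rintro F ⟨H, hH, h1, h2⟩ G hG
  exact ⟨H, hH, h1, hG.trans h2⟩

theorem Lst_down (M : Set (CubeFace n)) (A : CubeFace n) : Down (Lst M A) := by
  rintro F ⟨h1, h2⟩ G hG
  exact ⟨Bst_down M A F h1 G hG, fun h => h2 (h.trans hG)⟩

/-- punctured neighbourhoods of the barycenter in `real M` -/
def Wn (M : Set (CubeFace n)) (A : CubeFace n) (s : ℝ) : Set (Fin n → ℝ) :=
  {y | y ∈ real M ∧ 0 < gau A y ∧ gau A y < s}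

theorem Wn_face {M : Set (CubeFace n)} (hM : Down M) {A : CubeFace n} {s : ℝ} (hs : s ≤ 1)
    {y : Fin n → ℝ} (hy : y ∈ Wn M A s) : A ≤ car y ∧ car y ∈ M ∧ y ∈ CF (car y) := by
  obtain ⟨h1, h2⟩ := mem_real_car hM hy.1
  exact ⟨(gau_lt_iff h2.1).1 (hy.2.2.trans_le hs), h1, h2⟩

theorem Wn_cone {M : Set (CubeFace n)} (hM : Down M) (A : CubeFace n) :
    ConeFam (Wn M A) (bary0 A) := by
  refine ⟨fun s t _ hst _ y hy => ⟨hy.1, hy.2.1, hy.2.2.trans_le hst⟩,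
    fun s l _ hs hl hl1 y hy => ?_⟩
  obtain ⟨h1, h2, h3⟩ := Wn_face hM hs hy
  refine ⟨mem_real.2 ⟨_, h2, scale_CF h1 h3 hl.le ?_⟩, ?_, ?_⟩
  · nlinarith [hy.2.1, hy.2.2]
  · rw [gau_scale A y hl.le]; exact mul_pos hl hy.2.1
  · rw [gau_scale A y hl.le]; exact mul_lt_mul_of_pos_left hy.2.2 hl

theorem real_Lst {M : Set (CubeFace n)} {A : CubeFace n} {y : Fin n → ℝ}
    (hy : y ∈ real (Lst M A)) : gau A y = 1 ∧ ∃ H ∈ M, A ≤ H ∧ y ∈ CF H := by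
  obtain ⟨h1, h2⟩ := mem_real_car (Lst_down M A) hy
  obtain ⟨⟨H, hH, h3, h4⟩, h5⟩ := h1
  refine ⟨?_, H, hH, h3, ?_⟩
  · rcases (gau_le_one (A := A) h2.1).lt_or_eq with h | h
    · exact absurd ((gau_lt_iff h2.1).1 h) h5
    · exact h
  · obtain ⟨G, hG, hyG⟩ := mem_real.1 hy
    refine ⟨h2.1, fun i => ⟨fun hi => ?_, fun hi => ?_⟩⟩
    · refine (h2.2 i).1 ?_
      rcases h4 i with h | h
      · rw [h] at hi; cases hi
      · rw [h, hi]
    · refine (h2.2 i).2 ?_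
      rcases h4 i with h | h
      · rw [h] at hi; cases hi
      · rw [h, hi]

theorem real_Lst' {M : Set (CubeFace n)} {A H : CubeFace n} (hH : H ∈ M) (hA : A ≤ H)
    {y : Fin n → ℝ} (hy : y ∈ CF H) (hg : gau A y = 1) : y ∈ real (Lst M A) := by
  refine mem_real.2 ⟨car y, ⟨⟨H, hH, hA, car_le hy⟩, fun h => ?_⟩, mem_car hy.1⟩
  have := (gau_lt_iff hy.1).2 h
  linarith

theorem Wn_link {M : Set (CubeFace n)} (hM : Down M) (A : CubeFace n) {s : ℝ} (hs : 0 < s)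
    (hs1 : s ≤ 1) : ∃ f : C(↥(Wn M A s), ↥(real (Lst M A))), IsoH f := by
  have cg := gau_cont A
  let f : C(↥(Wn M A s), ↥(real (Lst M A))) := ⟨fun y =>
    ⟨bary0 A + (gau A y.1)⁻¹ • (y.1 - bary0 A), by
      obtain ⟨h1, h2, h3⟩ := Wn_face hM hs1 y.2
      have hg : (gau A y.1)⁻¹ * gau A y.1 = 1 := inv_mul_cancel₀ y.2.2.1.ne'
      refine real_Lst' h2 h1 (scale_CF h1 h3 (inv_nonneg.2 (gau_nonneg _ _)) hg.le) ?_
      rw [gau_scale _ _ (inv_nonneg.2 (gau_nonneg _ _)), hg]⟩, by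
      refine Continuous.subtype_mk ?_ _
      have hc : Continuous fun y : ↥(Wn M A s) => (gau A y.1)⁻¹ :=
        (cg.comp continuous_subtype_val).inv₀ fun y => y.2.2.1.ne'
      fun_prop⟩
  have hs2 : 0 < s / 2 := by positivity
  let g : C(↥(real (Lst M A)), ↥(Wn M A s)) := ⟨fun y =>
    ⟨bary0 A + (s / 2) • (y.1 - bary0 A), by
      obtain ⟨h1, H, hH, hA, hy⟩ := real_Lst y.2
      refine ⟨mem_real.2 ⟨H, hH, scale_CF hA hy hs2.le (by rw [h1]; linarith)⟩, ?_, ?_⟩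
      · rw [gau_scale _ _ hs2.le, h1]; linarith
      · rw [gau_scale _ _ hs2.le, h1]; linarith⟩, by fun_prop⟩
  have hfg : ∀ y, f (g y) = y := by
    intro y
    obtain ⟨h1, -⟩ := real_Lst y.2
    apply Subtype.ext
    change bary0 A + (gau A (bary0 A + (s / 2) • (y.1 - bary0 A)))⁻¹ •
      (bary0 A + (s / 2) • (y.1 - bary0 A) - bary0 A) = y.1
    rw [gau_scale _ _ hs2.le, h1, add_sub_cancel_left, smul_smul, mul_one,
      inv_mul_cancel₀ hs2.ne', one_smul, add_sub_cancel]
  refine ⟨f, IsoH_of_inv (g := g) ?_ ?_⟩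
  · refine line_homotopic' _ _ ?_
    intro y t h0 h1
    change (1 - t) • (bary0 A + (s / 2) • ((bary0 A + (gau A y.1)⁻¹ • (y.1 - bary0 A)) - bary0 A))
      + t • y.1 ∈ Wn M A s
    have hgp := y.2.2.1
    have hgs := y.2.2.2
    obtain ⟨k1, k2, k3⟩ := Wn_face hM hs1 y.2
    have key : (1 - t) • (bary0 A + (s / 2) • ((bary0 A + (gau A y.1)⁻¹ • (y.1 - bary0 A)) - bary0 A))
      + t • y.1 = bary0 A + ((1 - t) * ((s / 2) * (gau A y.1)⁻¹) + t) • (y.1 - bary0 A) := by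
      module
    have hpos : 0 ≤ (1 - t) * ((s / 2) * (gau A y.1)⁻¹) + t := by
      have : 0 ≤ 1 - t := by linarith
      positivity
    have hval : ((1 - t) * ((s / 2) * (gau A y.1)⁻¹) + t) * gau A y.1 =
        (1 - t) * (s / 2) + t * gau A y.1 := by
      field_simp
    have hlt : (1 - t) * (s / 2) + t * gau A y.1 < s := by
      rcases eq_or_lt_of_le h1 with rfl | h1
      · linarith
      · nlinarith [mul_nonneg h0 (sub_nonneg.2 hgs.le), mul_pos (sub_pos.2 h1) hs2]
    rw [key]
    refine ⟨mem_real.2 ⟨_, k2, scale_CF k1 k3 hpos (by rw [hval]; linarith)⟩, ?_, ?_⟩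
    · rw [gau_scale _ _ hpos, hval]
      rcases eq_or_lt_of_le h1 with rfl | h1
      · linarith
      · nlinarith [mul_nonneg h0 hgp.le, mul_pos (sub_pos.2 h1) hs2]
    · rw [gau_scale _ _ hpos, hval]; exact hlt
  · have : f.comp g = ContinuousMap.id _ := by
      ext1 y; exact hfg y
    rw [this]

end gauge
end
end BF


namespace BF
open CubeFace
noncomputable section

theorem symm_small {X : Type} [TopologicalSpace X] {E' : Type} [NormedAddCommGroup E']
    (φ : OpenPartialHomeomorph X E') (x0 : X) (hx0 : x0 ∈ φ.source) (g : X → ℝ) (hg : Continuous g)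
    (h0 : g x0 = 0) {s : ℝ} (hs : 0 < s) :
    ∃ r > 0, ∀ v : E', ‖v - φ x0‖ < r → v ∈ φ.target ∧ g (φ.symm v) < s := by
  have hp : φ x0 ∈ φ.target := φ.map_source hx0
  have h1 : ∀ᶠ v in nhds (φ x0), v ∈ φ.target := φ.open_target.mem_nhds hp
  have h2 : ∀ᶠ v in nhds (φ x0), g (φ.symm v) < s := by
    have hc : ContinuousAt (fun v => g (φ.symm v)) (φ x0) :=
      hg.continuousAt.comp (φ.continuousAt_symm hp)
    refine hc.eventually_lt_const ?_
    beta_reduce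
    rw [φ.left_inv hx0, h0]; exact hs
  obtain ⟨r, hr, h⟩ := Metric.eventually_nhds_iff.1 (h1.and h2)
  exact ⟨r, hr, fun v hv => h (by rwa [dist_eq_norm])⟩

theorem chart_sandwich {n : ℕ} {M : Set (CubeFace n)} (hM : Down M) {A : CubeFace n} 
    {E' : Type} [NormedAddCommGroup E'] [NormedSpace ℝ E']
    (φ : OpenPartialHomeomorph ↥(real M) E') (x0 : ↥(real M)) (hx : x0.1 = bary0 A)
    (hx0 : x0 ∈ φ.source) :
    ∃ r0 > 0, ∃ r > 0, r ≤ 1 ∧ ∃ s > 0, s ≤ 1 ∧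
      ∃ a : C(↥(pball (φ x0) r0 r), ↥(Wn M A s)), IsoH a := by
  have hg : Continuous fun y : ↥(real M) => gau A y.1 := (gau_cont A).comp continuous_subtype_val
  have hg0 : gau A x0.1 = 0 := gau_eq_zero.2 hx
  have hgp : ∀ y : ↥(real M), y ≠ x0 → 0 < gau A y.1 := by
    intro y hy
    refine lt_of_le_of_ne (gau_nonneg _ _) fun h => hy ?_
    apply Subtype.ext
    rw [hx]; exact gau_eq_zero.1 h.symm
  obtain ⟨r0, hr0, H1⟩ := symm_small φ x0 hx0 _ hg hg0 zero_lt_one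
  obtain ⟨s, hs, hs1, H2⟩ : ∃ s > 0, s ≤ 1 ∧ ∀ y : ↥(real M), gau A y.1 < s →
      y ∈ φ.source ∧ ‖φ y - φ x0‖ < r0 := by
    have h1 : ∀ᶠ y in nhds x0, y ∈ φ.source := φ.open_source.mem_nhds hx0
    have h2 : ∀ᶠ y in nhds x0, φ y ∈ Metric.ball (φ x0) r0 :=
      (φ.continuousAt hx0).eventually_mem (Metric.ball_mem_nhds _ hr0)
    obtain ⟨e, he, h⟩ := Metric.eventually_nhds_iff.1 (h1.and h2)
    refine ⟨min e 1, lt_min he zero_lt_one, min_le_right _ _, fun y hy => ?_⟩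
    have h3 : dist y x0 < e := by
      refine lt_of_le_of_lt ?_ (hy.trans_le (min_le_left _ _))
      have := dist_le_gau A y.1
      rw [← hx] at this
      exact this
    have := h h3
    rwa [mem_ball_iff_norm] at this
  obtain ⟨r', hr', H3⟩ := symm_small φ x0 hx0 _ hg hg0 hs
  refine ⟨r0, hr0, min 1 (r' / r0), lt_min zero_lt_one (by positivity), min_le_left _ _,
    s, hs, hs1, ?_⟩
  have hle : min 1 (r' / r0) * r0 ≤ r' := by
    calc _ ≤ r' / r0 * r0 := by gcongr; exact min_le_right _ _
      _ = r' := by field_simp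
  have hne : ∀ v : E', v ∈ φ.target → 0 < ‖v - φ x0‖ → φ.symm v ≠ x0 := by
    intro v hv h h'
    rw [← h', φ.right_inv hv] at h
    simp at h
  have csymm : ∀ (U : Set E'), U ⊆ φ.target → Continuous fun v : ↥U => φ.symm v.1 := by
    intro U hU
    exact φ.continuousOn_symm.comp_continuous continuous_subtype_val fun v => hU v.2
  have ha : ∀ v ∈ pball (φ x0) r0 (min 1 (r' / r0)), v ∈ φ.target ∧ (φ.symm v).1 ∈ Wn M A s := by
    intro v hv
    obtain ⟨k1, k2⟩ := H3 v (hv.2.trans_le hle)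
    exact ⟨k1, (φ.symm v).2, hgp _ (hne v k1 hv.1), k2⟩
  have hc : ∀ v ∈ pball (φ x0) r0 1, v ∈ φ.target ∧ (φ.symm v).1 ∈ Wn M A 1 := by
    intro v hv
    obtain ⟨k1, k2⟩ := H1 v (by simpa using hv.2)
    exact ⟨k1, (φ.symm v).2, hgp _ (hne v k1 hv.1), k2⟩
  have hb : ∀ y : ↥(Wn M A s), (⟨y.1, y.2.1⟩ : ↥(real M)) ∈ φ.source ∧
      φ ⟨y.1, y.2.1⟩ ∈ pball (φ x0) r0 1 := by
    intro y
    obtain ⟨k1, k2⟩ := H2 ⟨y.1, y.2.1⟩ y.2.2.2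
    refine ⟨k1, ?_, by simpa using k2⟩
    rw [norm_pos_iff, sub_ne_zero]
    intro h
    have := φ.injOn k1 hx0 h
    have h2 : y.1 = x0.1 := congrArg Subtype.val this
    have h3 := y.2.2.1
    rw [h2, hg0] at h3
    exact lt_irrefl _ h3
  let a : C(↥(pball (φ x0) r0 (min 1 (r' / r0))), ↥(Wn M A s)) :=
    ⟨fun v => ⟨(φ.symm v.1).1, (ha v.1 v.2).2⟩, Continuous.subtype_mk
      (continuous_subtype_val.comp (csymm _ fun v hv => (ha v hv).1)) _⟩
  let c : C(↥(pball (φ x0) r0 1), ↥(Wn M A 1)) :=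
    ⟨fun v => ⟨(φ.symm v.1).1, (hc v.1 v.2).2⟩, Continuous.subtype_mk
      (continuous_subtype_val.comp (csymm _ fun v hv => (hc v hv).1)) _⟩
  let b : C(↥(Wn M A s), ↥(pball (φ x0) r0 1)) :=
    ⟨fun y => ⟨φ ⟨y.1, y.2.1⟩, (hb y).2⟩, Continuous.subtype_mk
      (φ.continuousOn.comp_continuous (Continuous.subtype_mk continuous_subtype_val _)
        fun y => (hb y).1) _⟩
  refine ⟨a, sandwich (Wn_cone hM A) (pball_cone _ hr0) hs hs1 (lt_min zero_lt_one (by positivity))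
    (min_le_left _ _) le_rfl a b c ?_ ?_⟩
  · intro v
    exact φ.right_inv (ha v.1 v.2).1
  · intro y
    change (φ.symm (φ ⟨y.1, y.2.1⟩)).1 = y.1
    rw [φ.left_inv (hb y).1]

/-- any two punctured balls have the same homology -/
theorem pball_equiv {E' : Type} [NormedAddCommGroup E'] [NormedSpace ℝ E'] (p q : E')
    {r0 q0 r s : ℝ} (hr0 : 0 < r0) (hq0 : 0 < q0) (hr : 0 < r) (hs : 0 < s) (j : ℕ) :
    Nonempty (sHomology (ZMod 2) ↥(pball p r0 r) j ≃ₗ[ZMod 2]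
      sHomology (ZMod 2) ↥(pball q q0 s) j) := by
  have key : ∀ (p q : E') (r0 q0 r s : ℝ), 0 < r0 → 0 < q0 → 0 < r → 0 < s → ∀ y ∈ pball p r0 r,
      q + ((s * q0) / (r * r0)) • (y - p) ∈ pball q q0 s := by
    intro p q r0 q0 r s hr0 hq0 hr hs y hy
    have h1 := hy.1
    have h2 := hy.2
    have : 0 < (s * q0) / (r * r0) := by positivity
    rw [pball, Set.mem_ofPred_eq, add_sub_cancel_left, norm_smul, Real.norm_of_nonneg this.le]
    refine ⟨by positivity, ?_⟩
    calc _ < (s * q0) / (r * r0) * (r * r0) := by gcongr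
      _ = _ := by field_simp
  let f : C(↥(pball p r0 r), ↥(pball q q0 s)) := ⟨fun y => ⟨_, key p q r0 q0 r s hr0 hq0 hr hs y.1 y.2⟩,
    by fun_prop⟩
  let g : C(↥(pball q q0 s), ↥(pball p r0 r)) := ⟨fun y => ⟨_, key q p q0 r0 s r hq0 hr0 hs hr y.1 y.2⟩,
    by fun_prop⟩
  have h1 : g.comp f = ContinuousMap.id _ := by
    ext1 y; apply Subtype.ext
    change p + ((r * r0) / (s * q0)) • (q + ((s * q0) / (r * r0)) • (y.1 - p) - q) = y.1
    rw [add_sub_cancel_left, smul_smul, show (r * r0) / (s * q0) * ((s * q0) / (r * r0)) = 1 by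
      field_simp, one_smul, add_sub_cancel]
  have h2 : f.comp g = ContinuousMap.id _ := by
    ext1 y; apply Subtype.ext
    change q + ((s * q0) / (r * r0)) • (p + ((r * r0) / (s * q0)) • (y.1 - q) - p) = y.1
    rw [add_sub_cancel_left, smul_smul, show (s * q0) / (r * r0) * ((r * r0) / (s * q0)) = 1 by
      field_simp, one_smul, add_sub_cancel]
  have hf : IsoH f := IsoH_of_inv (g := g) (by rw [h1]) (by rw [h2])
  exact hf.equiv j

/-- top face -/
def topF (d : ℕ) : CubeFace d := fun _ => none

theorem mem_real_univ {d : ℕ} {y : Fin d → ℝ} :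
    y ∈ real (Set.univ : Set (CubeFace d)) ↔ ∀ i, 0 ≤ y i ∧ y i ≤ 1 := by
  rw [mem_real]
  constructor
  · rintro ⟨F, -, h⟩; exact h.1
  · intro h; exact ⟨car y, trivial, mem_car h⟩

/-- clamping to the unit interval -/
def clamp01 {d : ℕ} (v : EuclideanSpace ℝ (Fin d)) : ↥(real (Set.univ : Set (CubeFace d))) :=
  ⟨fun i => max 0 (min 1 (v i)), mem_real_univ.2 fun _ =>
    ⟨le_max_left _ _, max_le zero_le_one (min_le_left _ _)⟩⟩

theorem clamp01_eq {d : ℕ} {v : EuclideanSpace ℝ (Fin d)} (h : ∀ i, 0 < v i ∧ v i < 1) (i : Fin d) :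
    (clamp01 v).1 i = v i := by
  change max 0 (min 1 (v i)) = v i
  rw [min_eq_right (h i).2.le, max_eq_right (h i).1.le]

/-- chart of the cube -/
def cubeChart (d : ℕ) : OpenPartialHomeomorph ↥(real (Set.univ : Set (CubeFace d)))
    (EuclideanSpace ℝ (Fin d)) where
  toFun y := WithLp.toLp 2 y.1
  invFun := clamp01
  source := {y | ∀ i, 0 < y.1 i ∧ y.1 i < 1}
  target := {v | ∀ i, 0 < v i ∧ v i < 1}
  map_source' := fun y hy => hy
  map_target' := fun v hv i => by rw [clamp01_eq hv]; exact hv i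
  left_inv' := fun y hy => by
    apply Subtype.ext; funext i
    exact clamp01_eq (v := WithLp.toLp 2 y.1) hy i
  right_inv' := fun v hv => by
    ext i; exact clamp01_eq hv i
  open_source := by
    simp only [Set.ofPred_forall]
    refine isOpen_iInter_of_finite fun i => ?_
    have hc : Continuous fun y : ↥(real (Set.univ : Set (CubeFace d))) => y.1 i :=
      (continuous_apply i).comp continuous_subtype_val
    exact (isOpen_lt continuous_const hc).inter (isOpen_lt hc continuous_const)
  open_target := by
    simp only [Set.ofPred_forall]
    refine isOpen_iInter_of_finite fun i => ?_
    have hc : Continuous fun v : EuclideanSpace ℝ (Fin d) => v i := by fun_prop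
    exact (isOpen_lt continuous_const hc).inter (isOpen_lt hc continuous_const)
  continuousOn_toFun := by
    refine Continuous.continuousOn ?_
    fun_prop
  continuousOn_invFun := by
    refine Continuous.continuousOn ?_
    refine Continuous.subtype_mk ?_ _
    fun_prop

theorem Lst_univ (d : ℕ) : Lst Set.univ (topF d) = boundaryCube d := by
  ext G
  constructor
  · rintro ⟨-, h⟩ h'
    apply h
    rw [h']
    exact le_refl _
  · intro h
    refine ⟨⟨topF d, trivial, le_refl _, fun i => Or.inl rfl⟩, fun h' => h ?_⟩
    exact le_antisymm (fun i => Or.inl rfl) h'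

theorem link_sHom {n d : ℕ} {M : Set (CubeFace n)} (hM : Down M) {A : CubeFace n} (hA : A ∈ M)
    (φ : OpenPartialHomeomorph ↥(real M) (EuclideanSpace ℝ (Fin d)))
    (hφ : (⟨bary0 A, mem_real.2 ⟨A, hA, bary0_mem (le_refl A)⟩⟩ : ↥(real M)) ∈ φ.source) :
    ∃ (p : EuclideanSpace ℝ (Fin d)), ∃ r0 > 0, ∃ r > 0, ∀ j,
      Nonempty (Hq bd (CC (Lst M A) j) (CC (Lst M A) (j + 1)) ≃ₗ[ZMod 2]
        sHomology (ZMod 2) ↥(pball p r0 r) j) := by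
  obtain ⟨r0, hr0, r, hr, hr1, s, hs, hs1, a, ha⟩ := chart_sandwich hM (A := A) φ _ rfl hφ
  refine ⟨φ ⟨bary0 A, mem_real.2 ⟨A, hA, bary0_mem (le_refl A)⟩⟩, r0, hr0, r, hr, fun j => ?_⟩
  obtain ⟨e1⟩ := ha.equiv j
  obtain ⟨f, hf⟩ := Wn_link hM A hs hs1
  obtain ⟨e2⟩ := hf.equiv j
  obtain ⟨e3⟩ := sHom_cell (Lst_down M A) j
  exact ⟨(e1.trans (e2.trans e3)).symm⟩

theorem link_homology {n d : ℕ} {M : Set (CubeFace n)} (hM : Down M)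
    (hman : Nonempty (ChartedSpace (EuclideanSpace ℝ (Fin d)) ↥(real M)))
    {A : CubeFace n} (hA : A ∈ M) (j : ℕ) :
    Nonempty (Hq bd (CC (Lst M A) j) (CC (Lst M A) (j + 1)) ≃ₗ[ZMod 2]
      Hq bd (CC (boundaryCube d) j) (CC (boundaryCube d) (j + 1))) := by
  obtain ⟨hc⟩ := hman
  obtain ⟨p, r0, hr0, r, hr, e1⟩ := link_sHom hM hA
    (chartAt (EuclideanSpace ℝ (Fin d)) _) (mem_chart_source _ _)
  obtain ⟨q, q0, hq0, s, hs, e2⟩ := link_sHom (M := Set.univ) (fun _ _ _ _ => trivial)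
    (A := topF d) trivial (cubeChart d) (fun i => by
      change 0 < (1 / 2 : ℝ) ∧ (1 / 2 : ℝ) < 1
      norm_num)
  rw [Lst_univ] at e2
  obtain ⟨e1⟩ := e1 j
  obtain ⟨e2⟩ := e2 j
  obtain ⟨e3⟩ := pball_equiv p q hr0 hq0 hr hs j
  exact ⟨e1.trans (e3.trans e2.symm)⟩

end
end BF


namespace BF
open CubeFace
noncomputable section

/-! ### transfer of homology statements -/

theorem Hq_subsing {V : Type*} [AddCommGroup V] [Module (ZMod 2) V] (D : V →ₗ[ZMod 2] V)
    (W W' : Submodule (ZMod 2) V) :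
    Subsingleton (Hq D W W') ↔ ∀ c ∈ W, D c = 0 → c ∈ W'.map D := by
  rw [Submodule.Quotient.subsingleton_iff, Submodule.eq_top_iff']
  constructor
  · intro h c hc hd
    exact h ⟨c, hc, hd⟩
  · rintro h ⟨c, hc, hd⟩
    exact h c hc hd

/-- exactly two elements -/
def Two (Q : Type*) [Zero Q] : Prop := ∃ z : Q, z ≠ 0 ∧ ∀ c, c = 0 ∨ c = z

theorem Two.congr {Q Q' : Type*} [AddCommGroup Q] [AddCommGroup Q'] (e : Q ≃+ Q') (h : Two Q) :
    Two Q' := by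
  obtain ⟨z, hz, h⟩ := h
  refine ⟨e z, fun h0 => hz (e.map_eq_zero_iff.1 h0), fun c => ?_⟩
  rcases h (e.symm c) with h1 | h1
  · left; rw [← e.apply_symm_apply c, h1, map_zero]
  · right; rw [← h1, e.apply_symm_apply]

theorem Hq_two {V : Type*} [AddCommGroup V] [Module (ZMod 2) V] (D : V →ₗ[ZMod 2] V)
    (W W' : Submodule (ZMod 2) V) :
    Two (Hq D W W') ↔ ∃ z ∈ W, D z = 0 ∧ z ∉ W'.map D ∧
      ∀ c ∈ W, D c = 0 → c ∈ W'.map D ∨ c + z ∈ W'.map D := by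
  have neg : ∀ v : V, -v = v := fun v => by
    rw [neg_eq_iff_add_eq_zero]; exact two_self v
  constructor
  · rintro ⟨z, hz, h⟩
    obtain ⟨⟨z, hz1, hz2⟩, rfl⟩ := Submodule.mkQ_surjective _ z
    refine ⟨z, hz1, hz2, fun h' => hz ?_, fun c hc hd => ?_⟩
    · exact (Submodule.Quotient.mk_eq_zero _).2 h'
    · rcases h (Submodule.Quotient.mk ⟨c, hc, hd⟩) with h1 | h1
      · left
        have := (Submodule.Quotient.mk_eq_zero _).1 h1
        exact this
      · right
        have := (Submodule.Quotient.eq _).1 h1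
        have h2 : c - z ∈ W'.map D := this
        rwa [sub_eq_add_neg, neg] at h2
  · rintro ⟨z, hz1, hz2, h3, h4⟩
    refine ⟨Submodule.Quotient.mk ⟨z, hz1, hz2⟩, fun h' => h3 ?_, fun c => ?_⟩
    · have := (Submodule.Quotient.mk_eq_zero _).1 h'
      exact this
    · obtain ⟨⟨c, hc, hd⟩, rfl⟩ := Submodule.mkQ_surjective _ c
      rcases h4 c hc hd with h1 | h1
      · left; exact (Submodule.Quotient.mk_eq_zero _).2 h1
      · right
        refine (Submodule.Quotient.eq _).2 ?_
        change c - z ∈ W'.map D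
        rwa [sub_eq_add_neg, neg]

/-! ### the boundary of the cube -/

theorem topF_eq {d : ℕ} {F : CubeFace d} (h : dim F = d) : F = topF d := by
  classical
  apply face_ext
  intro i
  rw [dim_eq] at h
  have : Finset.univ.filter (fun i => F i = none) = Finset.univ := by
    apply Finset.eq_univ_of_card; simpa using h
  have h2 : i ∈ Finset.univ.filter (fun i => F i = none) := by rw [this]; simp
  change F i = none
  simpa using h2

theorem dim_topF (d : ℕ) : dim (topF d) = d := by
  classical
  rw [dim_eq]; simp [topF]

theorem star_univ (d : ℕ) : StarAt (Set.univ : Set (CubeFace d)) (fun _ => false) :=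
  fun _ _ => ⟨topF d, trivial, fun _ => Or.inl rfl, fun _ => Or.inl rfl⟩

theorem down_univ (d : ℕ) : Down (Set.univ : Set (CubeFace d)) := fun _ _ _ _ => trivial

theorem CC_univ_bc {d j : ℕ} (hj : j ≠ d) : CC (Set.univ : Set (CubeFace d)) j ≤
    CC (boundaryCube d) j := by
  refine Finsupp.supported_mono ?_
  rintro F ⟨-, h⟩
  refine ⟨fun h' => hj ?_, h⟩
  rw [← h, h']; exact dim_topF d

theorem bc_fill {d j : ℕ} (hj0 : j ≠ 0) (hj : j + 1 ≠ d) :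
    Subsingleton (Hq bd (CC (boundaryCube d) j) (CC (boundaryCube d) (j + 1))) := by
  rw [Hq_subsing]
  intro c hc hb
  obtain ⟨e, he, h⟩ := star_acyclic (down_univ d) (star_univ d) hj0
    (CC_mono (Set.subset_univ _) _ hc) hb
  exact ⟨e, CC_univ_bc hj he, h.symm⟩

theorem zmod2 (t : ZMod 2) : t = 0 ∨ t = 1 := by
  revert t; decide

theorem bc_zero {d : ℕ} (hd : 2 ≤ d) :
    Two (Hq bd (CC (boundaryCube d) 0) (CC (boundaryCube d) (0 + 1))) := by
  rw [Hq_two]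
  set v : CubeFace d := toFace fun _ => false
  have hv : dim v = 0 := dim_toFace _
  have hz : (Finsupp.single v 1 : Cell d) ∈ CC (boundaryCube d) 0 :=
    CC_univ_bc (by omega) (Finsupp.single_mem_supported _ _ ⟨trivial, hv⟩)
  have haz : aug (Finsupp.single v 1 : Cell d) = 1 := by rw [aug_single, if_pos hv]
  refine ⟨Finsupp.single v 1, hz, bd_zero hz, ?_, ?_⟩
  · rintro ⟨e, -, he⟩
    rw [← he, aug_bd] at haz
    exact zero_ne_one haz
  · intro c hc _
    have key : ∀ x ∈ CC (boundaryCube d) 0, aug x = 0 → x ∈ (CC (boundaryCube d) (0+1)).map bd := by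
      intro x hx ha
      obtain ⟨e, he, h⟩ := star_acyclic_zero (down_univ d) (star_univ d)
        (CC_mono (Set.subset_univ _) _ hx) ha
      exact ⟨e, CC_univ_bc (by omega) he, h.symm⟩
    rcases zmod2 (aug c) with h | h
    · exact Or.inl (key c hc h)
    · right
      refine key _ (Submodule.add_mem _ hc hz) ?_
      rw [map_add, h, haz]; decide

theorem CC_top {d : ℕ} {c : Cell d} (h : c ∈ CC (Set.univ : Set (CubeFace d)) d) :
    c = 0 ∨ c = Finsupp.single (topF d) 1 := by
  have hs : c ∈ Finsupp.supported (ZMod 2) (ZMod 2) {topF d} := by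
    refine Finsupp.supported_mono ?_ h
    rintro F ⟨_, h2⟩
    exact topF_eq h2
  rw [Finsupp.mem_supported, Finset.coe_subset_singleton, Finsupp.support_subset_singleton] at hs
  rcases zmod2 (c (topF d)) with h | h
  · left; rw [hs, h]; simp
  · right; rw [hs, h]

/-- coefficients of the boundary -/
theorem bd_coeff {n : ℕ} {A G : CubeFace n} (h : A ≤ G) (hd : dim A + 1 = dim G) :
    (bd (Finsupp.single G 1) : Cell n) A = 1 := by
  classical
  obtain ⟨i, b, hi, rfl⟩ : ∃ i b, G i = none ∧ A = upd G i (some b) := by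
    obtain ⟨i, hi, hA⟩ : ∃ i, G i = none ∧ A i ≠ none := by
      by_contra! hcon
      have : A = G := face_ext fun i => by
        rcases h i with h1 | h1
        · rw [h1, hcon i h1]
        · exact h1
      rw [this] at hd; omega
    obtain ⟨b, hb⟩ := Option.ne_none_iff_exists'.1 hA
    refine ⟨i, b, hi, ?_⟩
    have h1 : A ≤ upd G i (some b) := by
      intro j
      by_cases hj : j = i
      · subst hj; right; rw [hb, upd_same]
      · rw [upd_ne _ hj]; exact h j
    have h2 : dim (upd G i (some b)) = dim A := by
      have := dim_upd_some G i b hi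
      omega
    have hsub : Finset.univ.filter (fun i => A i = none) ⊆
        Finset.univ.filter (fun j => upd G i (some b) j = none) := by
      intro j hj
      simp only [Finset.mem_filter, Finset.mem_univ, true_and] at hj ⊢
      rcases h1 j with h3 | h3
      · exact h3
      · rw [← h3, hj]
    have heq := Finset.eq_of_subset_of_card_le hsub (by rw [← dim_eq, ← dim_eq, h2])
    apply face_ext
    intro j
    rcases h1 j with h3 | h3
    · have : j ∈ Finset.univ.filter (fun i => A i = none) := by rw [heq]; simp [h3]
      rw [h3]; simpa using this
    · exact h3
  rw [bd_single, Finsupp.finsetSum_apply, Finset.sum_eq_single i]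
  · rw [if_pos hi, Finsupp.add_apply]
    have hne : upd G i (some false) ≠ upd G i (some true) := by
      intro h
      have := congrFun h i
      simp at this
    cases b
    · rw [Finsupp.single_eq_same, Finsupp.single_eq_of_ne hne, add_zero]
    · rw [Finsupp.single_eq_same, Finsupp.single_eq_of_ne hne.symm, zero_add]
  · intro j _ hj
    split_ifs with h1
    · have hne : ∀ b', upd G i (some b) ≠ upd G j (some b') := by
        intro b' h
        have := congrFun h i
        rw [upd_same, upd_ne _ hj.symm, hi] at this
        simp at this
      rw [Finsupp.add_apply, Finsupp.single_eq_of_ne (hne _), Finsupp.single_eq_of_ne (hne _),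
        add_zero]
    · rfl
  · simp

theorem bc_top {d : ℕ} (hd : 2 ≤ d) {j : ℕ} (hj : j + 1 = d) :
    Two (Hq bd (CC (boundaryCube d) j) (CC (boundaryCube d) (j + 1))) := by
  rw [Hq_two]
  have ht : (Finsupp.single (topF d) 1 : Cell d) ∈ CC (Set.univ : Set (CubeFace d)) (j + 1) :=
    Finsupp.single_mem_supported _ _ ⟨trivial, by rw [dim_topF, hj]⟩
  have hno : ∀ c, c ∈ (CC (boundaryCube d) (j+1)).map bd → c = 0 := by
    rintro c ⟨e, he, rfl⟩
    have : e = 0 := by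
      apply supported_empty_eq
      refine Finsupp.supported_mono ?_ he
      rintro F ⟨h1, h2⟩
      exact h1 (topF_eq (h2.trans hj))
    rw [this, map_zero]
  refine ⟨bd (Finsupp.single (topF d) 1), CC_univ_bc (by omega) (bd_mem (down_univ d) ht),
    bd_bd _, fun h => ?_, fun c hc hb => ?_⟩
  · have h0 := hno _ h
    have h1 := bd_coeff (A := upd (topF d) ⟨0, by omega⟩ (some false)) (G := topF d)
      (upd_some_le _ _ _ rfl) (dim_upd_some _ _ _ rfl)
    rw [h0] at h1
    exact zero_ne_one h1
  · obtain ⟨e, he, h⟩ := star_acyclic (down_univ d) (star_univ d) (by omega : j ≠ 0)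
      (CC_mono (Set.subset_univ _) _ hc) hb
    rw [hj] at he
    rcases CC_top he with h1 | h1
    · left; rw [h, h1, map_zero]; exact Submodule.zero_mem _
    · right; rw [h, h1, two_self]; exact Submodule.zero_mem _

end
end BF


namespace BF
open CubeFace
noncomputable section

variable {n d : ℕ} {M : Set (CubeFace n)}

theorem dim_mono {A B : CubeFace n} (h : A ≤ B) : dim A ≤ dim B := by
  classical
  rw [dim_eq, dim_eq]
  apply Finset.card_le_card
  intro j hj
  simp only [Finset.mem_filter, Finset.mem_univ, true_and] at hj ⊢
  rcases h j with h3 | h3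
  · exact h3
  · rw [← h3, hj]

theorem eq_of_le_dim {A B : CubeFace n} (h : A ≤ B) (hd : dim B ≤ dim A) : A = B := by
  classical
  have hsub : Finset.univ.filter (fun i => A i = none) ⊆
      Finset.univ.filter (fun j => B j = none) := by
    intro j hj
    simp only [Finset.mem_filter, Finset.mem_univ, true_and] at hj ⊢
    rcases h j with h3 | h3
    · exact h3
    · rw [← h3, hj]
  have heq := Finset.eq_of_subset_of_card_le hsub (by rwa [← dim_eq, ← dim_eq])
  apply face_ext
  intro j
  rcases h j with h3 | h3
  · have : j ∈ Finset.univ.filter (fun i => A i = none) := by rw [heq]; simp [h3]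
    rw [h3]; simpa using this
  · exact h3

theorem Lst_dim (hdim : ∀ F ∈ M, dim F ≤ d) {A G : CubeFace n} (hG : G ∈ Lst M A) :
    dim G < d := by
  obtain ⟨⟨H, hH, h1, h2⟩, h3⟩ := hG
  by_contra hcon
  have : G = H := eq_of_le_dim h2 ((hdim H hH).trans (not_lt.1 hcon))
  exact h3 (this ▸ h1)

theorem Bst_top (hdim : ∀ F ∈ M, dim F ≤ d) {A G : CubeFace n} (hG : G ∈ Bst M A)
    (hd : dim G = d) : G ∈ M ∧ A ≤ G := by
  obtain ⟨H, hH, h1, h2⟩ := hG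
  have : G = H := eq_of_le_dim h2 ((hdim H hH).trans hd.ge)
  exact this ▸ ⟨hH, h1⟩

theorem Bst_sub (hM : Down M) (A : CubeFace n) : Bst M A ⊆ M := by
  rintro G ⟨H, hH, -, h2⟩
  exact hM H hH G h2

theorem Bst_star (M : Set (CubeFace n)) (A : CubeFace n) : StarAt (Bst M A) (someVert A) := by
  rintro G ⟨H, hH, h1, h2⟩
  exact ⟨H, ⟨H, hH, h1, le_refl H⟩, h2, (someVert_le A).trans h1⟩

/-- the homological properties of links -/
structure LinkOK (M : Set (CubeFace n)) (d : ℕ) (A : CubeFace n) : Prop where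
  fill : ∀ i, i + 1 ≠ d → ∀ x ∈ CC (Lst M A) i, bd x = 0 → aug x = 0 →
    ∃ e ∈ CC (Lst M A) (i + 1), x = bd e
  vert : ∃ w ∈ Lst M A, dim w = 0
  top : ∀ j, j + 1 = d → ∃ z ∈ CC (Lst M A) j, bd z = 0 ∧ z ≠ 0 ∧
    ∀ c ∈ CC (Lst M A) j, bd c = 0 → c = 0 ∨ c = z

theorem exists_of_CC_ne {K : Set (CubeFace n)} {j : ℕ} {c : Cell n} (hc : c ∈ CC K j)
    (h : c ≠ 0) : ∃ F ∈ K, dim F = j ∧ c F = 1 := by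
  obtain ⟨F, hF⟩ := Finsupp.support_nonempty_iff.2 h
  have := (Finsupp.mem_supported _ _).1 hc hF
  refine ⟨F, this.1, this.2, ?_⟩
  rcases zmod2 (c F) with h1 | h1
  · exact absurd h1 (Finsupp.mem_support_iff.1 hF)
  · exact h1

theorem linkOK (hM : Down M) (hd : 2 ≤ d) (hdim : ∀ F ∈ M, dim F ≤ d)
    (hman : Nonempty (ChartedSpace (EuclideanSpace ℝ (Fin d)) ↥(real M)))
    {A : CubeFace n} (hA : A ∈ M) : LinkOK M d A := by
  have hl := link_homology hM hman hA
  have hT : ∀ j, Two (Hq bd (CC (boundaryCube d) j) (CC (boundaryCube d) (j + 1))) →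
      Two (Hq bd (CC (Lst M A) j) (CC (Lst M A) (j + 1))) := by
    intro j h
    obtain ⟨e⟩ := hl j
    exact h.congr e.symm.toAddEquiv
  obtain ⟨z0, hz01, -, hz03, hz04⟩ := (Hq_two _ _ _).1 (hT 0 (bc_zero hd))
  have hvert : ∃ w ∈ Lst M A, dim w = 0 := by
    have : z0 ≠ 0 := by
      rintro rfl; exact hz03 (Submodule.zero_mem _)
    obtain ⟨w, hw, hw2, -⟩ := exists_of_CC_ne hz01 this
    exact ⟨w, hw, hw2⟩
  refine ⟨?_, hvert, ?_⟩
  · intro i hi x hx hb ha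
    by_cases hi0 : i = 0
    · subst hi0
      obtain ⟨w, hw, hw0⟩ := hvert
      have hwc : (Finsupp.single w 1 : Cell n) ∈ CC (Lst M A) 0 :=
        Finsupp.single_mem_supported _ _ ⟨hw, hw0⟩
      have haw : aug (Finsupp.single w 1 : Cell n) = 1 := by rw [aug_single, if_pos hw0]
      have hnot : ∀ y, y ∈ (CC (Lst M A) (0 + 1)).map bd → aug y = 0 := by
        rintro y ⟨e, -, rfl⟩; exact aug_bd e
      have h1 := hz04 _ hwc (bd_zero hwc)
      have h2 := hz04 x hx hb
      have h3 : Finsupp.single w 1 + z0 ∈ (CC (Lst M A) (0 + 1)).map bd := by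
        rcases h1 with h1 | h1
        · have := hnot _ h1
          rw [haw] at this; exact absurd this one_ne_zero
        · exact h1
      rcases h2 with ⟨e, he, rfl⟩ | h2
      · exact ⟨e, he, rfl⟩
      · have h4 := hnot _ (Submodule.add_mem _ h3 h2)
        rw [map_add, map_add, map_add, haw, ha, zero_add] at h4
        have := two_self (aug z0)
        rw [add_assoc, this, add_zero] at h4
        exact absurd h4 one_ne_zero
    · have := bc_fill hi0 hi
      obtain ⟨e⟩ := hl i
      have : Subsingleton (Hq bd (CC (Lst M A) i) (CC (Lst M A) (i + 1))) :=
        e.toEquiv.subsingleton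
      obtain ⟨y, hy, h⟩ := (Hq_subsing _ _ _).1 this x hx hb
      exact ⟨y, hy, h.symm⟩
  · intro j hj
    have hno : ∀ c, c ∈ (CC (Lst M A) (j+1)).map bd → c = 0 := by
      rintro c ⟨e, he, rfl⟩
      have : e = 0 := by
        apply supported_empty_eq
        refine Finsupp.supported_mono ?_ he
        rintro F ⟨h1, h2⟩
        have := Lst_dim hdim h1
        omega
      rw [this, map_zero]
    obtain ⟨z, hz1, hz2, hz3, hz4⟩ := (Hq_two _ _ _).1 (hT j (bc_top hd hj))
    refine ⟨z, hz1, hz2, fun h => hz3 (h ▸ Submodule.zero_mem _), fun c hc hb => ?_⟩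
    rcases hz4 c hc hb with h | h
    · exact Or.inl (hno _ h)
    · exact Or.inr (add_eq_zero_iff'.1 (hno _ h))

/-! ### relative cycles of the pair `(M, M_A)` -/

/-- the faces not containing `A` -/
def MA (M : Set (CubeFace n)) (A : CubeFace n) : Set (CubeFace n) := {G | G ∈ M ∧ ¬ A ≤ G}

theorem MA_down (hM : Down M) (A : CubeFace n) : Down (MA M A) := by
  rintro F ⟨h1, h2⟩ G hG
  exact ⟨hM F h1 G hG, fun h => h2 (h.trans hG)⟩

theorem MA_split (A : CubeFace n) {j : ℕ} {c : Cell n} (hc : c ∈ CC M j) :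
    ∃ a ∈ CC (Bst M A) j, ∃ b ∈ CC (MA M A) j, c = a + b := by
  apply supported_split
  refine Finsupp.supported_mono ?_ hc
  rintro G ⟨h1, h2⟩
  by_cases h : A ≤ G
  · exact Or.inl ⟨⟨G, h1, h, le_refl G⟩, h2⟩
  · exact Or.inr ⟨⟨h1, h⟩, h2⟩

theorem Lst_sub_MA (hM : Down M) (A : CubeFace n) : Lst M A ⊆ MA M A :=
  fun _ h => ⟨Bst_sub hM A h.1, h.2⟩

theorem CS_Lst {A : CubeFace n} {c : Cell n} (h1 : c ∈ CS (Bst M A)) (h2 : c ∈ CS (MA M A)) :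
    c ∈ CS (Lst M A) := by
  refine Finsupp.supported_mono ?_ (supported_inter_mem h1 h2)
  rintro G ⟨h1, h2⟩
  exact ⟨h1, h2.2⟩

theorem CC_top_succ (hdim : ∀ F ∈ M, dim F ≤ d) {j : ℕ} (hj : d < j) {c : Cell n}
    (hc : c ∈ CC M j) : c = 0 := by
  apply supported_empty_eq
  refine Finsupp.supported_mono ?_ hc
  rintro F ⟨h1, h2⟩
  have := hdim F h1
  omega

theorem local_zero (hM : Down M) {A : CubeFace n} (hL : LinkOK M d A) {j : ℕ} (hj : j ≠ d)
    {c : Cell n} (hc : c ∈ CC M j) (hb : bd c ∈ CS (MA M A)) :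
    ∃ e ∈ CC M (j + 1), c + bd e ∈ CS (MA M A) := by
  obtain ⟨a, ha, b, hb', rfl⟩ := MA_split A hc
  suffices h : ∃ e ∈ CC (Bst M A) (j + 1), a + bd e ∈ CS (Lst M A) by
    obtain ⟨e, he, h⟩ := h
    refine ⟨e, CC_mono (Bst_sub hM A) _ he, ?_⟩
    have : a + b + bd e = (a + bd e) + b := by abel
    rw [this]
    exact Submodule.add_mem _ (Finsupp.supported_mono (Lst_sub_MA hM A) h) (CC_le_CS _ _ hb')
  cases j with
  | zero =>
    obtain ⟨w, hw, hw0⟩ := hL.vert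
    have hwc : (Finsupp.single w 1 : Cell n) ∈ CC (Lst M A) 0 :=
      Finsupp.single_mem_supported _ _ ⟨hw, hw0⟩
    have haw : aug (Finsupp.single w 1 : Cell n) = 1 := by rw [aug_single, if_pos hw0]
    have hwa : aug a • (Finsupp.single w 1 : Cell n) ∈ CC (Lst M A) 0 :=
      Submodule.smul_mem _ _ hwc
    obtain ⟨e, he, h⟩ := star_acyclic_zero (Bst_down M A) (Bst_star M A)
      (c := a + aug a • (Finsupp.single w 1 : Cell n))
      (Submodule.add_mem _ ha (CC_mono (fun _ h => h.1) _ hwa))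
      (by rw [map_add, map_smul, haw, smul_eq_mul, mul_one]; exact two_self _)
    refine ⟨e, he, ?_⟩
    rw [← h, ← add_assoc, two_self, zero_add]
    exact CC_le_CS _ _ hwa
  | succ i =>
    have hx : bd a ∈ CC (Lst M A) i := by
      refine CC_of_CS (bd_mem (Bst_down M A) ha) (CS_Lst ?_ ?_)
      · exact bd_mem_CS (Bst_down M A) (CC_le_CS _ _ ha)
      · have h1 := bd_mem_CS (MA_down hM A) (CC_le_CS _ _ hb')
        have h2 := Submodule.add_mem _ hb h1
        rwa [map_add, add_assoc, two_self, add_zero] at h2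
    obtain ⟨e, he, h⟩ := hL.fill i hj _ hx (bd_bd _) (aug_bd _)
    obtain ⟨f, hf, h'⟩ := star_acyclic (Bst_down M A) (Bst_star M A) (Nat.succ_ne_zero i)
      (c := a + e) (Submodule.add_mem _ ha (CC_mono (fun _ h => h.1) _ he))
      (by rw [map_add, h, two_self])
    refine ⟨f, hf, ?_⟩
    rw [← h', ← add_assoc, two_self, zero_add]
    exact CC_le_CS _ _ he

/-- in top degree there is exactly one nonzero relative cycle -/
theorem local_top (hM : Down M) (hd : 2 ≤ d) (hdim : ∀ F ∈ M, dim F ≤ d) {A : CubeFace n}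
    (hL : LinkOK M d A) : ∃ f ∈ CC (Bst M A) d, f ≠ 0 ∧ bd f ∈ CS (MA M A) ∧
      ∀ c ∈ CC (Bst M A) d, bd c ∈ CS (MA M A) → c = 0 ∨ c = f := by
  obtain ⟨j, rfl⟩ : ∃ j, d = j + 1 := ⟨d - 1, by omega⟩
  obtain ⟨z, hz1, hz2, hz3, hz4⟩ := hL.top j rfl
  obtain ⟨f, hf, h⟩ := star_acyclic (Bst_down M A) (Bst_star M A) (by omega : j ≠ 0)
    (CC_mono (fun _ h => h.1) _ hz1) hz2
  have inj : ∀ c ∈ CC (Bst M A) (j + 1), bd c = 0 → c = 0 := by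
    intro c hc hb
    obtain ⟨e, he, h⟩ := star_acyclic (Bst_down M A) (Bst_star M A) (by omega : j + 1 ≠ 0) hc hb
    rw [h, CC_top_succ hdim (Nat.lt_succ_self _) (CC_mono (Bst_sub hM A) _ he), map_zero]
  refine ⟨f, hf, ?_, ?_, ?_⟩
  · rintro rfl; rw [map_zero] at h; exact hz3 h
  · rw [← h]; exact Finsupp.supported_mono (Lst_sub_MA hM A) (CC_le_CS _ _ hz1)
  · intro c hc hb
    have hx : bd c ∈ CC (Lst M A) j :=
      CC_of_CS (bd_mem (Bst_down M A) hc) (CS_Lst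
        (bd_mem_CS (Bst_down M A) (CC_le_CS _ _ hc)) hb)
    rcases hz4 _ hx (bd_bd _) with h1 | h1
    · exact Or.inl (inj c hc h1)
    · right
      apply add_eq_zero_iff'.1
      apply inj _ (Submodule.add_mem _ hc hf)
      rw [map_add, h1, h, two_self]

/-! ### the fundamental class -/

open Classical in
/-- the sum of all `d`-faces -/
def fund (M : Set (CubeFace n)) (d : ℕ) : Cell n :=
  Finsupp.equivFunOnFinite.symm fun F => if F ∈ M ∧ dim F = d then 1 else 0

open Classical in
theorem fund_apply (F : CubeFace n) : fund M d F = if F ∈ M ∧ dim F = d then 1 else 0 := rfl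

theorem fund_mem : fund M d ∈ CC M d := by
  rw [Finsupp.mem_supported]
  intro F hF
  have h := Finsupp.mem_support_iff.1 hF
  rw [fund_apply] at h
  by_contra hcon
  exact h (if_neg hcon)

theorem CS_coeff {K : Set (CubeFace n)} {c : Cell n} (h : c ∈ CS K) {A : CubeFace n}
    (hA : A ∉ K) : c A = 0 := by
  by_contra hcon
  exact hA ((Finsupp.mem_supported _ _).1 h (Finsupp.mem_support_iff.2 hcon))

theorem ridge (hM : Down M) (hd : 2 ≤ d) (hdim : ∀ F ∈ M, dim F ≤ d) {A : CubeFace n}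
    (hA : A ∈ M) (hAd : dim A + 1 = d) (hL : LinkOK M d A) : bd (fund M d) A = 0 := by
  obtain ⟨f, hf, hf0, hfb, huniq⟩ := local_top hM hd hdim hL
  obtain ⟨G', hG', hG'd, hfG'⟩ := exists_of_CC_ne hf hf0
  have hall : ∀ G ∈ M, dim G = d → A ≤ G → f G = 1 := by
    intro G hG hGd hAG
    by_contra hcon
    have hne : G ≠ G' := by rintro rfl; exact hcon hfG'
    have hGB : G ∈ Bst M A := ⟨G, hG, hAG, le_refl G⟩
    have hc : (Finsupp.single G 1 + Finsupp.single G' 1 : Cell n) ∈ CC (Bst M A) d :=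
      Submodule.add_mem _ (Finsupp.single_mem_supported _ _ ⟨hGB, hGd⟩)
        (Finsupp.single_mem_supported _ _ ⟨hG', hG'd⟩)
    have hAG' := (Bst_top hdim hG' hG'd).2
    have hb : bd (Finsupp.single G 1 + Finsupp.single G' 1 : Cell n) ∈ CS (MA M A) := by
      have h1 : bd (Finsupp.single G 1 + Finsupp.single G' 1 : Cell n) ∈ CC M (d - 1) := by
        apply bd_mem hM
        rw [show d - 1 + 1 = d by omega]
        exact CC_mono (Bst_sub hM A) _ hc
      rw [Finsupp.mem_supported]
      intro H hH
      have h2 := (Finsupp.mem_supported _ _).1 h1 hH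
      refine ⟨h2.1, fun hAH => ?_⟩
      have : A = H := eq_of_le_dim hAH (by rw [h2.2]; omega)
      subst this
      apply Finsupp.mem_support_iff.1 hH
      rw [map_add, Finsupp.add_apply, bd_coeff hAG (by omega), bd_coeff hAG' (by omega)]
      exact two_self _
    rcases huniq _ hc hb with h | h
    · have := DFunLike.congr_fun h G
      rw [Finsupp.add_apply, Finsupp.single_eq_same, Finsupp.single_eq_of_ne hne] at this
      simp at this
    · apply hcon
      rw [← h, Finsupp.add_apply, Finsupp.single_eq_same, Finsupp.single_eq_of_ne hne, add_zero]
  have hdiff : fund M d + f ∈ CC (MA M A) d := by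
    refine CC_of_CS (Submodule.add_mem _ fund_mem (CC_mono (Bst_sub hM A) _ hf)) ?_
    have h1 := (Submodule.add_mem _ (fund_mem (M := M) (d := d)) (CC_mono (Bst_sub hM A) _ hf))
    rw [Finsupp.mem_supported]
    intro H hH
    have h2 := (Finsupp.mem_supported _ _).1 h1 hH
    refine ⟨h2.1, fun hAH => ?_⟩
    apply Finsupp.mem_support_iff.1 hH
    rw [Finsupp.add_apply, fund_apply, if_pos ⟨h2.1, h2.2⟩, hall H h2.1 h2.2 hAH]
    exact two_self _
  have h1 := CS_coeff (bd_mem_CS (MA_down hM A) (CC_le_CS _ _ hdiff)) (A := A)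
    fun h => h.2 (le_refl A)
  have h2 := CS_coeff hfb (A := A) fun h => h.2 (le_refl A)
  rwa [map_add, Finsupp.add_apply, h2, add_zero] at h1

theorem fund_cycle (hM : Down M) (hd : 2 ≤ d) (hdim : ∀ F ∈ M, dim F ≤ d)
    (hL : ∀ A ∈ M, LinkOK M d A) : bd (fund M d) = 0 := by
  have h1 : bd (fund M d) ∈ CC M (d - 1) := by
    apply bd_mem hM
    rw [show d - 1 + 1 = d by omega]
    exact fund_mem
  by_contra hcon
  obtain ⟨A, hA, hAd, h⟩ := exists_of_CC_ne h1 hcon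
  rw [ridge hM hd hdim hA (by omega) (hL A hA)] at h
  exact zero_ne_one h

/-- trivial relative cycles -/
def RR (M : Set (CubeFace n)) (d j : ℕ) : Submodule (ZMod 2) (Cell n) :=
  if j = d then Submodule.span (ZMod 2) {fund M d} else (CC M (j + 1)).map bd

theorem RR_top : RR M d d = Submodule.span (ZMod 2) {fund M d} := if_pos rfl

theorem mem_RR_top {c : Cell n} (h : c ∈ RR M d d) : c = 0 ∨ c = fund M d := by
  rw [RR_top, Submodule.mem_span_singleton] at h
  obtain ⟨t, rfl⟩ := h
  rcases zmod2 t with rfl | rfl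
  · left; simp
  · right; simp

theorem fund_mem_RR : fund M d ∈ RR M d d := by
  rw [RR_top]; exact Submodule.mem_span_singleton_self _

theorem mem_RR {j : ℕ} (hj : j ≠ d) {c : Cell n} :
    c ∈ RR M d j ↔ ∃ e ∈ CC M (j + 1), c = bd e := by
  rw [RR, if_neg hj]
  constructor
  · rintro ⟨e, he, rfl⟩; exact ⟨e, he, rfl⟩
  · rintro ⟨e, he, rfl⟩; exact ⟨e, he, rfl⟩

/-- relative homology of `(M,K)` in degree `j` is trivial, or generated by the fundamental class -/
def Zr (M : Set (CubeFace n)) (d : ℕ) (K : Set (CubeFace n)) (j : ℕ) : Prop :=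
  ∀ c ∈ CC M j, bd c ∈ CS K → ∃ e ∈ RR M d j, c + e ∈ CS K

/-- `(M,K)` looks like a ball modulo its complement -/
def Good (M : Set (CubeFace n)) (d : ℕ) (K : Set (CubeFace n)) : Prop :=
  (∀ j, Zr M d K j) ∧ fund M d ∉ CS K

theorem good_MA (hM : Down M) (hd : 2 ≤ d) (hdim : ∀ F ∈ M, dim F ≤ d)
    (hL : ∀ A ∈ M, LinkOK M d A) {A : CubeFace n} (hA : A ∈ M) : Good M d (MA M A) := by
  obtain ⟨f, hf, hf0, hfb, huniq⟩ := local_top hM hd hdim (hL A hA)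
  have hnot : fund M d ∉ CS (MA M A) := by
    intro h
    obtain ⟨G, hG, hGd, -⟩ := exists_of_CC_ne hf hf0
    obtain ⟨hG1, hG2⟩ := Bst_top hdim hG hGd
    have := CS_coeff h (A := G) fun h => h.2 hG2
    rw [fund_apply, if_pos ⟨hG1, hGd⟩] at this
    exact one_ne_zero this
  refine ⟨fun j c hc hb => ?_, hnot⟩
  by_cases hj : j = d
  · subst hj
    have key : ∀ c ∈ CC M j, bd c ∈ CS (MA M A) → c ∈ CS (MA M A) ∨ c + f ∈ CS (MA M A) := by
      intro c hc hb
      obtain ⟨a, ha, b, hb', rfl⟩ := MA_split A hc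
      have hba : bd a ∈ CS (MA M A) := by
        have h1 := bd_mem_CS (MA_down hM A) (CC_le_CS _ _ hb')
        have h2 := Submodule.add_mem _ hb h1
        rwa [map_add, add_assoc, two_self, add_zero] at h2
      rcases huniq a ha hba with rfl | rfl
      · left; rw [zero_add]; exact CC_le_CS _ _ hb'
      · right; rw [add_comm a b, add_assoc, two_self, add_zero]; exact CC_le_CS _ _ hb'
    have hF := key _ fund_mem (by rw [fund_cycle hM hd hdim hL]; exact Submodule.zero_mem _)
    have hF := hF.resolve_left hnot
    rcases key c hc hb with h | h
    · exact ⟨0, Submodule.zero_mem _, by rwa [add_zero]⟩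
    · refine ⟨_, fund_mem_RR, ?_⟩
      have := Submodule.add_mem _ h hF
      have h2 : c + f + (fund M j + f) = c + fund M j := by
        have := two_self f
        grind
      rwa [h2] at this
  · obtain ⟨e, he, h⟩ := local_zero hM (hL A hA) hj hc hb
    exact ⟨_, (mem_RR hj).2 ⟨e, he, rfl⟩, h⟩

end
end BF


namespace BF
open CubeFace
noncomputable section

variable {n d : ℕ} {M : Set (CubeFace n)}

theorem Zr_big (hdim : ∀ F ∈ M, dim F ≤ d) (K : Set (CubeFace n)) {j : ℕ} (hj : d < j) :
    Zr M d K j := by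
  intro c hc _
  refine ⟨0, Submodule.zero_mem _, ?_⟩
  rw [CC_top_succ hdim hj hc, add_zero]; exact Submodule.zero_mem _

theorem CS_union_split {K0 K1 : Set (CubeFace n)} {j : ℕ} {c : Cell n} (hc : c ∈ CC M j)
    (h : c ∈ CS (K0 ∪ K1)) : ∃ a ∈ CC K0 j, ∃ b ∈ CC K1 j, c = a + b := by
  apply supported_split
  refine Finsupp.supported_mono ?_ (supported_inter_mem hc h)
  rintro G ⟨h1, h2 | h2⟩
  · exact Or.inl ⟨h2, h1.2⟩
  · exact Or.inr ⟨h2, h1.2⟩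

theorem CS_mono {K L : Set (CubeFace n)} (h : K ⊆ L) : CS K ≤ CS L := Finsupp.supported_mono h

theorem RR_cycle (hM : Down M) (hf : bd (fund M d) = 0) {j : ℕ} {e : Cell n} (he : e ∈ RR M d j) :
    bd e = 0 := by
  by_cases hj : j = d
  · subst hj
    rcases mem_RR_top he with rfl | rfl
    · exact map_zero _
    · exact hf
  · obtain ⟨y, -, rfl⟩ := (mem_RR hj).1 he
    exact bd_bd y

theorem MV_inter (hM : Down M) (hdim : ∀ F ∈ M, dim F ≤ d) (hf : bd (fund M d) = 0)
    {K0 K1 : Set (CubeFace n)} (h0 : Down K0)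
    (h1 : Down K1) (s0 : K0 ⊆ M) (s1 : K1 ⊆ M) {j : ℕ} (z0 : Zr M d K0 j) (z1 : Zr M d K1 j)
    (zu : Zr M d (K0 ∪ K1) (j + 1)) (hnot : fund M d ∉ CS (K0 ∪ K1)) : Zr M d (K0 ∩ K1) j := by
  intro c hc hb
  obtain ⟨e0, he0, k0⟩ := z0 c hc (CS_mono Set.inter_subset_left hb)
  obtain ⟨e1, he1, k1⟩ := z1 c hc (CS_mono Set.inter_subset_right hb)
  by_cases hj : j = d
  · subst hj
    have two : ∀ e ∈ CC M j, e = e → (c + e ∈ CS K0) → c + e ∈ CS K1 → c + e ∈ CS (K0 ∩ K1) :=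
      fun e _ _ h h' => supported_inter_mem h h'
    by_cases he : e0 = e1
    · subst he
      exact ⟨e0, he0, supported_inter_mem k0 k1⟩
    · exfalso
      apply hnot
      have := Submodule.add_mem _ (CS_mono Set.subset_union_left k0)
        (CS_mono Set.subset_union_right k1)
      have h2 : c + e0 + (c + e1) = e0 + e1 := by
        have := two_self c
        grind
      rw [h2] at this
      rcases mem_RR_top he0 with rfl | rfl <;> rcases mem_RR_top he1 with rfl | rfl
      · exact absurd rfl he
      · rwa [zero_add] at this
      · rwa [add_zero] at this
      · exact absurd rfl he
  · obtain ⟨y0, hy0, rfl⟩ := (mem_RR hj).1 he0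
    obtain ⟨y1, hy1, rfl⟩ := (mem_RR hj).1 he1
    have hx : bd (y0 + y1) ∈ CS (K0 ∪ K1) := by
      have := Submodule.add_mem _ (CS_mono Set.subset_union_left k0)
        (CS_mono Set.subset_union_right k1)
      have h2 : c + bd y0 + (c + bd y1) = bd (y0 + y1) := by
        have := two_self c
        rw [map_add]
        grind
      rwa [h2] at this
    obtain ⟨t, ht, k⟩ := zu _ (Submodule.add_mem _ hy0 hy1) hx
    obtain ⟨a0, ha0, a1, ha1, h⟩ := supported_split k
    -- degree parts
    have htc := RR_cycle hM hf ht
    obtain ⟨b0, hb0, b1, hb1, hbb⟩ : ∃ a ∈ CC K0 (j+1), ∃ b ∈ CC K1 (j+1), y0 + y1 + t = a + b := by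
      refine CS_union_split (M := M) ?_ k
      refine Submodule.add_mem _ (Submodule.add_mem _ hy0 hy1) ?_
      by_cases hj1 : j + 1 = d
      · rw [hj1] at ht ⊢
        rcases mem_RR_top ht with rfl | rfl
        · exact Submodule.zero_mem _
        · exact fund_mem
      · obtain ⟨y, hy, rfl⟩ := (mem_RR hj1).1 ht
        exact bd_mem hM hy
    refine ⟨bd (y0 + b0), (mem_RR hj).2 ⟨_, Submodule.add_mem _ hy0 (CC_mono s0 _ hb0), rfl⟩, ?_⟩
    refine supported_inter_mem ?_ ?_
    · rw [map_add, ← add_assoc]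
      exact Submodule.add_mem _ k0 (bd_mem_CS h0 (CC_le_CS _ _ hb0))
    · have h3 : y0 + b0 = y1 + b1 + t := by
        have e1 := two_self y1
        have e2 := two_self b0
        have e3 := two_self t
        grind
      rw [h3, map_add, htc, add_zero, map_add, ← add_assoc]
      exact Submodule.add_mem _ k1 (bd_mem_CS h1 (CC_le_CS _ _ hb1))

/-- a nontrivial relative class -/
def Non (M : Set (CubeFace n)) (d : ℕ) (K : Set (CubeFace n)) (j : ℕ) : Prop :=
  ∃ c ∈ CC M j, bd c ∈ CS K ∧ ∀ e ∈ RR M d j, c + e ∉ CS K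

theorem MV_non (hM : Down M) (hdim : ∀ F ∈ M, dim F ≤ d)
    {K0 K1 : Set (CubeFace n)} (h0 : Down K0)
    (h1 : Down K1) (s0 : K0 ⊆ M) {j : ℕ} (z0 : Zr M d K0 (j + 1))
    (z1 : Zr M d K1 (j + 1)) (hu : Non M d (K0 ∪ K1) (j + 1)) : Non M d (K0 ∩ K1) j := by
  obtain ⟨x, hx, hxb, hne⟩ := hu
  obtain ⟨b0, hb0, b1, hb1, h⟩ := CS_union_split (bd_mem hM hx) hxb
  refine ⟨b0, CC_mono s0 _ hb0, ?_, ?_⟩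
  · have e : bd b0 = bd b1 := by
      apply add_eq_zero_iff'.1
      rw [← map_add, ← h, bd_bd]
    refine supported_inter_mem (bd_mem_CS h0 (CC_le_CS _ _ hb0)) ?_
    change bd b0 ∈ CS K1
    rw [e]
    exact bd_mem_CS h1 (CC_le_CS _ _ hb1)
  · intro e he hcon
    have hj : j ≠ d := by
      rintro rfl
      refine hne 0 (Submodule.zero_mem _) ?_
      rw [CC_top_succ hdim (Nat.lt_succ_self _) hx, zero_add]
      exact Submodule.zero_mem _
    obtain ⟨y, hy, rfl⟩ := (mem_RR hj).1 he
    have hy0 : bd y ∈ CS K0 := by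
      have := Submodule.add_mem _ (CS_mono Set.inter_subset_left hcon) (CC_le_CS _ _ hb0)
      have h2 : b0 + bd y + b0 = bd y := by
        have := two_self b0
        grind
      rwa [h2] at this
    have hy1 : bd (x + y) ∈ CS K1 := by
      have := Submodule.add_mem _ (CS_mono Set.inter_subset_right hcon) (CC_le_CS _ _ hb1)
      have h2 : b0 + bd y + b1 = bd (x + y) := by
        rw [map_add, h]; abel
      rwa [h2] at this
    obtain ⟨r0, hr0, k0⟩ := z0 y hy hy0
    obtain ⟨r1, hr1, k1⟩ := z1 _ (Submodule.add_mem _ hx hy) hy1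
    refine hne (r0 + r1) (Submodule.add_mem _ hr0 hr1) ?_
    have := Submodule.add_mem _ (CS_mono Set.subset_union_left k0)
        (CS_mono Set.subset_union_right k1)
    have h2 : y + r0 + (x + y + r1) = x + (r0 + r1) := by
      have := two_self y
      grind
    rwa [h2] at this

theorem MV_base (hf : bd (fund M d) = 0)
    {K0 K1 : Set (CubeFace n)} (h0 : Down K0)
    (h1 : Down K1) (s0 : K0 ⊆ M) (hu : K0 ∪ K1 = M) (n0 : fund M d ∉ CS K0)
    (n1 : fund M d ∉ CS K1) : Non M d (K0 ∩ K1) d := by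
  obtain ⟨a0, ha0, a1, ha1, h⟩ := CS_union_split (K0 := K0) (K1 := K1) (fund_mem (M := M) (d := d))
    (by rw [hu]; exact CC_le_CS _ _ fund_mem)
  refine ⟨a0, CC_mono s0 _ ha0, ?_, ?_⟩
  · have e : bd a0 = bd a1 := by
      apply add_eq_zero_iff'.1
      rw [← map_add, ← h, hf]
    refine supported_inter_mem (bd_mem_CS h0 (CC_le_CS _ _ ha0)) ?_
    change bd a0 ∈ CS K1
    rw [e]
    exact bd_mem_CS h1 (CC_le_CS _ _ ha1)
  · intro e he hcon
    rcases mem_RR_top he with rfl | rfl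
    · rw [add_zero] at hcon
      apply n1
      rw [h]
      exact Submodule.add_mem _ (CS_mono Set.inter_subset_right hcon) (CC_le_CS _ _ ha1)
    · apply n0
      have := Submodule.add_mem _ (CS_mono Set.inter_subset_left hcon) (CC_le_CS _ _ ha0)
      have h2 : a0 + fund M d + a0 = fund M d := by
        have := two_self a0
        grind
      rwa [h2] at this

/-! ### the faces meeting a given face -/

/-- `G` meets `F`, and the intersection contains all the directions in `J` -/
def QQ (F : CubeFace n) (J : Finset (Fin n)) (G : CubeFace n) : Prop :=
  Meets G F ∧ ∀ i ∈ J, G i = none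

/-- the faces in `M` not satisfying `QQ` -/
def KK (M : Set (CubeFace n)) (F : CubeFace n) (J : Finset (Fin n)) : Set (CubeFace n) :=
  {G | G ∈ M ∧ ¬ QQ F J G}

theorem KK_sub (F : CubeFace n) (J : Finset (Fin n)) : KK M F J ⊆ M := fun _ h => h.1

theorem KK_down (hM : Down M) (F : CubeFace n) (J : Finset (Fin n)) : Down (KK M F J) := by
  rintro G ⟨h1, h2⟩ G' hG
  refine ⟨hM G h1 G' hG, fun h => h2 ⟨fun i => ?_, fun i hi => ?_⟩⟩
  · rcases hG i with h3 | h3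
    · exact Or.inl h3
    · rw [← h3]; exact h.1 i
  · rcases hG i with h3 | h3
    · exact h3
    · rw [← h3]; exact h.2 i hi

theorem meets_upd {F G : CubeFace n} {i : Fin n} (hi : F i = none) (b : Bool) :
    Meets G (upd F i (some b)) ↔ Meets G F ∧ (G i = none ∨ G i = some b) := by
  constructor
  · intro h
    refine ⟨fun j => ?_, ?_⟩
    · by_cases hj : j = i
      · subst hj; exact Or.inr (Or.inl hi)
      · have := h j
        rwa [upd_ne _ hj] at this
    · have := h i
      simpa using this
  · rintro ⟨h1, h2⟩ j
    by_cases hj : j = i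
    · subst hj; simpa using h2
    · rw [upd_ne _ hj]; exact h1 j

theorem KK_inter {F : CubeFace n} {J : Finset (Fin n)} {i : Fin n} (hi : F i = none) :
    KK M (upd F i (some false)) J ∩ KK M (upd F i (some true)) J = KK M F J := by
  ext G
  have : QQ F J G ↔ QQ (upd F i (some false)) J G ∨ QQ (upd F i (some true)) J G := by
    simp only [QQ, meets_upd hi]
    rcases G i with _ | b
    · simp
    · cases b <;> simp
  simp only [KK, Set.mem_inter_iff, Set.mem_ofPred_eq, this]
  tauto

theorem KK_union {F : CubeFace n} {J : Finset (Fin n)} {i : Fin n} (hi : F i = none) :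
    KK M (upd F i (some false)) J ∪ KK M (upd F i (some true)) J = KK M F (insert i J) := by
  ext G
  have : QQ F (insert i J) G ↔ QQ (upd F i (some false)) J G ∧ QQ (upd F i (some true)) J G := by
    simp only [QQ, meets_upd hi, Finset.forall_mem_insert]
    rcases G i with _ | b
    · simp
    · cases b <;> simp
  simp only [KK, Set.mem_union, Set.mem_ofPred_eq, this]
  tauto

open Classical in
/-- the free directions of `F` outside `J` -/
def frJ (F : CubeFace n) (J : Finset (Fin n)) : Finset (Fin n) :=
  Finset.univ.filter fun i => F i = none ∧ i ∉ J

open Classical in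
theorem frJ_upd {F : CubeFace n} {J : Finset (Fin n)} {i : Fin n} (hi : i ∈ frJ F J) (b : Bool) :
    (frJ (upd F i (some b)) J).card + 1 = (frJ F J).card := by
  have : frJ (upd F i (some b)) J = (frJ F J).erase i := by
    ext j
    simp only [frJ, Finset.mem_filter, Finset.mem_univ, true_and, Finset.mem_erase]
    by_cases hj : j = i
    · subst hj; simp
    · simp [upd_ne _ hj, hj]
  rw [this, Finset.card_erase_add_one hi]

open Classical in
theorem frJ_insert {F : CubeFace n} {J : Finset (Fin n)} {i : Fin n} (hi : i ∈ frJ F J) :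
    (frJ F (insert i J)).card + 1 = (frJ F J).card := by
  have : frJ F (insert i J) = (frJ F J).erase i := by
    ext j
    simp only [frJ, Finset.mem_filter, Finset.mem_univ, true_and, Finset.mem_erase,
      Finset.mem_insert, not_or]
    tauto
  rw [this, Finset.card_erase_add_one hi]

theorem KK_full {F : CubeFace n} {J : Finset (Fin n)} (hJ : ∀ i ∈ J, F i = none)
    (h : frJ F J = ∅) : KK M F J = MA M F := by
  ext G
  have : QQ F J G ↔ F ≤ G := by
    constructor
    · rintro ⟨h1, h2⟩ i
      by_cases hi : i ∈ J
      · exact Or.inl (h2 i hi)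
      · have h3 : F i ≠ none := by
          intro h3
          have : i ∈ frJ F J := by simp [frJ, h3, hi]
          rw [h] at this; simp at this
        rcases h1 i with h4 | h4 | h4
        · exact Or.inl h4
        · exact absurd h4 h3
        · exact Or.inr h4.symm
    · intro h1
      refine ⟨fun i => ?_, fun i hi => ?_⟩
      · rcases h1 i with h | h
        · exact Or.inl h
        · exact Or.inr (Or.inr h.symm)
      · rcases h1 i with h | h
        · exact h
        · rw [← h]; exact hJ i hi
  simp only [KK, MA, Set.mem_ofPred_eq, this]

theorem good_KK (hM : Down M) (hdim : ∀ F ∈ M, dim F ≤ d) (hf : bd (fund M d) = 0)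
    (hg : ∀ A ∈ M, Good M d (MA M A)) (r : ℕ) :
    ∀ (F : CubeFace n) (J : Finset (Fin n)), F ∈ M → (∀ i ∈ J, F i = none) →
      (frJ F J).card = r → Good M d (KK M F J) := by
  induction r with
  | zero =>
    intro F J hF hJ hr
    rw [KK_full hJ (Finset.card_eq_zero.1 hr)]
    exact hg F hF
  | succ r ih =>
    intro F J hF hJ hr
    obtain ⟨i, hi⟩ : (frJ F J).Nonempty := by rw [← Finset.card_pos]; omega
    have hi' : F i = none ∧ i ∉ J := by simpa [frJ] using hi
    have hJb : ∀ b, ∀ i' ∈ J, upd F i (some b) i' = none := by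
      intro b i' h
      rw [upd_ne _ (by rintro rfl; exact hi'.2 h)]
      exact hJ i' h
    have hb : ∀ b, Good M d (KK M (upd F i (some b)) J) := fun b =>
      ih _ J (hM F hF _ (upd_some_le F i _ hi'.1)) (hJb b) (by have := frJ_upd hi b; omega)
    have hu : Good M d (KK M F (insert i J)) := ih F _ hF (by
      intro i' h
      rcases Finset.mem_insert.1 h with rfl | h
      · exact hi'.1
      · exact hJ _ h) (by have := frJ_insert hi; omega)
    rw [← KK_inter hi'.1]
    rw [← KK_union hi'.1] at hu
    refine ⟨fun j => ?_, fun h => (hb false).2 (CS_mono Set.inter_subset_left h)⟩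
    exact MV_inter hM hdim hf (KK_down hM _ _) (KK_down hM _ _) (KK_sub _ _) (KK_sub _ _)
      ((hb false).1 j) ((hb true).1 j) (hu.1 _) hu.2

theorem bad_KK (hM : Down M) (hdim : ∀ F ∈ M, dim F ≤ d) (hf : bd (fund M d) = 0)
    (hg : ∀ A ∈ M, Good M d (MA M A)) {F : CubeFace n} (hF : F ∉ M)
    (hFb : ∀ i b, F i = none → upd F i (some b) ∈ M) (r : ℕ) :
    ∀ (J : Finset (Fin n)), (∀ i ∈ J, F i = none) →
      (frJ F J).card = r + 1 → (∀ j, j + (r + 1) ≠ d + 1 → Zr M d (KK M F J) j) ∧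
        (∀ j, j + (r + 1) = d + 1 → Non M d (KK M F J) j) ∧ fund M d ∉ CS (KK M F J) := by
  have step : ∀ J : Finset (Fin n), (∀ i ∈ J, F i = none) → ∀ i ∈ frJ F J, F i = none ∧
      (∀ b, Good M d (KK M (upd F i (some b)) J)) ∧ (∀ i' ∈ insert i J, F i' = none) := by
    intro J hJ i hi
    have hi' : F i = none ∧ i ∉ J := by simpa [frJ] using hi
    refine ⟨hi'.1, fun b => good_KK hM hdim hf hg _ _ J (hFb i b hi'.1) ?_ rfl, ?_⟩
    · intro i' h
      rw [upd_ne _ (by rintro rfl; exact hi'.2 h)]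
      exact hJ i' h
    · intro i' h
      rcases Finset.mem_insert.1 h with rfl | h
      · exact hi'.1
      · exact hJ _ h
  induction r with
  | zero =>
    intro J hJ hr
    obtain ⟨i, hi⟩ : (frJ F J).Nonempty := by rw [← Finset.card_pos]; omega
    obtain ⟨h1, h2, h3⟩ := step J hJ i hi
    have hc : (frJ F (insert i J)).card = 0 := by have := frJ_insert hi; omega
    have hu : KK M F (insert i J) = M := by
      rw [KK_full h3 (Finset.card_eq_zero.1 hc)]
      ext G
      exact ⟨fun h => h.1, fun h => ⟨h, fun h' => hF (hM G h F h')⟩⟩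
    rw [← KK_union h1] at hu
    rw [← KK_inter h1]
    refine ⟨fun j hj => ?_, fun j hj => ?_, fun h => (h2 false).2 (CS_mono Set.inter_subset_left h)⟩
    · have hj : j ≠ d := by omega
      intro c hc hb
      -- use the Mayer-Vietoris argument with trivial union
      obtain ⟨e0, he0, k0⟩ := (h2 false).1 j c hc (CS_mono Set.inter_subset_left hb)
      obtain ⟨e1, he1, k1⟩ := (h2 true).1 j c hc (CS_mono Set.inter_subset_right hb)
      obtain ⟨y0, hy0, rfl⟩ := (mem_RR hj).1 he0
      obtain ⟨y1, hy1, rfl⟩ := (mem_RR hj).1 he1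
      obtain ⟨b0, hb0, b1, hb1, hbb⟩ := CS_union_split (K0 := KK M (upd F i (some false)) J)
        (K1 := KK M (upd F i (some true)) J) (Submodule.add_mem _ hy0 hy1)
        (by rw [hu]; exact CC_le_CS _ _ (Submodule.add_mem _ hy0 hy1))
      refine ⟨bd (y0 + b0), (mem_RR hj).2
        ⟨_, Submodule.add_mem _ hy0 (CC_mono (KK_sub _ _) _ hb0), rfl⟩, ?_⟩
      refine supported_inter_mem ?_ ?_
      · rw [map_add, ← add_assoc]
        exact Submodule.add_mem _ k0 (bd_mem_CS (KK_down hM _ _) (CC_le_CS _ _ hb0))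
      · have h3 : y0 + b0 = y1 + b1 := by
          have e1 := two_self y1
          have e2 := two_self b0
          grind
        rw [h3, map_add, ← add_assoc]
        exact Submodule.add_mem _ k1 (bd_mem_CS (KK_down hM _ _) (CC_le_CS _ _ hb1))
    · have hj : j = d := by omega
      subst hj
      exact MV_base hf (KK_down hM _ _) (KK_down hM _ _) (KK_sub _ _) hu (h2 false).2 (h2 true).2
  | succ r ih =>
    intro J hJ hr
    obtain ⟨i, hi⟩ : (frJ F J).Nonempty := by rw [← Finset.card_pos]; omega
    obtain ⟨h1, h2, h3⟩ := step J hJ i hi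
    obtain ⟨u1, u2, u3⟩ := ih (insert i J) h3 (by have := frJ_insert hi; omega)
    rw [← KK_union h1] at u1 u2 u3
    rw [← KK_inter h1]
    refine ⟨fun j hj => ?_, fun j hj => ?_, fun h => (h2 false).2 (CS_mono Set.inter_subset_left h)⟩
    · exact MV_inter hM hdim hf (KK_down hM _ _) (KK_down hM _ _) (KK_sub _ _) (KK_sub _ _)
        ((h2 false).1 j) ((h2 true).1 j) (u1 _ (by omega)) u3
    · exact MV_non hM hdim (KK_down hM _ _) (KK_down hM _ _) (KK_sub _ _)
        ((h2 false).1 _) ((h2 true).1 _) (u2 _ (by omega))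

end
end BF


namespace BF
open CubeFace
noncomputable section

variable {n d : ℕ} {M K : Set (CubeFace n)}

/-- the homology of a complex -/
abbrev HH (K : Set (CubeFace n)) (j : ℕ) : Type := Hq bd (CC K j) (CC K (j + 1))

/-- inclusion of cycles -/
def cycInc (hKM : K ⊆ M) (j : ℕ) : ↥(CC K j ⊓ LinearMap.ker bd) →ₗ[ZMod 2]
    ↥(CC M j ⊓ LinearMap.ker bd) :=
  Submodule.inclusion (inf_le_inf_right _ (CC_mono hKM j))

/-- induced map on homology -/
def homInc (hKM : K ⊆ M) (j : ℕ) : HH K j →ₗ[ZMod 2] HH M j :=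
  Submodule.mapQ _ _ (cycInc hKM j) (by
    rintro ⟨c, hc⟩ ⟨e, he, h⟩
    exact ⟨e, CC_mono hKM _ he, h⟩)

/-- injectivity, elementwise -/
def IncInj (M K : Set (CubeFace n)) (j : ℕ) : Prop :=
  ∀ c ∈ CC K j, bd c = 0 → (∃ e ∈ CC M (j + 1), c = bd e) → ∃ e ∈ CC K (j + 1), c = bd e

/-- surjectivity, elementwise -/
def IncSurj (M K : Set (CubeFace n)) (j : ℕ) : Prop :=
  ∀ c ∈ CC M j, bd c = 0 → ∃ e ∈ CC M (j + 1), c + bd e ∈ CS K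

theorem homInc_inj (hKM : K ⊆ M) (j : ℕ) :
    Function.Injective (homInc hKM j) ↔ IncInj M K j := by
  rw [← LinearMap.ker_eq_bot, eq_bot_iff]
  constructor
  · rintro h c hc hb ⟨e, he, hce⟩
    have h1 : (Submodule.Quotient.mk ⟨c, hc, hb⟩ : HH K j) ∈ LinearMap.ker (homInc hKM j) := by
      change homInc hKM j _ = 0
      refine (Submodule.Quotient.mk_eq_zero _).2 ?_
      exact ⟨e, he, hce.symm⟩
    have h2 : (Submodule.Quotient.mk ⟨c, hc, hb⟩ : HH K j) = 0 := h h1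
    obtain ⟨e, he, h⟩ := (Submodule.Quotient.mk_eq_zero _).1 h2
    exact ⟨e, he, h.symm⟩
  · rintro h x hx
    obtain ⟨⟨c, hc, hb⟩, rfl⟩ := Submodule.mkQ_surjective _ x
    obtain ⟨e, he, h1⟩ := (Submodule.Quotient.mk_eq_zero _).1 hx
    obtain ⟨e', he', h2⟩ := h c hc hb ⟨e, he, h1.symm⟩
    refine (Submodule.Quotient.mk_eq_zero _).2 ?_
    exact ⟨e', he', h2.symm⟩

theorem homInc_surj (hM : Down M) (hKM : K ⊆ M) (j : ℕ) :
    Function.Surjective (homInc hKM j) ↔ IncSurj M K j := by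
  have neg : ∀ v : Cell n, -v = v := fun v => by
    rw [neg_eq_iff_add_eq_zero]; exact two_self v
  constructor
  · rintro h c hc hb
    obtain ⟨x, hx⟩ := h (Submodule.Quotient.mk ⟨c, hc, hb⟩)
    obtain ⟨⟨a, ha, hb⟩, rfl⟩ := Submodule.mkQ_surjective _ x
    obtain ⟨e, he, h1⟩ := (Submodule.Quotient.eq _).1 hx
    refine ⟨e, he, ?_⟩
    have h2 : bd e = a - c := h1
    rw [h2, add_sub_cancel]
    exact CC_le_CS _ _ ha
  · intro h x
    obtain ⟨⟨c, hc, hb⟩, rfl⟩ := Submodule.mkQ_surjective _ x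
    obtain ⟨e, he, h1⟩ := h c hc hb
    have h2 : c + bd e ∈ CC K j := CC_of_CS (Submodule.add_mem _ hc (bd_mem hM he)) h1
    refine ⟨Submodule.Quotient.mk ⟨c + bd e, h2, ?_⟩, ?_⟩
    · change bd (c + bd e) = 0
      rw [map_add, hb, bd_bd, add_zero]
    · refine (Submodule.Quotient.eq _).2 ?_
      refine ⟨e, he, ?_⟩
      change bd e = c + bd e - c
      abel

theorem inj_iff_surj (hM : Down M) (hKM : K ⊆ M) (j : ℕ)
    (h : Nonempty (HH K j ≃ₗ[ZMod 2] HH M j)) : IncInj M K j ↔ IncSurj M K j := by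
  rw [← homInc_inj hKM, ← homInc_surj hM hKM]
  obtain ⟨e⟩ := h
  exact LinearMap.injective_iff_surjective_of_finrank_eq_finrank e.finrank_eq

theorem equiv_of_inc (hM : Down M) (hKM : K ⊆ M) (j : ℕ) (h1 : IncInj M K j)
    (h2 : IncSurj M K j) : Nonempty (HH K j ≃ₗ[ZMod 2] HH M j) :=
  ⟨LinearEquiv.ofBijective (homInc hKM j)
    ⟨(homInc_inj hKM j).2 h1, (homInc_surj hM hKM j).2 h2⟩⟩

theorem surj_of_Zr {j : ℕ} (hj : j ≠ d) (h : Zr M d K j) : IncSurj M K j := by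
  intro c hc hb
  obtain ⟨e, he, k⟩ := h c hc (by rw [hb]; exact Submodule.zero_mem _)
  obtain ⟨y, hy, rfl⟩ := (mem_RR hj).1 he
  exact ⟨y, hy, k⟩

theorem inj_of_Zr (hM : Down M) {j : ℕ} (hj : j + 1 ≠ d) (h : Zr M d K (j + 1)) :
    IncInj M K j := by
  rintro c hc hb ⟨e, he, rfl⟩
  obtain ⟨t, ht, k⟩ := h e he (CC_le_CS _ _ hc)
  obtain ⟨y, hy, rfl⟩ := (mem_RR hj).1 ht
  refine ⟨e + bd y, CC_of_CS (Submodule.add_mem _ he (bd_mem hM hy)) k, ?_⟩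
  rw [map_add, bd_bd, add_zero]

theorem cell_iso (hM : Down M) (hK : Down K) (j : ℕ) :
    Nonempty (sHomology (ZMod 2) (↥(real K)) j ≅ sHomology (ZMod 2) (↥(real M)) j) ↔
      Nonempty (HH K j ≃ₗ[ZMod 2] HH M j) := by
  obtain ⟨e1⟩ := sHom_cell hK j
  obtain ⟨e2⟩ := sHom_cell hM j
  constructor
  · rintro ⟨e⟩
    exact ⟨e1.symm.trans (e.toLinearEquiv.trans e2)⟩
  · rintro ⟨e⟩
    exact ⟨(e1.trans (e.trans e2.symm)).toModuleIso⟩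

theorem main_forward {k : ℕ} (hk : 2 ≤ k) (hkd : k ≤ d) (hM : Down M) (hK : Down K) (hKM : K ⊆ M)
    (hg : ∀ j, Zr M d K j) :
    Nonempty (sHomology (ZMod 2) (↥(real K)) (d - k) ≅ sHomology (ZMod 2) (↥(real M)) (d - k)) ∧
    Nonempty (sHomology (ZMod 2) (↥(real K)) (d - k - 1) ≅
      sHomology (ZMod 2) (↥(real M)) (d - k - 1)) := by
  rw [cell_iso hM hK, cell_iso hM hK]
  have : ∀ j, j + 1 < d → Nonempty (HH K j ≃ₗ[ZMod 2] HH M j) := fun j hj =>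
    equiv_of_inc hM hKM j (inj_of_Zr hM (by omega) (hg _)) (surj_of_Zr (d := d) (by omega) (hg _))
  exact ⟨this _ (by omega), this _ (by omega)⟩

theorem main_backward {k : ℕ} (hk : 2 ≤ k) (hkd : k ≤ d) (hM : Down M) (hK : Down K) (hKM : K ⊆ M)
    (hz : ∀ j, j + (k + 1) ≠ d + 1 → Zr M d K j) (hn : ∀ j, j + (k + 1) = d + 1 → Non M d K j)
    (h1 : Nonempty (sHomology (ZMod 2) (↥(real K)) (d - k) ≅
      sHomology (ZMod 2) (↥(real M)) (d - k)))
    (h2 : Nonempty (sHomology (ZMod 2) (↥(real K)) (d - k - 1) ≅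
      sHomology (ZMod 2) (↥(real M)) (d - k - 1))) : False := by
  rw [cell_iso hM hK] at h1 h2
  have s1 : IncSurj M K (d - k) :=
    (inj_iff_surj hM hKM _ h1).1 (inj_of_Zr hM (by omega) (hz _ (by omega)))
  obtain ⟨c, hc, hcb, hne⟩ := hn (d - k) (by omega)
  have hne' : ∀ e ∈ CC M (d - k + 1), c + bd e ∉ CS K := fun e he =>
    hne _ ((mem_RR (by omega)).2 ⟨e, he, rfl⟩)
  by_cases h0 : d - k = 0
  · rw [h0] at s1 hc hne'
    obtain ⟨e, he, h⟩ := s1 c hc (bd_zero hc)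
    exact hne' e he h
  · obtain ⟨m, hm⟩ : ∃ m, d - k = m + 1 := ⟨d - k - 1, by omega⟩
    rw [hm] at s1 hc hne' h2
    rw [Nat.add_sub_cancel] at h2
    have i2 : IncInj M K m :=
      (inj_iff_surj hM hKM _ h2).2 (surj_of_Zr (d := d) (by omega) (hz _ (by omega)))
    obtain ⟨y, hy, h⟩ := i2 (bd c) (CC_of_CS (bd_mem hM hc) hcb) (bd_bd _) ⟨c, hc, rfl⟩
    obtain ⟨e, he, h'⟩ := s1 (c + y) (Submodule.add_mem _ hc (CC_mono hKM _ hy))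
      (by rw [map_add, h, two_self])
    apply hne' e he
    have := Submodule.add_mem _ h' (CC_le_CS _ _ hy)
    have h3 : c + y + bd e + y = c + bd e := by
      have := two_self y
      grind
    rwa [h3] at this

end
end BF


namespace BF
open CubeFace
noncomputable section

/-! ### rigidity of cube boundaries -/

/-- flip a coordinate -/
def fl {m : ℕ} (v : Fin m → Bool) (i : Fin m) : Fin m → Bool := fun j => if j = i then !(v j) else v j

theorem fl_same {m : ℕ} (v : Fin m → Bool) (i : Fin m) : fl v i i = !(v i) := by simp [fl]

theorem fl_ne {m : ℕ} (v : Fin m → Bool) {i j : Fin m} (h : j ≠ i) : fl v i j = v j := by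
  simp [fl, h]

theorem fl_fl {m : ℕ} (v : Fin m → Bool) (i : Fin m) : fl (fl v i) i = v := by
  funext j
  by_cases h : j = i
  · subst h; simp [fl_same]
  · simp [fl_ne _ h]

theorem fl_comm {m : ℕ} (v : Fin m → Bool) (i j : Fin m) : fl (fl v i) j = fl (fl v j) i := by
  funext k
  simp only [fl]
  split_ifs <;> rfl

theorem fl_inj {m : ℕ} {v : Fin m → Bool} {i j : Fin m} (h : fl v i = fl v j) : i = j := by
  by_contra hne
  have := congrFun h i
  rw [fl_same, fl_ne _ hne] at this
  simp at this

theorem cube_induction {m : ℕ} {P : (Fin m → Bool) → Prop} (h0 : P fun _ => false)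
    (hs : ∀ v i, P v → P (fl v i)) (v : Fin m → Bool) : P v := by
  classical
  have key : ∀ s : Finset (Fin m), P fun i => if i ∈ s then v i else false := by
    intro s
    induction s using Finset.induction_on with
    | empty => simpa using h0
    | insert i s his ih =>
      by_cases hv : v i = true
      · convert hs _ i ih using 1
        funext j
        by_cases hj : j = i
        · subst hj; simp [fl_same, his, hv]
        · simp [fl_ne _ hj, hj]
      · convert ih using 1
        funext j
        by_cases hj : j = i
        · subst hj; simp [his, hv]
        · simp [hj]
  simpa using key Finset.univ

theorem vert_mem {n : ℕ} {v : Fin n → Bool} {F : CubeFace n} : v ∈ verts F ↔ toFace v ≤ F := Iff.rfl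

theorem fl_mem {n : ℕ} {v : Fin n → Bool} {F : CubeFace n} (h : v ∈ verts F) {i : Fin n}
    (hi : F i = none) : fl v i ∈ verts F := by
  intro j
  by_cases hj : j = i
  · subst hj; exact Or.inl hi
  · rcases h j with h1 | h1
    · exact Or.inl h1
    · right
      rw [← h1]
      change some (fl v i j) = some (v j)
      rw [fl_ne _ hj]

theorem verts_val {n : ℕ} {v : Fin n → Bool} {F : CubeFace n} (h : v ∈ verts F) {i : Fin n} {b : Bool}
    (hi : F i = some b) : v i = b := by
  rcases h i with h1 | h1
  · rw [hi] at h1; simp at h1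
  · rw [hi] at h1; exact Option.some.inj h1

theorem le_of_verts {n : ℕ} {F G : CubeFace n} (h : verts F ⊆ verts G) : F ≤ G := by
  intro i
  rcases hG : G i with _ | b
  · exact Or.inl rfl
  · right
    have h1 : someVert F ∈ verts F := someVert_le F
    have h2 := verts_val (h h1) hG
    rcases hF : F i with _ | b'
    · have h3 := verts_val (h (fl_mem h1 hF)) hG
      rw [fl_same, h2] at h3
      simp at h3
    · rw [← verts_val h1 hF, h2]

theorem verts_inj {n : ℕ} {F G : CubeFace n} (h : verts F = verts G) : F = G :=
  le_antisymm (le_of_verts h.le) (le_of_verts h.ge)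

theorem edge_verts {m : ℕ} (v : Fin m → Bool) (i : Fin m) :
    verts (upd (toFace v) i none) = {v, fl v i} := by
  ext w
  constructor
  · intro h
    have h1 : ∀ j, j ≠ i → w j = v j := fun j hj =>
      verts_val h (by rw [upd_ne _ hj]; rfl)
    by_cases hw : w i = v i
    · left
      funext j
      by_cases hj : j = i
      · subst hj; exact hw
      · exact h1 j hj
    · right
      funext j
      by_cases hj : j = i
      · subst hj
        rw [fl_same]
        cases h3 : w j <;> cases h4 : v j <;> simp_all
      · rw [fl_ne _ hj]; exact h1 j hj
  · have hv : v ∈ verts (upd (toFace v) i none) := by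
      intro j
      by_cases hj : j = i
      · subst hj; left; exact upd_same _ _ _
      · right; exact (upd_ne _ hj _).symm
    rintro (rfl | rfl)
    · exact hv
    · exact fl_mem hv (upd_same _ _ _)

theorem rigid_dir {m n : ℕ} {g : (Fin m → Bool) → (Fin n → Bool)} (hg : Function.Injective g)
    (he : ∀ v i, ∃ c, g (fl v i) = fl (g v) c) :
    ∃ δ : Fin m → Fin n, Function.Injective δ ∧ ∀ v i, g (fl v i) = fl (g v) (δ i) := by
  choose D hD using he
  have h1 : ∀ v i j, D (fl v j) i = D v i := by
    intro v i j
    by_contra hne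
    by_cases hij : i = j
    · subst hij
      have := hD (fl v i) i
      rw [fl_fl, hD v i] at this
      have h2 := congrFun this (D v i)
      rw [fl_ne _ (fun h => hne h.symm), fl_same] at h2
      simp at h2
    · have e1 := hD (fl v i) j
      rw [fl_comm, hD (fl v j) i, hD v i, hD v j] at e1
      have hab : D (fl v i) j ≠ D v i := by
        intro h
        have := hD (fl v i) j
        rw [h, hD v i, fl_fl] at this
        have := congrFun (hg this) i
        rw [fl_ne _ hij, fl_same] at this
        simp at this
      have hac : D v j ≠ D v i := by
        intro h
        have := hD v j
        rw [h, ← hD v i] at this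
        exact hij (fl_inj (hg this)).symm
      have h2 := congrFun e1 (D v i)
      rw [fl_ne _ (fun h => hne h.symm), fl_ne _ hac.symm, fl_ne _ hab.symm, fl_same] at h2
      simp at h2
  have h2 : ∀ v i, D v i = D (fun _ => false) i := by
    intro v i
    refine cube_induction (P := fun v => D v i = D (fun _ => false) i) rfl ?_ v
    intro v j h
    rw [h1, h]
  refine ⟨D fun _ => false, ?_, fun v i => ?_⟩
  · intro i j h
    have h3 := hD (fun _ => false) i
    rw [h, ← hD] at h3
    exact fl_inj (hg h3)
  · rw [hD, h2]

/-- the face spanned by an embedded cube -/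
def phi {m n : ℕ} (δ : Fin m → Fin n) (p : Fin n → Bool) (G : CubeFace m) : CubeFace n :=
  Function.extend δ (fun i => (G i).map (xor (p (δ i)))) (fun x => some (p x))

theorem phi_on {m n : ℕ} {δ : Fin m → Fin n} (hδ : Function.Injective δ) (p : Fin n → Bool)
    (G : CubeFace m) (i : Fin m) : phi δ p G (δ i) = (G i).map (xor (p (δ i))) :=
  hδ.extend_apply _ _ _

theorem phi_off {m n : ℕ} {δ : Fin m → Fin n} (p : Fin n → Bool)
    (G : CubeFace m) {x : Fin n} (hx : ¬ ∃ i, δ i = x) : phi δ p G x = some (p x) :=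
  Function.extend_apply' _ _ _ hx

theorem phi_inj {m n : ℕ} {δ : Fin m → Fin n} (hδ : Function.Injective δ) (p : Fin n → Bool)
    {G : CubeFace m} (h : phi δ p G = phi δ p (topF m)) : G = topF m := by
  apply face_ext
  intro i
  have := congrFun h (δ i)
  rw [phi_on hδ, phi_on hδ] at this
  simpa [topF] using this

theorem phi_le {m n : ℕ} {δ : Fin m → Fin n} (hδ : Function.Injective δ) (p : Fin n → Bool)
    (G : CubeFace m) : phi δ p G ≤ phi δ p (topF m) := by
  intro x
  by_cases hx : ∃ i, δ i = x
  · obtain ⟨i, rfl⟩ := hx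
    left; rw [phi_on hδ]; rfl
  · right; rw [phi_off p _ hx, phi_off p _ hx]

theorem xor_xor' (a b : Bool) : xor a (xor a b) = b := by cases a <;> cases b <;> rfl

/-- pull back a face along an embedded cube -/
def pull {m n : ℕ} (δ : Fin m → Fin n) (p : Fin n → Bool) (H : CubeFace n) : CubeFace m :=
  fun i => (H (δ i)).map (xor (p (δ i)))

theorem phi_surj {m n : ℕ} {δ : Fin m → Fin n} (hδ : Function.Injective δ) (p : Fin n → Bool)
    {H : CubeFace n} (h : H ≤ phi δ p (topF m)) : ∃ G, H = phi δ p G := by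
  refine ⟨pull δ p H, face_ext fun x => ?_⟩
  by_cases hx : ∃ i, δ i = x
  · obtain ⟨i, rfl⟩ := hx
    refine Eq.trans ?_ (phi_on hδ p _ i).symm
    change H (δ i) = ((H (δ i)).map _).map _
    rcases H (δ i) with _ | b
    · rfl
    · simp
  · refine Eq.trans ?_ (phi_off p _ hx).symm
    rcases h x with h1 | h1
    · rw [phi_off p _ hx] at h1; simp at h1
    · exact h1.trans (phi_off p _ hx)

theorem phi_dim {m n : ℕ} {δ : Fin m → Fin n} (hδ : Function.Injective δ) (p : Fin n → Bool) :
    dim (phi δ p (topF m)) = m := by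
  classical
  rw [dim_eq]
  have : Finset.univ.filter (fun x => phi δ p (topF m) x = none) = Finset.univ.image δ := by
    ext x
    simp only [Finset.mem_filter, Finset.mem_univ, true_and, Finset.mem_image]
    by_cases hx : ∃ i, δ i = x
    · refine ⟨fun _ => hx, fun _ => ?_⟩
      obtain ⟨i, rfl⟩ := hx
      rw [phi_on hδ]; rfl
    · rw [phi_off p _ hx]; simp [not_exists.1 hx]
  rw [this, Finset.card_image_of_injective _ hδ]; simp

theorem phi_verts {m n : ℕ} {g : (Fin m → Bool) → (Fin n → Bool)} {δ : Fin m → Fin n}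
    (hδ : Function.Injective δ) (h : ∀ v i, g (fl v i) = fl (g v) (δ i)) (G : CubeFace m) :
    verts (phi δ (g fun _ => false) G) = g '' verts G := by
  set p := g fun _ => false with hp
  have hon : ∀ v i, g v (δ i) = xor (p (δ i)) (v i) := by
    intro v
    refine cube_induction (P := fun v => ∀ i, g v (δ i) = xor (p (δ i)) (v i)) ?_ ?_ v
    · intro i; rw [← hp]; simp
    · intro v j hv i
      rw [h]
      by_cases hij : i = j
      · subst hij; rw [fl_same, fl_same, hv]; simp
      · rw [fl_ne _ (fun h => hij (hδ h)), fl_ne _ hij, hv]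
  have hoff : ∀ v x, (¬ ∃ i, δ i = x) → g v x = p x := by
    intro v
    refine cube_induction (P := fun v => ∀ x, (¬ ∃ i, δ i = x) → g v x = p x) ?_ ?_ v
    · intro i _; rfl
    · intro v j hv x hx
      rw [h, fl_ne _ (fun h => hx ⟨j, h.symm⟩), hv x hx]
  ext w
  constructor
  · intro hw
    refine ⟨fun i => xor (p (δ i)) (w (δ i)), ?_, ?_⟩
    · intro i
      rcases hG : G i with _ | b
      · exact Or.inl rfl
      · right
        have := verts_val hw (i := δ i) (by rw [phi_on hδ, hG]; rfl)
        change some (xor (p (δ i)) (w (δ i))) = some b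
        rw [this, xor_xor']
    · funext x
      by_cases hx : ∃ i, δ i = x
      · obtain ⟨i, rfl⟩ := hx
        rw [hon, xor_xor']
      · rw [hoff _ _ hx, verts_val hw (phi_off p _ hx)]
  · rintro ⟨v, hv, rfl⟩ x
    by_cases hx : ∃ i, δ i = x
    · obtain ⟨i, rfl⟩ := hx
      rw [phi_on hδ]
      rcases hG : G i with _ | b
      · exact Or.inl rfl
      · right
        change some (g v (δ i)) = some (xor (p (δ i)) b)
        rw [hon, verts_val hv hG]
    · right
      rw [phi_off p _ hx]
      exact congrArg some (hoff v x hx)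

theorem rigidity {n k : ℕ} (hk : 2 ≤ k) {S : Set (CubeFace n)} (hS : IsSubcomplex S)
    (hiso : Iso S (boundaryCube (k + 1))) : ∃ F : CubeFace n, dim F = k + 1 ∧ S = bdryHat F := by
  obtain ⟨f, hf, hW⟩ := hiso
  have hall : ∀ v, v ∈ cvert (boundaryCube (k + 1)) := by
    intro v h
    have := congrFun h ⟨0, by omega⟩
    simp [toFace] at this
  choose g hgS hgf using fun v => hf.surjOn (hall v)
  have hinj : Function.Injective g := fun v w h => by rw [← hgf v, h, hgf w]
  have hgf2 : ∀ x ∈ cvert S, g (f x) = x := fun x hx =>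
    hf.injOn (hgS _) hx (hgf _)
  have himg : ∀ G : CubeFace (k + 1), f '' (g '' verts G) = verts G := by
    intro G
    rw [← Set.image_comp]
    have : f ∘ g = id := funext hgf
    rw [this, Set.image_id]
  have hsub : ∀ G : CubeFace (k + 1), g '' verts G ⊆ cvert S := by
    rintro G _ ⟨v, -, rfl⟩; exact hgS v
  have hface : ∀ G ∈ boundaryCube (k + 1), ∃ F ∈ S, verts F = g '' verts G := fun G hG =>
    (hW _ (hsub G)).2 ⟨G, hG, (himg G).symm⟩
  have hedge : ∀ v i, ∃ c, g (fl v i) = fl (g v) c := by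
    intro v i
    obtain ⟨i', hi'⟩ : ∃ i' : Fin (k + 1), i' ≠ i := by
      have : Nontrivial (Fin (k + 1)) := Fin.nontrivial_iff_two_le.2 (by omega)
      exact exists_ne i
    obtain ⟨F, hF, hFv⟩ := hface (upd (toFace v) i none) (by
      intro h
      have := congrFun h i'
      rw [upd_ne _ hi'] at this
      simp [toFace] at this)
    rw [edge_verts, Set.image_pair] at hFv
    have h1 : g v ∈ verts F := by rw [hFv]; simp
    have h2 : g (fl v i) ∈ verts F := by rw [hFv]; simp
    have hne : g v ≠ g (fl v i) := by
      intro h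
      have := congrFun (hinj h) i
      rw [fl_same] at this
      simp at this
    obtain ⟨c, hc⟩ := Function.ne_iff.1 hne
    have hFc : F c = none := by
      rcases hb : F c with _ | b
      · rfl
      · exact absurd ((verts_val h1 hb).trans (verts_val h2 hb).symm) hc
    have h3 := fl_mem h1 hFc
    rw [hFv] at h3
    refine ⟨c, ?_⟩
    rcases h3 with h3 | h3
    · have := congrFun h3 c
      rw [fl_same] at this
      simp at this
    · exact h3.symm
  obtain ⟨δ, hδ, hg⟩ := rigid_dir hinj hedge
  refine ⟨phi δ (g fun _ => false) (topF _), phi_dim hδ _, ?_⟩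
  ext H
  constructor
  · intro hH
    obtain ⟨G, hG, hGv⟩ := (hW (verts H) fun v hv => hS.2 H hH _ hv).1 ⟨H, hH, rfl⟩
    have h1 : H = phi δ (g fun _ => false) G := by
      apply verts_inj
      rw [phi_verts hδ hg, hGv, ← Set.image_comp]
      ext w
      constructor
      · intro hw
        exact ⟨w, hw, hgf2 w (hS.2 H hH _ hw)⟩
      · rintro ⟨x, hx, rfl⟩
        change g (f x) ∈ verts H
        rw [hgf2 x (hS.2 H hH _ hx)]; exact hx
    rw [h1]
    exact ⟨phi_le hδ _ _, fun h => hG (phi_inj hδ _ h)⟩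
  · rintro ⟨h1, h2⟩
    obtain ⟨G, rfl⟩ := phi_surj hδ _ h1
    obtain ⟨F, hF, hFv⟩ := hface G (fun h => h2 (by rw [h]; rfl))
    rw [← phi_verts hδ hg] at hFv
    rw [← verts_inj hFv]
    exact hF

/-! ### the deletion -/

theorem delete_eq {n : ℕ} (M : Set (CubeFace n)) {F : CubeFace n} (hF : dim F ≠ 0) :
    delete M (bdryHat F) = KK M F ∅ := by
  ext G
  have hv : cvert (bdryHat F) = verts F := by
    ext v
    constructor
    · intro h; exact h.1
    · intro h
      refine ⟨h, fun h' => hF ?_⟩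
      rw [← h']; exact dim_toFace v
  have : QQ F ∅ G ↔ (verts G ∩ verts F).Nonempty := by
    constructor
    · rintro ⟨h, -⟩
      exact ⟨someVert (meet G F), (someVert_le _).trans (meet_le_left _ _),
        (someVert_le _).trans (meet_le_right h)⟩
    · rintro ⟨v, h1, h2⟩
      exact ⟨meets_of_le h1 h2, by simp⟩
  change (G ∈ M ∧ verts G ∩ cvert (bdryHat F) = ∅) ↔ (G ∈ M ∧ ¬ QQ F ∅ G)
  rw [this, hv, Set.not_nonempty_iff_eq_empty]

theorem frJ_empty {n : ℕ} (F : CubeFace n) : (frJ F ∅).card = dim F := by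
  classical
  rw [dim_eq, frJ]
  congr 1
  ext i; simp

end
end BF



open CubeFace in
/-- a subcomplex `S ≅ ∂I^{k+1}` (`k ≥ 2`) of a cubical manifold `M ⊆ I^n`
of dimension `d` is the boundary of a `(k+1)`-face of `M` iff
`H_j(|M ∖ S|; ℤ/2) ≅ H_j(|M|; ℤ/2)` for both `j = d − k` and `j = d − k − 1`. -/
theorem boundary_of_face_iff_homology
    {n d k : ℕ} (hk : 2 ≤ k)
    (M : Set (CubeFace n)) (hM : IsSubcomplex M) (hdim : HasDim M d)
    (hman : IsCompactManifold (↥(real M)) d)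
    (S : Set (CubeFace n)) (hS : IsSubcomplex S) (hSM : S ⊆ M)
    (hiso : Iso S (boundaryCube (k + 1))) :
    (∃ F ∈ M, dim F = k + 1 ∧ S = bdryHat F) ↔
    (Nonempty (sHomology (ZMod 2) (↥(real (delete M S))) (d - k) ≅
        sHomology (ZMod 2) (↥(real M)) (d - k)) ∧
      Nonempty (sHomology (ZMod 2) (↥(real (delete M S))) (d - k - 1) ≅
        sHomology (ZMod 2) (↥(real M)) (d - k - 1))) := by
  have hMd : BF.Down M := hM.2
  have hdim' := hdim.1
  have setup : 2 ≤ d → BF.bd (BF.fund M d) = 0 ∧ ∀ A ∈ M, BF.Good M d (BF.MA M A) := by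
    intro hd
    have hL : ∀ A ∈ M, BF.LinkOK M d A := fun A hA => BF.linkOK hMd hd hdim' hman.2 hA
    exact ⟨BF.fund_cycle hMd hd hdim' hL, fun A hA => BF.good_MA hMd hd hdim' hL hA⟩
  constructor
  · rintro ⟨F, hF, hFd, rfl⟩
    have hkd : k + 1 ≤ d := hFd ▸ hdim' F hF
    obtain ⟨hf, hg⟩ := setup (by omega)
    rw [BF.delete_eq M (by omega : dim F ≠ 0)]
    exact BF.main_forward hk (by omega) hMd (BF.KK_down hMd _ _) (BF.KK_sub _ _)
      (BF.good_KK hMd hdim' hf hg _ F ∅ hF (by simp) rfl).1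
  · rintro ⟨h1, h2⟩
    obtain ⟨F, hFd, rfl⟩ := BF.rigidity hk hS hiso
    refine ⟨F, ?_, hFd, rfl⟩
    by_contra hF
    have hFb : ∀ i b, F i = none → BF.upd F i (some b) ∈ M := by
      intro i b hi
      refine hSM ⟨BF.upd_some_le F i _ hi, fun h => ?_⟩
      have := BF.dim_upd_some F i b hi
      rw [h] at this
      omega
    obtain ⟨i, hi⟩ : ∃ i, F i = none := by
      by_contra! hcon
      have : dim F = 0 := by
        classical
        rw [BF.dim_eq, Finset.card_eq_zero, Finset.filter_eq_empty_iff]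
        exact fun i _ => hcon i
      omega
    have hkd : k ≤ d := by
      have := hdim' _ (hFb i false hi)
      have := BF.dim_upd_some F i false hi
      omega
    obtain ⟨hf, hg⟩ := setup (by omega)
    rw [BF.delete_eq M (by omega : dim F ≠ 0)] at h1 h2
    obtain ⟨u1, u2, -⟩ := BF.bad_KK hMd hdim' hf hg hF hFb k ∅ (by simp)
      (by rw [BF.frJ_empty, hFd])
    exact BF.main_backward hk hkd hMd (BF.KK_down hMd _ _) (BF.KK_sub _ _) u1 u2 h1 h2
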